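/- For the piecewise linear birth function g(u) = ku for u ∈ [0,1) and g(u) = 4 − u for u ≥ 1, with k ∈ (1,3), there exists a continuous strictly decreasing function c_* : [0,∞) → (0,∞) such that the equation u_t = u_xx − u + g(u(t−h,x)) has a wavefront of speed c if and only if c ≥ c_*(h). Furthermore, if k ∈ (1, 5/3), then there is a maximal h_p = h_p(k) ∈ (0, +∞] such that c_*(h) > c_#(h) for all h ∈ [0, h_p). Finally, each wavefront is unique up to translation, and for each fixed h ≥ 0 the equation has at most one non-linearly determined wavefront, i.e. at most one wavefront whose profile satisfies φ(t+s₀) = e^{λ₁ t} + O(e^{(λ₁+σ)t}) as t → −∞ for some s₀ ∈ ℝ and σ > 0, where λ₁ is the larger positive root of z² − cz − 1 + k e^{−zch} = 0. -/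

import Mathlib

open Filter Set Asymptotics

noncomputable section

/-- The piecewise linear birth function of the toy model. -/
def gtoy (k u : ℝ) : ℝ := if u < 1 then k * u else 4 - u

/-- The characteristic function `χ(z,c) = z² - cz - 1 + k e^{-zch}` at the zero equilibrium. -/
def chi (k c h z : ℝ) : ℝ := z ^ 2 - c * z - 1 + k * Real.exp (-(z * c * h))

/-- `c` is a positive speed at which `χ(·,c)` has a double positive root. -/
def IsCsharp (k h c : ℝ) : Prop :=
  0 < c ∧ ∃ z : ℝ, 0 < z ∧ chi k c h z = 0 ∧
    2 * z - c - k * c * h * Real.exp (-(z * c * h)) = 0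

/-- A wavefront profile of speed `c` for the toy model: positive, `C¹`,
twice differentiable and satisfying the profile equation at every point where
`φ(t - ch) ≠ 1`, with `φ(-∞) = 0` and `φ(+∞) = 2`. -/
def ToyWavefront (k c h : ℝ) (φ : ℝ → ℝ) : Prop :=
  ContDiff ℝ 1 φ ∧ (∀ t, 0 < φ t) ∧
    Tendsto φ atBot (nhds 0) ∧ Tendsto φ atTop (nhds 2) ∧
    ∀ t : ℝ, φ (t - c * h) ≠ 1 →
      HasDerivAt (deriv φ) (c * deriv φ t + φ t - gtoy k (φ (t - c * h))) t

/-- A non-linearly determined (pushed-type) wavefront: its profile decays at `-∞`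
like `e^{λ₁ t}` where `λ₁` is the larger positive root of `χ(·,c) = 0`. -/
def NonlinDetermined (k c h : ℝ) (φ : ℝ → ℝ) : Prop :=
  ∃ lam1 s0 σ : ℝ, 0 < lam1 ∧ chi k c h lam1 = 0 ∧
    (∀ z : ℝ, 0 < z → chi k c h z = 0 → z ≤ lam1) ∧ 0 < σ ∧
    (fun t => φ (t + s0) - Real.exp (lam1 * t)) =O[atBot]
      fun t => Real.exp ((lam1 + σ) * t)

set_option linter.unusedVariables false

/-! ### Part A: threshold -/

def RR (k ρ m h : ℝ) : ℝ :=
  1 + ρ * m - k * Real.exp (-(ρ * m * h)) - ρ ^ 2 * (1 + m + Real.exp (-(m * h)))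

def CC (m h : ℝ) : ℝ := m / Real.sqrt (1 + m + Real.exp (-(m * h)))

def IsThr (k θ h m : ℝ) : Prop :=
  0 < m ∧ ∀ m', 0 < m' → ((∃ ρ ∈ Icc θ 1, 0 ≤ RR k ρ m' h) ↔ m ≤ m')

lemma RR_cont (k : ℝ) : Continuous (fun x : ℝ × ℝ × ℝ => RR k x.1 x.2.1 x.2.2) := by
  unfold RR; fun_prop

lemma RR_pos_rho {k ρ m h : ℝ} (hk : 1 < k) (h0 : 0 ≤ ρ) (h1 : ρ ≤ 1) (hm : 0 < m)
    (hR : 0 ≤ RR k ρ m h) : 0 < ρ ∧ ρ < 1 := by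
  unfold RR at hR
  constructor
  · rcases h0.lt_or_eq with h | h
    · exact h
    · subst h; norm_num at hR; linarith
  · rcases h1.lt_or_eq with h | h
    · exact h
    · subst h
      have : 0 < Real.exp (-(m * h)) := Real.exp_pos _
      rw [one_mul] at hR
      nlinarith

lemma RR_strict {k ρ m m' h : ℝ} (hk : 1 < k) (h0 : 0 < ρ) (h1 : ρ < 1) (hh : 0 ≤ h)
    (hm : m < m') : RR k ρ m h < RR k ρ m' h := by
  unfold RR
  have e1 : Real.exp (-(ρ * m' * h)) ≤ Real.exp (-(ρ * m * h)) := by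
    apply Real.exp_le_exp.2
    have : ρ * m * h ≤ ρ * m' * h := by gcongr
    linarith
  have e2 : Real.exp (-(m' * h)) ≤ Real.exp (-(m * h)) := by
    apply Real.exp_le_exp.2
    have : m * h ≤ m' * h := by gcongr
    linarith
  have e3 : ρ * ρ * (m' - m) < ρ * (m' - m) := by
    have : 0 < ρ * (m' - m) := by apply mul_pos h0; linarith
    nlinarith
  have e4 : k * Real.exp (-(ρ * m' * h)) ≤ k * Real.exp (-(ρ * m * h)) := by gcongr
  have e5 : ρ ^ 2 * Real.exp (-(m' * h)) ≤ ρ ^ 2 * Real.exp (-(m * h)) := by gcongr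
  nlinarith

lemma thr_exists {k θ h : ℝ} (hk : 1 < k) (hθ : 0 ≤ θ) (hθ2 : θ < 1 / 2) (hh : 0 ≤ h) :
    ∃ m, IsThr k θ h m := by
  set M : ℝ := 4 * k with hM
  let K : Set (ℝ × ℝ) := (Icc θ 1 ×ˢ Icc 0 M) ∩ {x | 0 ≤ RR k x.1 x.2 h}
  have hKc : IsCompact K := by
    apply (isCompact_Icc.prod isCompact_Icc).inter_right
    apply isClosed_le continuous_const
    unfold RR; fun_prop
  have hM0 : 0 < M := by simp [hM]; linarith
  have hKn : K.Nonempty := by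
    refine ⟨(1/2, M), ⟨⟨⟨hθ2.le, by norm_num⟩, ⟨hM0.le, le_rfl⟩⟩, ?_⟩⟩
    show 0 ≤ RR k (1/2) M h
    unfold RR
    have e1 : Real.exp (-(1/2 * M * h)) ≤ 1 := by
      apply Real.exp_le_one_iff.2; have : 0 ≤ 1/2 * M * h := by positivity
      linarith
    have e2 : Real.exp (-(M * h)) ≤ 1 := by
      apply Real.exp_le_one_iff.2; have : 0 ≤ M * h := by positivity
      linarith
    have e3 : k * Real.exp (-(1/2 * M * h)) ≤ k * 1 := by gcongr
    nlinarith
  obtain ⟨⟨ρ0, m0⟩, hx, hmin⟩ := hKc.exists_isMinOn hKn (f := fun x => x.2) (by fun_prop)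
  obtain ⟨⟨⟨ha, hb⟩, ⟨hc, hd⟩⟩, he⟩ := hx
  simp only at ha hb hc hd
  have he' : 0 ≤ RR k ρ0 m0 h := he
  have hm0 : 0 < m0 := by
    rcases hc.lt_or_eq with h1 | h1
    · exact h1
    · exfalso; rw [← h1] at he'; unfold RR at he'
      simp at he'
      nlinarith [sq_nonneg ρ0]
  obtain ⟨hr0, hr1⟩ := RR_pos_rho hk (hθ.trans ha) hb hm0 he'
  refine ⟨m0, hm0, fun m' hm' => ⟨?_, ?_⟩⟩
  · rintro ⟨ρ, hρ, hR⟩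
    by_contra hlt
    push Not at hlt
    have := hmin (show (ρ, m') ∈ K from ⟨⟨hρ, ⟨hm'.le, hlt.le.trans hd⟩⟩, hR⟩)
    simp at this
    linarith
  · intro hle
    rcases hle.lt_or_eq with h1 | h1
    · exact ⟨ρ0, ⟨ha, hb⟩, he'.trans (RR_strict hk hr0 hr1 hh h1).le⟩
    · exact ⟨ρ0, ⟨ha, hb⟩, h1 ▸ he'⟩

/-- facts at the threshold -/
lemma thr_attained {k θ h m : ℝ} (hk : 1 < k) (hθ : 0 ≤ θ) (ht : IsThr k θ h m) :
    ∃ ρ, θ ≤ ρ ∧ 0 < ρ ∧ ρ < 1 ∧ 0 ≤ RR k ρ m h := by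
  obtain ⟨ρ, ⟨h1, h2⟩, h3⟩ := (ht.2 m ht.1).2 le_rfl
  obtain ⟨h4, h5⟩ := RR_pos_rho hk (hθ.trans h1) h2 ht.1 h3
  exact ⟨ρ, h1, h4, h5, h3⟩

lemma thr_lt {k θ h m m' ρ : ℝ} (ht : IsThr k θ h m) (hm' : 0 < m') (hρ : ρ ∈ Icc θ 1)
    (hR : 0 < RR k ρ m' h) : m < m' := by
  have hc : Continuous (fun x => RR k ρ x h) := by unfold RR; fun_prop
  have h1 : ∀ᶠ x in nhds m', 0 < RR k ρ x h :=
    hc.continuousAt.eventually (lt_mem_nhds hR)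
  have h2 : ∀ᶠ x in nhds m', 0 < x := lt_mem_nhds hm'
  obtain ⟨x, hx, hx1, hx2⟩ : ∃ x, x < m' ∧ 0 < RR k ρ x h ∧ 0 < x := by
    have h3 : ∀ᶠ x in nhdsWithin m' (Iio m'), 0 < RR k ρ x h ∧ 0 < x :=
      (h1.and h2).filter_mono nhdsWithin_le_nhds
    have h4 : ∀ᶠ x in nhdsWithin m' (Iio m'), x < m' := self_mem_nhdsWithin
    obtain ⟨x, hx⟩ := (h4.and h3).exists
    exact ⟨x, hx⟩
  exact lt_of_le_of_lt ((ht.2 x hx2).1 ⟨ρ, hρ, hx1.le⟩) hx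

lemma thr_le_zero {k θ h m ρ : ℝ} (ht : IsThr k θ h m) (hρ : ρ ∈ Icc θ 1) :
    RR k ρ m h ≤ 0 := by
  by_contra hc
  push Not at hc
  exact lt_irrefl _ (thr_lt ht ht.1 hρ hc)

lemma CC_sq {m h : ℝ} (hm : 0 < m) : (CC m h) ^ 2 * (1 + m + Real.exp (-(m * h))) = m ^ 2 := by
  have : 0 < 1 + m + Real.exp (-(m * h)) := by positivity
  unfold CC
  rw [div_pow, Real.sq_sqrt this.le]
  field_simp

lemma CC_pos {m h : ℝ} (hm : 0 < m) : 0 < CC m h := by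
  have : 0 < 1 + m + Real.exp (-(m * h)) := by positivity
  unfold CC; positivity

lemma CC_strict {m m' h : ℝ} (hm : 0 < m) (hh : 0 ≤ h) (hlt : m < m') : CC m h < CC m' h := by
  have hm' := hm.trans hlt
  have h1 := CC_sq (h := h) hm
  have h2 := CC_sq (h := h) hm'
  have p1 := CC_pos (h := h) hm
  have p2 := CC_pos (h := h) hm'
  have e2 : Real.exp (-(m' * h)) ≤ Real.exp (-(m * h)) := by
    apply Real.exp_le_exp.2
    have : m * h ≤ m' * h := by gcongr
    linarith
  have q1 : 0 < Real.exp (-(m * h)) := Real.exp_pos _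
  have q2 : 0 < Real.exp (-(m' * h)) := Real.exp_pos _
  set a := Real.exp (-(m * h))
  set b := Real.exp (-(m' * h))
  by_contra hc
  push Not at hc
  have hs : (CC m' h)^2 ≤ (CC m h)^2 := by gcongr
  have : m' ^ 2 * (1 + m + a) ≤ m ^ 2 * (1 + m' + b) := by
    rw [← h1, ← h2]
    have : 0 < (1 + m + a) * (1 + m' + b) := by positivity
    nlinarith
  have f1 : m ^ 2 < m' ^ 2 := by gcongr
  have f2 : m ^ 2 * m' < m' ^ 2 * m := by nlinarith [mul_pos hm hm']
  have f3 : m ^ 2 * b ≤ m' ^ 2 * a := by gcongr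
  nlinarith

lemma CC_cont (h : ℝ) : ContinuousOn (fun m => CC m h) (Ici 0) := by
  intro m hm
  have hm : 0 ≤ m := hm
  have : 0 < 1 + m + Real.exp (-(m * h)) := by positivity
  have h2 : Real.sqrt (1 + m + Real.exp (-(m * h))) ≠ 0 := by positivity
  apply ContinuousAt.continuousWithinAt
  unfold CC
  exact ContinuousAt.div (f := fun m : ℝ => m)
    (g := fun m : ℝ => Real.sqrt (1 + m + Real.exp (-(m * h)))) (by fun_prop) (by fun_prop) h2

lemma CC_surj {c h : ℝ} (hc : 0 < c) (hh : 0 ≤ h) : ∃ m, 0 < m ∧ CC m h = c := by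
  set M : ℝ := 3 * c ^ 2 + 1 with hM
  have hM0 : 0 < M := by positivity
  have h0 : CC 0 h = 0 := by simp [CC]
  have h1 : c ≤ CC M h := by
    have h2 := CC_sq (h := h) hM0
    have p2 := CC_pos (h := h) hM0
    have e2 : Real.exp (-(M * h)) ≤ 1 := by
      apply Real.exp_le_one_iff.2; have : 0 ≤ M * h := by positivity
      linarith
    by_contra hcon
    push Not at hcon
    have hs : (CC M h)^2 < c ^ 2 := by gcongr
    have q2 : 0 < Real.exp (-(M * h)) := Real.exp_pos _
    have : (CC M h)^2 * (1 + M + Real.exp (-(M * h))) ≤ c ^ 2 * (1 + M + 1) := by gcongr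
    rw [h2] at this
    nlinarith [sq_nonneg c]
  have := intermediate_value_Icc hM0.le ((CC_cont h).mono Icc_subset_Ici_self)
  obtain ⟨m, hm, hmc⟩ := this ⟨by simp only [h0]; exact hc.le, h1⟩
  refine ⟨m, ?_, hmc⟩
  rcases hm.1.lt_or_eq with h3 | h3
  · exact h3
  · rw [← h3] at hmc; simp only [h0] at hmc; linarith

lemma thr_cont {k θ : ℝ} (hk : 1 < k) (hθ : 0 ≤ θ) {ms : ℝ → ℝ}
    (hms : ∀ h, 0 ≤ h → IsThr k θ h (ms h)) :
    ContinuousOn (fun h => CC (ms h) h) (Ici 0) := by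
  have hcont : ContinuousOn ms (Ici 0) := by
    intro h hh
    have hh : 0 ≤ h := hh
    have ht := hms h hh
    apply tendsto_order.2
    constructor
    · intro a ha
      rcases le_or_gt a 0 with ha0 | ha0
      · filter_upwards [self_mem_nhdsWithin] with x hx
        exact lt_of_le_of_lt ha0 (hms x hx).1
      have hneg : ∀ ρ ∈ Icc θ 1, RR k ρ a h < 0 := by
        intro ρ hρ
        by_contra hc
        push Not at hc
        have := (ht.2 a ha0).1 ⟨ρ, hρ, hc⟩
        linarith
      have : ∀ᶠ x in nhds h, ∀ ρ ∈ Icc θ 1, RR k ρ a x < 0 := by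
        apply isCompact_Icc.eventually_forall_of_forall_eventually
        intro ρ hρ
        have hc : Continuous (fun z : ℝ × ℝ => RR k z.2 a z.1) := by unfold RR; fun_prop
        exact hc.continuousAt.eventually (gt_mem_nhds (hneg ρ hρ))
      filter_upwards [this.filter_mono nhdsWithin_le_nhds, self_mem_nhdsWithin] with x hx hx0
      by_contra hc
      push Not at hc
      obtain ⟨ρ, hρ, hR⟩ := ((hms x hx0).2 a ha0).2 hc
      linarith [hx ρ hρ]
    · intro b hb
      obtain ⟨ρ, h1, h2, h3, h4⟩ := thr_attained hk hθ ht
      have hR : 0 < RR k ρ b h := h4.trans_lt (RR_strict hk h2 h3 hh hb)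
      have hc : Continuous (fun z : ℝ => RR k ρ b z) := by unfold RR; fun_prop
      filter_upwards [(hc.continuousAt.eventually (lt_mem_nhds hR)).filter_mono nhdsWithin_le_nhds,
        self_mem_nhdsWithin] with x hx hx0
      exact thr_lt (hms x hx0) (ht.1.trans hb) ⟨h1, h3.le⟩ hx
  have : ∀ h ∈ Ici (0:ℝ), Real.sqrt (1 + ms h + Real.exp (-(ms h * h))) ≠ 0 := by
    intro h hh
    have := (hms h hh).1
    positivity
  unfold CC
  apply ContinuousOn.div hcont _ this
  fun_prop

lemma RR_chi {k ρ m h c : ℝ} (hc : 0 < c) (hm : 0 < m) (hcc : CC m h = c) (w : ℝ) (hw : w = ρ * m) :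
    RR k ρ m h = -(w ^ 2 / c ^ 2 - w - 1 + k * Real.exp (-(w * h))) := by
  have := CC_sq (h := h) hm
  rw [hcc] at this
  have h2 : 1 + m + Real.exp (-(m * h)) = m ^ 2 / c ^ 2 := by
    field_simp; linarith
  unfold RR
  rw [h2, hw]
  ring

lemma thr_anti {k θ : ℝ} (hk : 1 < k) (hθ : 0 ≤ θ) {ms : ℝ → ℝ}
    (hms : ∀ h, 0 ≤ h → IsThr k θ h (ms h)) :
    StrictAntiOn (fun h => CC (ms h) h) (Ici 0) := by
  intro h hh h' hh' hlt
  have hh : 0 ≤ h := hh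
  have hh' : 0 ≤ h' := hh'
  simp only
  have ht := hms h hh
  have ht' := hms h' hh'
  set m := ms h
  have hm : 0 < m := ht.1
  set c := CC m h with hcdef
  have hc : 0 < c := CC_pos hm
  obtain ⟨ρ, h1, h2, h3, h4⟩ := thr_attained hk hθ ht
  obtain ⟨m', hm', hcm'⟩ := CC_surj (h := h') hc hh'
  have s1 := CC_sq (h := h) hm
  have s2 := CC_sq (h := h') hm'
  rw [hcm'] at s2
  rw [← hcdef] at s1
  have e1 : Real.exp (-(m * h')) < Real.exp (-(m * h)) := by
    apply Real.exp_lt_exp.2; nlinarith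
  have hmm : m' < m := by
    by_contra hcon
    push Not at hcon
    have : CC m h' ≤ CC m' h' := by
      rcases hcon.lt_or_eq with h | h
      · exact (CC_strict hm hh' h).le
      · rw [h]
    rw [hcm'] at this
    have s3 := CC_sq (h := h') hm
    have p := CC_pos (h := h') hm
    have : CC m h' ^ 2 ≤ c ^ 2 := by gcongr
    have : CC m h' ^ 2 * (1 + m + Real.exp (-(m * h'))) ≤ c ^ 2 * (1 + m + Real.exp (-(m * h'))) := by
      gcongr
    have : c ^ 2 * (1 + m + Real.exp (-(m * h'))) < c ^ 2 * (1 + m + Real.exp (-(m * h))) := by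
      gcongr
    linarith
  set w := ρ * m with hw
  have hw0 : 0 < w := by positivity
  have r1 := RR_chi (k := k) hc hm hcdef.symm w hw
  have r2 := RR_chi (k := k) (ρ := w / m') hc hm' hcm' w (by field_simp)
  have e2 : Real.exp (-(w * h')) < Real.exp (-(w * h)) := by
    apply Real.exp_lt_exp.2; nlinarith
  have e3 : k * Real.exp (-(w * h')) < k * Real.exp (-(w * h)) := by gcongr
  have hpos : 0 < RR k (w / m') m' h' := by rw [r2]; linarith
  have hρ1 : w / m' ≤ 1 := by
    rw [div_le_one hm']
    by_contra hcon
    push Not at hcon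
    have a1 : w ^ 2 / c ^ 2 - w - 1 < 0 := by
      have : 0 < k * Real.exp (-(w * h')) := by positivity
      linarith
    have a2 : 0 < m' ^ 2 / c ^ 2 - m' - 1 := by
      have : m' ^ 2 / c ^ 2 = 1 + m' + Real.exp (-(m' * h')) := by
        field_simp; linarith
      rw [this]; have := Real.exp_pos (-(m' * h')); linarith
    have a3 : w ^ 2 / c ^ 2 = w * (w / c ^ 2) := by ring
    have a4 : m' ^ 2 / c ^ 2 = m' * (m' / c ^ 2) := by ring
    have a5 : m' / c ^ 2 < w / c ^ 2 := by gcongr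
    have a6 : 1 < m' / c ^ 2 := by
      by_contra hq; push Not at hq; nlinarith
    nlinarith
  have hρ2 : θ ≤ w / m' := by
    rw [le_div_iff₀ hm']
    have : ρ * m' ≤ w := by rw [hw]; gcongr
    nlinarith
  have := thr_lt ht' hm' ⟨hρ2, hρ1⟩ hpos
  have := CC_strict ht'.1 hh' this
  rw [hcm'] at this
  exact this

lemma thr_k53 {k m0 m1 : ℝ} (hk : 1 < k) (hk3 : k < 5 / 3) (h0 : IsThr k 0 0 m0)
    (h1 : IsThr k ((3 - k) / 4) 0 m1) : m0 < m1 := by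
  obtain ⟨ρ, a1, a2, a3, a4⟩ := thr_attained hk (by linarith) h1
  have hm1 := h1.1
  have hle : m0 ≤ m1 := (h0.2 m1 hm1).1 ⟨ρ, ⟨a2.le, a3.le⟩, a4⟩
  rcases hle.lt_or_eq with h | h
  · exact h
  exfalso
  subst h
  set m := m0
  have e : ∀ r, RR k r m 0 = 1 + r * m - k - r ^ 2 * (2 + m) := by
    intro r; unfold RR; simp only [mul_zero, neg_zero, Real.exp_zero]; ring
  set r := m / (2 * (2 + m)) with hr
  have hr0 : 0 < r := by positivity
  have hr2 : r < 1 := by rw [hr, div_lt_one (by positivity)]; linarith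
  have b1 : RR k r m 0 ≤ 0 := thr_le_zero h0 ⟨hr0.le, hr2.le⟩
  rw [e] at b1 a4
  have hrm : m = 2 * r * (2 + m) := by rw [hr]; field_simp
  have b2 : (2 + m) * (ρ - r) ^ 2 ≤ 0 := by nlinarith
  have b3 : ρ = r := by
    have : (ρ - r) ^ 2 ≤ 0 := by
      by_contra hc; push Not at hc; nlinarith
    nlinarith [sq_nonneg (ρ - r), pow_eq_zero_iff (two_ne_zero) |>.1 (le_antisymm this (sq_nonneg (ρ - r)))]
  rw [b3] at a4 a1
  have b4 : 1 + r * m - k - r ^ 2 * (2 + m) = 0 := le_antisymm b1 a4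
  have b5 : m * (1 - 2 * r) = 4 * r := by linarith
  have b6 : r < 1 / 2 := by nlinarith
  have b7 : 2 * r ^ 2 = (k - 1) * (1 - 2 * r) := by nlinarith
  nlinarith


/-! ### Part B: roots of the characteristic function -/

def XX (k c τ z : ℝ) : ℝ := z ^ 2 - c * z - 1 + k * Real.exp (-(z * τ))

lemma chi_eq_XX (k c h z : ℝ) : chi k c h z = XX k c (c * h) z := by
  unfold chi XX; rw [mul_assoc z c h]

lemma XX_tang {k c τ : ℝ} (hk : 0 < k) (y z : ℝ) :
    XX k c τ y + (2 * y - c - k * τ * Real.exp (-(y * τ))) * (z - y) + (z - y) ^ 2 ≤ XX k c τ z := by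
  unfold XX
  have h1 : Real.exp (-(z * τ)) = Real.exp (-(y * τ)) * Real.exp (-((z - y) * τ)) := by
    rw [← Real.exp_add]; ring_nf
  have h2 : -((z - y) * τ) + 1 ≤ Real.exp (-((z - y) * τ)) := Real.add_one_le_exp _
  have h3 : 0 < k * Real.exp (-(y * τ)) := by positivity
  have h4 := mul_le_mul_of_nonneg_left h2 h3.le
  rw [h1]
  nlinarith

lemma XX_three {k c τ x y z : ℝ} (hk : 0 < k) (hxy : x < y) (hyz : y < z)
    (hx : XX k c τ x ≤ 0) (hz : XX k c τ z ≤ 0) : XX k c τ y < 0 := by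
  have h1 := XX_tang (c := c) (τ := τ) hk y x
  have h2 := XX_tang (c := c) (τ := τ) hk y z
  set d := (2 * y - c - k * τ * Real.exp (-(y * τ)))
  have a := sub_pos.2 hxy
  have b := sub_pos.2 hyz
  have h3 : XX k c τ y + d * (x - y) + (x - y) ^ 2 ≤ 0 := h1.trans hx
  have h4 : XX k c τ y + d * (z - y) + (z - y) ^ 2 ≤ 0 := h2.trans hz
  have h5 := mul_le_mul_of_nonneg_left h3 b.le
  have h6 := mul_le_mul_of_nonneg_left h4 a.le
  by_contra hc
  push Not at hc
  have h7 : 0 < (z - y) * (x - y) ^ 2 := by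
    exact mul_pos b (by nlinarith)
  nlinarith

lemma XX_cont (k c τ : ℝ) : Continuous (XX k c τ) := by unfold XX; fun_prop

lemma XX_nonpos_pos {k c τ z : ℝ} (hk : 1 < k) (hc : 0 ≤ c) (hτ : 0 ≤ τ) (hz : z ≤ 0) :
    0 < XX k c τ z := by
  unfold XX
  have : 1 ≤ Real.exp (-(z * τ)) := by
    apply Real.one_le_exp; nlinarith
  nlinarith [sq_nonneg z]

lemma XX_large {k c τ z : ℝ} (hk : 0 < k) (hc : 0 ≤ c) (hz : c + 1 ≤ z) : 0 < XX k c τ z := by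
  unfold XX
  have : 0 < k * Real.exp (-(z * τ)) := by positivity
  nlinarith

lemma XX_roots {k c τ q : ℝ} (hk : 1 < k) (hc : 0 < c) (hτ : 0 ≤ τ) (hq : XX k c τ q ≤ 0) :
    (∃ l1 l2, 0 < l2 ∧ l2 < l1 ∧ XX k c τ l1 = 0 ∧ XX k c τ l2 = 0 ∧ q ≤ l1) ∨
    (0 < q ∧ XX k c τ q = 0 ∧ 2 * q - c - k * τ * Real.exp (-(q * τ)) = 0) := by
  have hpos : ∀ z, XX k c τ z ≤ 0 → 0 < z := by
    intro z hz; by_contra hcon; push Not at hcon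
    linarith [XX_nonpos_pos (z := z) hk hc.le hτ hcon]
  by_cases hex : ∃ q', XX k c τ q' < 0
  · left
    obtain ⟨q', hq'⟩ := hex
    have hq'0 := hpos q' hq'.le
    have hlt : q' < c + 1 := by
      by_contra hcon; push Not at hcon
      linarith [XX_large (k := k) (τ := τ) (by linarith) hc.le hcon]
    have h0 := XX_nonpos_pos (z := 0) hk hc.le hτ le_rfl
    have h1 := XX_large (k := k) (τ := τ) (by linarith) hc.le (le_refl (c + 1))
    obtain ⟨l2, hl2, hx2⟩ := intermediate_value_Icc' hq'0.le (XX_cont k c τ).continuousOn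
      ⟨hq'.le, h0.le⟩
    obtain ⟨l1, hl1, hx1⟩ := intermediate_value_Icc hlt.le (XX_cont k c τ).continuousOn
      ⟨hq'.le, h1.le⟩
    have c1 : q' < l1 := lt_of_le_of_ne hl1.1 (by rintro rfl; linarith)
    have c2 : l2 < q' := lt_of_le_of_ne hl2.2 (by rintro rfl; linarith)
    refine ⟨l1, l2, hpos _ hx2.le, c2.trans c1, hx1, hx2, ?_⟩
    by_contra hcon
    push Not at hcon
    have := XX_three (by linarith) c1 hcon hq'.le hq
    linarith
  · right
    push Not at hex
    refine ⟨hpos q hq, le_antisymm hq (hex q), ?_⟩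
    have hd : HasDerivAt (XX k c τ) (2 * q - c - k * τ * Real.exp (-(q * τ))) q := by
      unfold XX
      have h1 : HasDerivAt (fun z : ℝ => -(z * τ)) (-(1 * τ)) q :=
        ((hasDerivAt_id q).mul_const τ).neg
      have h2 := ((((hasDerivAt_id q).pow 2).sub ((hasDerivAt_id q).const_mul c)).sub_const 1).add
        (h1.exp.const_mul k)
      refine h2.congr_deriv ?_
      simp; ring
    have hm : IsLocalMin (XX k c τ) q := by
      apply Filter.Eventually.of_forall
      intro x; exact hq.trans (hex x)
    exact hm.hasDerivAt_eq_zero hd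

lemma XX_le_root {k c τ l1 l2 q : ℝ} (hk : 1 < k) (h21 : l2 < l1) (h1 : XX k c τ l1 = 0)
    (h2 : XX k c τ l2 = 0) (hq : XX k c τ q = 0) : q ≤ l1 := by
  by_contra hcon
  push Not at hcon
  have := XX_three (by linarith) h21 hcon h2.le hq.le
  linarith

lemma XX_dbl {k c τ l q : ℝ} (hk : 1 < k) (h1 : XX k c τ l = 0)
    (h2 : 2 * l - c - k * τ * Real.exp (-(l * τ)) = 0) (hq : XX k c τ q ≤ 0) : q = l := by
  have := XX_tang (c := c) (τ := τ) (show 0 < k by linarith) l q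
  rw [h1, h2] at this
  have : (q - l) ^ 2 ≤ 0 := by linarith
  have := pow_eq_zero_iff (two_ne_zero) |>.1 (le_antisymm this (sq_nonneg (q - l)))
  linarith

lemma XX_deriv_pos {k c τ l1 l2 : ℝ} (hk : 1 < k) (h21 : l2 < l1) (h1 : XX k c τ l1 = 0)
    (h2 : XX k c τ l2 = 0) : 0 < 2 * l1 - c - k * τ * Real.exp (-(l1 * τ)) := by
  have := XX_tang (c := c) (τ := τ) (show 0 < k by linarith) l1 l2
  rw [h1, h2] at this
  have h3 : 0 < (l2 - l1) ^ 2 := by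
    have := sub_pos.2 h21
    nlinarith
  by_contra hcon
  push Not at hcon
  nlinarith

/-- `l < μ` -/
lemma root_lt_mu {k c τ l μ : ℝ} (hk : 1 < k) (hμ : 0 < μ)
    (hμ2 : μ ^ 2 - c * μ - 1 - Real.exp (-(μ * τ)) = 0) (hl : XX k c τ l ≤ 0) : l < μ := by
  unfold XX at hl
  have e1 := Real.exp_pos (-(μ * τ))
  have e2 : 0 < k * Real.exp (-(l * τ)) := by positivity
  by_contra hcon
  push Not at hcon
  have : c < μ := by by_contra h; push Not at h; nlinarith
  nlinarith


/-! ### Part C: first order cooperative equation -/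

lemma deriv_pos_left {f : ℝ → ℝ} {f' x : ℝ} (h : HasDerivAt f f' x) (hf : 0 < f') :
    ∀ᶠ t in nhdsWithin x (Iio x), f t < f x := by
  have h1 := (hasDerivAt_iff_tendsto_slope.1 h).eventually (lt_mem_nhds hf)
  have h2 : nhdsWithin x (Iio x) ≤ nhdsWithin x {x}ᶜ :=
    nhdsWithin_mono _ (fun y hy => ne_of_lt hy)
  filter_upwards [h2 h1, self_mem_nhdsWithin] with t ht htx
  have htx : t < x := htx
  rw [slope_def_field, lt_div_iff_of_neg (by linarith)] at ht
  linarith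

lemma deriv_pos_right {f : ℝ → ℝ} {f' x : ℝ} (h : HasDerivAt f f' x) (hf : 0 < f') :
    ∀ᶠ t in nhdsWithin x (Ioi x), f x < f t := by
  have h1 := (hasDerivAt_iff_tendsto_slope.1 h).eventually (lt_mem_nhds hf)
  have h2 : nhdsWithin x (Ioi x) ≤ nhdsWithin x {x}ᶜ :=
    nhdsWithin_mono _ (fun y hy => ne_of_gt hy)
  filter_upwards [h2 h1, self_mem_nhdsWithin] with t ht htx
  have htx : x < t := htx
  rw [slope_def_field, lt_div_iff₀ (by linarith)] at ht
  linarith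

def Hom (a κ τ T : ℝ) (v : ℝ → ℝ) : Prop :=
  Continuous v ∧ ∀ t ≤ T, HasDerivAt v (a * v t + κ * ∫ s in (t - τ)..t, v s) t

lemma Hom.comb {a κ τ T : ℝ} {u v : ℝ → ℝ} (hu : Hom a κ τ T u) (hv : Hom a κ τ T v) (r : ℝ) :
    Hom a κ τ T (fun t => u t + r * v t) := by
  refine ⟨hu.1.add (hv.1.const_mul r) , fun t ht => ?_⟩
  have h1 := (hu.2 t ht).add ((hv.2 t ht).const_mul r)
  refine h1.congr_deriv ?_
  have i1 : IntervalIntegrable u MeasureTheory.volume (t - τ) t := hu.1.intervalIntegrable _ _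
  have i2 : IntervalIntegrable (fun s => r * v s) MeasureTheory.volume (t - τ) t :=
    (hv.1.const_mul r).intervalIntegrable _ _
  rw [intervalIntegral.integral_add i1 i2, intervalIntegral.integral_const_mul]
  ring

lemma Hom.smul {a κ τ T : ℝ} {v : ℝ → ℝ} (hv : Hom a κ τ T v) (r : ℝ) :
    Hom a κ τ T (fun t => r * v t) := by
  refine ⟨hv.1.const_mul r , fun t ht => ?_⟩
  have h1 := ((hv.2 t ht).const_mul r)
  refine h1.congr_deriv ?_
  rw [intervalIntegral.integral_const_mul]
  ring

lemma int_exp {δ : ℝ} (hδ : δ ≠ 0) (x y : ℝ) :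
    ∫ s in x..y, Real.exp (δ * s) = (Real.exp (δ * y) - Real.exp (δ * x)) / δ := by
  rw [intervalIntegral.integral_comp_mul_left (fun s => Real.exp s) hδ, integral_exp]
  simp; ring

lemma Hom_exp {a κ τ T δ : ℝ} (hδ : δ ≠ 0)
    (h : δ * δ = a * δ + κ * (1 - Real.exp (-(δ * τ)))) :
    Hom a κ τ T (fun t => Real.exp (δ * t)) := by
  refine ⟨by fun_prop, fun t _ => ?_⟩
  rw [int_exp hδ]
  have h1 := ((hasDerivAt_id t).const_mul δ).exp
  refine h1.congr_deriv ?_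
  have h2 : Real.exp (δ * (t - τ)) = Real.exp (δ * t) * Real.exp (-(δ * τ)) := by
    rw [← Real.exp_add]; ring_nf
  rw [h2]
  simp only [id, mul_one]
  field_simp
  linear_combination h

lemma Hom.cmp {a κ τ T t0 : ℝ} {v : ℝ → ℝ} (hκ : 0 ≤ κ) (hτ : 0 ≤ τ) (hv : Hom a κ τ T v)
    (h0 : ∀ t ∈ Icc (t0 - τ) t0, 0 ≤ v t) : ∀ t ∈ Icc t0 T, 0 ≤ v t := by
  intro t2 ht2
  set M : ℝ := |a| + κ * τ + 1 with hM
  have hM0 : 0 ≤ M := by positivity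
  suffices H : ∀ ε > 0, 0 < v t2 + ε * Real.exp (M * t2) by
    by_contra hcon
    push Not at hcon
    have := H (- v t2 / Real.exp (M * t2)) (by
      apply div_pos (by linarith) (Real.exp_pos _))
    rw [div_mul_cancel₀ _ (Real.exp_pos _).ne'] at this
    linarith
  intro ε hε
  set g : ℝ → ℝ := fun t => v t + ε * Real.exp (M * t) with hg
  have hgc : Continuous g := by
    have := hv.1
    fun_prop
  by_contra hcon
  have hK : IsCompact (Icc t0 T ∩ {t | g t ≤ 0}) :=
    isCompact_Icc.inter_right (isClosed_le hgc continuous_const)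
  obtain ⟨t1, ⟨ht1, hgt1⟩, hleast⟩ := hK.exists_isLeast ⟨t2, ht2, not_lt.1 hcon⟩
  have hgt1 : g t1 ≤ 0 := hgt1
  have hbef : ∀ t, t0 - τ ≤ t → t < t1 → 0 < g t := by
    intro t hta htb
    rcases le_or_gt t t0 with h | h
    · have := h0 t ⟨hta, h⟩
      have : 0 < ε * Real.exp (M * t) := by positivity
      simp only [hg]; linarith
    · by_contra hc
      push Not at hc
      have := hleast ⟨⟨h.le, htb.le.trans ht1.2⟩, hc⟩
      linarith
  have hlt : t0 < t1 := by
    rcases ht1.1.lt_or_eq with h | h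
    · exact h
    · exfalso
      have := h0 t0 ⟨by linarith, le_rfl⟩
      have : 0 < ε * Real.exp (M * t0) := by positivity
      rw [← h] at hgt1
      simp only [hg] at hgt1
      linarith
  have hd : HasDerivAt g (a * v t1 + κ * (∫ s in (t1 - τ)..t1, v s)
      + ε * (Real.exp (M * t1) * (M * 1))) t1 :=
    (hv.2 t1 ht1.2).add ((((hasDerivAt_id t1).const_mul M).exp).const_mul ε)
  have hgz : 0 ≤ g t1 := by
    have h1 : Tendsto g (nhdsWithin t1 (Iio t1)) (nhds (g t1)) :=
      hgc.continuousAt.tendsto.mono_left nhdsWithin_le_nhds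
    refine ge_of_tendsto h1 ?_
    filter_upwards [Ioo_mem_nhdsLT hlt] with t ht
    exact (hbef t (by linarith [ht.1]) ht.2).le
  have hz : g t1 = 0 := le_antisymm hgt1 hgz
  have hv1 : v t1 = -(ε * Real.exp (M * t1)) := by
    simp only [hg] at hz; linarith
  have hint : -(ε * Real.exp (M * t1)) * τ ≤ ∫ s in (t1 - τ)..t1, v s := by
    have h1 : ∫ s in (t1 - τ)..t1, -(ε * Real.exp (M * t1)) = -(ε * Real.exp (M * t1)) * τ := by
      rw [intervalIntegral.integral_const]; simp; ring
    rw [← h1]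
    apply intervalIntegral.integral_mono_on (by linarith) (by simp) (hv.1.intervalIntegrable _ _)
    intro s hs
    have e1 : Real.exp (M * s) ≤ Real.exp (M * t1) := by
      apply Real.exp_le_exp.2; exact mul_le_mul_of_nonneg_left hs.2 hM0
    have e2 : 0 ≤ g s := by
      rcases hs.2.lt_or_eq with h | h
      · exact (hbef s (by linarith [hs.1]) h).le
      · rw [h]; exact hgz
    simp only [hg] at e2
    nlinarith
  have hpos : 0 < a * v t1 + κ * (∫ s in (t1 - τ)..t1, v s)
      + ε * (Real.exp (M * t1) * (M * 1)) := by
    have h1 := mul_le_mul_of_nonneg_left hint hκ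
    have h2 : 0 < ε * Real.exp (M * t1) := by positivity
    rw [hv1]
    have h3 : a ≤ |a| := le_abs_self a
    have h4 : 0 < (ε * Real.exp (M * t1)) * (M - a - κ * τ) := by
      apply mul_pos h2; rw [hM]; linarith
    nlinarith
  have hl := deriv_pos_left hd hpos
  obtain ⟨t, hta, htb⟩ := (hl.and (Ioo_mem_nhdsLT hlt)).exists
  have := hbef t (by linarith [htb.1]) htb.2
  linarith

lemma Hom.mono {a κ τ T t0 : ℝ} {v : ℝ → ℝ} (hκ : 0 ≤ κ) (hτ : 0 ≤ τ) (hv : Hom a κ τ T v)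
    (h0 : ∀ t, t0 - τ ≤ t → t ≤ T → 0 ≤ v t) :
    ∀ r t, t0 ≤ r → r ≤ t → t ≤ T → Real.exp (a * (t - r)) * v r ≤ v t := by
  intro r t h1 h2 h3
  have hmon : MonotoneOn (fun t => Real.exp (-(a * t)) * v t) (Icc r t) := by
    have hd : ∀ s ≤ T, HasDerivAt (fun t => Real.exp (-(a * t)) * v t)
        (Real.exp (-(a * s)) * (κ * ∫ x in (s - τ)..s, v x)) s := by
      intro s hs
      have h1 := (((hasDerivAt_id s).const_mul a).neg.exp).mul (hv.2 s hs)
      refine h1.congr_deriv ?_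
      simp only [id, Pi.neg_apply]; ring
    apply monotoneOn_of_deriv_nonneg (convex_Icc _ _)
    · have := hv.1
      fun_prop
    · intro s hs
      rw [interior_Icc] at hs
      exact (hd s (hs.2.le.trans h3)).differentiableAt.differentiableWithinAt
    · intro s hs
      rw [interior_Icc] at hs
      rw [(hd s (hs.2.le.trans h3)).deriv]
      apply mul_nonneg (Real.exp_pos _).le
      apply mul_nonneg hκ
      apply intervalIntegral.integral_nonneg (by linarith)
      intro x hx
      exact h0 x (by linarith [hx.1, hs.1]) (by linarith [hx.2, hs.2])
  have := hmon (left_mem_Icc.2 h2) (right_mem_Icc.2 h2) h2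
  simp only at this
  have e : Real.exp (a * (t - r)) = Real.exp (a * t) * Real.exp (-(a * r)) := by
    rw [← Real.exp_add]; ring_nf
  have e2 : Real.exp (a * t) * Real.exp (-(a * t)) = 1 := by
    rw [← Real.exp_add]; simp
  rw [e]
  calc _ = Real.exp (a * t) * (Real.exp (-(a * r)) * v r) := by ring
    _ ≤ Real.exp (a * t) * (Real.exp (-(a * t)) * v t) := by gcongr
    _ = v t := by rw [← mul_assoc, e2, one_mul]

/-- nonnegative solutions are multiples of the exponential -/
lemma Hom.pos_unique {a κ τ T δ : ℝ} {u : ℝ → ℝ} (hκ : 0 ≤ κ) (hτ : 0 ≤ τ) (hu : Hom a κ τ T u)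
    (he : Hom a κ τ T (fun t => Real.exp (δ * t))) (h0 : ∀ t ≤ T, 0 ≤ u t) :
    ∃ B, 0 ≤ B ∧ ∀ t ≤ T, u t = B * Real.exp (δ * t) := by
  set S : Set ℝ := (fun t => u t * Real.exp (-(δ * t))) '' Iic T with hS
  have hSne : S.Nonempty := ⟨_, ⟨T, mem_Iic.2 le_rfl, rfl⟩⟩
  have hSb : BddBelow S := by
    refine ⟨0, ?_⟩
    rintro _ ⟨t, ht, rfl⟩
    exact mul_nonneg (h0 t ht) (Real.exp_pos _).le
  set ρ := sInf S with hρ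
  have hρ0 : 0 ≤ ρ := by
    apply le_csInf hSne
    rintro _ ⟨t, ht, rfl⟩
    exact mul_nonneg (h0 t ht) (Real.exp_pos _).le
  have ee : ∀ t : ℝ, Real.exp (-(δ * t)) * Real.exp (δ * t) = 1 := by
    intro t; rw [← Real.exp_add]; simp
  set w : ℝ → ℝ := fun t => u t + (-ρ) * Real.exp (δ * t) with hw
  have hwH : Hom a κ τ T w := hu.comb he (-ρ)
  have hw0 : ∀ t ≤ T, 0 ≤ w t := by
    intro t ht
    have : ρ ≤ u t * Real.exp (-(δ * t)) := csInf_le hSb ⟨t, ht, rfl⟩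
    have h2 := mul_le_mul_of_nonneg_right this (Real.exp_pos (δ * t)).le
    rw [mul_assoc, ee, mul_one] at h2
    simp only [hw]; linarith
  set C : ℝ := Real.exp ((|a| + |δ|) * τ) with hC
  have hCpos : 0 < C := Real.exp_pos _
  have key : ∀ ε > 0, w T ≤ C * ε * Real.exp (δ * T) := by
    intro ε hε
    obtain ⟨_, ⟨t1, ht1, rfl⟩, hlt⟩ := exists_lt_of_csInf_lt hSne (show sInf S < ρ + ε by linarith)
    have ht1 : t1 ≤ T := ht1
    have hwt1 : w t1 ≤ ε * Real.exp (δ * t1) := by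
      have h2 := mul_le_mul_of_nonneg_right hlt.le (Real.exp_pos (δ * t1)).le
      simp only at h2
      rw [mul_assoc, ee, mul_one] at h2
      simp only [hw]; linarith
    have hd : Hom a κ τ T (fun t => (C * ε) * Real.exp (δ * t) + (-1) * w t) :=
      (he.smul (C * ε)).comb hwH (-1)
    have := hd.cmp hκ hτ (t0 := t1) ?_ T ⟨ht1, le_rfl⟩
    · linarith
    · intro s hs
      have h1 := hwH.mono hκ hτ (t0 := s) (fun t _ ht => hw0 t ht) s t1 le_rfl hs.2 ht1
      have h2 : w s ≤ Real.exp (-(a * (t1 - s))) * w t1 := by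
        have h3 := mul_le_mul_of_nonneg_left h1 (Real.exp_pos (-(a * (t1 - s)))).le
        rw [← mul_assoc, ← Real.exp_add] at h3
        simpa using h3
      have h3 : Real.exp (-(a * (t1 - s))) * w t1 ≤
          Real.exp (-(a * (t1 - s))) * (ε * Real.exp (δ * t1)) := by gcongr
      have h4 : Real.exp (-(a * (t1 - s))) * Real.exp (δ * t1) ≤ C * Real.exp (δ * s) := by
        rw [hC, ← Real.exp_add, ← Real.exp_add]
        apply Real.exp_le_exp.2
        have q1 : 0 ≤ t1 - s := by linarith [hs.2]
        have q2 : t1 - s ≤ τ := by linarith [hs.1]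
        have q3 : -a ≤ |a| := neg_le_abs a
        have q4 : δ ≤ |δ| := le_abs_self δ
        have q5 : (-a + δ) * (t1 - s) ≤ (|a| + |δ|) * τ := by
          calc (-a + δ) * (t1 - s) ≤ (|a| + |δ|) * (t1 - s) := by gcongr
            _ ≤ _ := by gcongr
        linarith
      have h5 := mul_le_mul_of_nonneg_left h4 hε.le
      have : w s ≤ C * ε * Real.exp (δ * s) := by
        calc w s ≤ _ := h2
          _ ≤ _ := h3
          _ = ε * (Real.exp (-(a * (t1 - s))) * Real.exp (δ * t1)) := by ring
          _ ≤ _ := h5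
          _ = _ := by ring
      linarith
  have hwT : w T ≤ 0 := by
    by_contra hcon
    push Not at hcon
    have hq : 0 < C * Real.exp (δ * T) := by positivity
    have := key (w T / (2 * (C * Real.exp (δ * T)))) (by positivity)
    have h2 : C * (w T / (2 * (C * Real.exp (δ * T)))) * Real.exp (δ * T) = w T / 2 := by
      field_simp
    linarith
  refine ⟨ρ, hρ0, fun t ht => ?_⟩
  have h1 := hwH.mono hκ hτ (t0 := t) (fun t _ ht => hw0 t ht) t T le_rfl ht le_rfl
  have h2 := hw0 t ht
  have h3 : w t = 0 := by
    have : 0 < Real.exp (a * (T - t)) := Real.exp_pos _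
    by_contra hne
    have : 0 < w t := lt_of_le_of_ne h2 (Ne.symm hne)
    have : 0 < Real.exp (a * (T - t)) * w t := by positivity
    linarith
  simp only [hw] at h3
  linarith


/-! ### Part D: classification of positive solutions at `-∞` -/

lemma hasDerivAt_int_delay {f : ℝ → ℝ} (hf : Continuous f) (τ t : ℝ) :
    HasDerivAt (fun t => ∫ s in (t - τ)..t, f s) (f t - f (t - τ)) t := by
  have h1 : ∀ x : ℝ, HasDerivAt (fun t => ∫ s in (0:ℝ)..t, f s) (f x) x := fun x =>
    intervalIntegral.integral_hasDerivAt_right (hf.intervalIntegrable _ _)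
      (hf.stronglyMeasurableAtFilter _ _) hf.continuousAt
  have h2 : HasDerivAt (fun t => ∫ s in (0:ℝ)..(t - τ), f s) (f (t - τ)) t := by
    have := (h1 (t - τ)).comp t ((hasDerivAt_id t).sub_const τ)
    simpa [Function.comp_def] using this
  refine ((h1 t).sub h2).congr_of_eventuallyEq ?_
  filter_upwards with x
  have := intervalIntegral.integral_add_adjacent_intervals
    (hf.intervalIntegrable (μ := MeasureTheory.volume) 0 (x - τ))
    (hf.intervalIntegrable (μ := MeasureTheory.volume) (x - τ) x)
  simp only [Pi.sub_apply]
  linarith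

lemma const_left {w : ℝ → ℝ} {T : ℝ} (hw : Continuous w) (hd : ∀ t < T, HasDerivAt w 0 t) :
    ∀ t ≤ T, w t = w T := by
  intro t ht
  have := constant_of_has_deriv_right_zero (f := w) (a := t) (b := T) hw.continuousOn
    (fun x hx => (hd x hx.2).hasDerivWithinAt) T ⟨ht, le_rfl⟩
  exact this.symm

lemma red {k c τ lam : ℝ} {φ D : ℝ → ℝ} (hφ : ∀ t, HasDerivAt φ (D t) t) (hD : Continuous D)
    (hE : ∀ t < τ, HasDerivAt D (c * D t + φ t - k * φ (t - τ)) t) (hr : XX k c τ lam = 0) :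
    ∃ w0, ∀ t ≤ τ, HasDerivAt (fun t => Real.exp (-(lam * t)) * φ t)
      ((c - 2 * lam) * (Real.exp (-(lam * t)) * φ t) + (k * Real.exp (-(lam * τ))) *
        (∫ s in (t - τ)..t, Real.exp (-(lam * s)) * φ s) + w0) t := by
  have hφc : Continuous φ := continuous_iff_continuousAt.2 fun t => (hφ t).continuousAt
  have hyc : Continuous (fun s => Real.exp (-(lam * s)) * φ s) := by fun_prop
  have hed : ∀ t, HasDerivAt (fun t => Real.exp (-(lam * t))) (-lam * Real.exp (-(lam * t))) t := by
    intro t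
    have := ((hasDerivAt_id t).const_mul lam).neg.exp
    refine this.congr_deriv ?_
    simp [mul_comm]
  have hy : ∀ t, HasDerivAt (fun t => Real.exp (-(lam * t)) * φ t)
      (Real.exp (-(lam * t)) * (D t - lam * φ t)) t := by
    intro t
    refine ((hed t).mul (hφ t)).congr_deriv ?_
    ring
  set w : ℝ → ℝ := fun t => Real.exp (-(lam * t)) * (D t - lam * φ t)
    - (c - 2 * lam) * (Real.exp (-(lam * t)) * φ t) - (k * Real.exp (-(lam * τ))) *
        (∫ s in (t - τ)..t, Real.exp (-(lam * s)) * φ s) with hw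
  have hic : Continuous (fun t => ∫ s in (t - τ)..t, Real.exp (-(lam * s)) * φ s) :=
    continuous_iff_continuousAt.2 fun t => (hasDerivAt_int_delay hyc τ t).continuousAt
  have hwc : Continuous w := by fun_prop
  have hwd : ∀ t < τ, HasDerivAt w 0 t := by
    intro t ht
    have h1 := (((hed t).mul ((hE t ht).sub ((hφ t).const_mul lam))).sub
      ((hy t).const_mul (c - 2 * lam))).sub
      ((hasDerivAt_int_delay hyc τ t).const_mul (k * Real.exp (-(lam * τ))))
    refine h1.congr_deriv ?_
    have e : Real.exp (-(lam * (t - τ))) * Real.exp (-(lam * τ)) = Real.exp (-(lam * t)) := by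
      rw [← Real.exp_add]; ring_nf
    simp only [XX] at hr
    simp only [Pi.sub_apply]
    linear_combination (k * φ (t - τ)) * e - Real.exp (-(lam * t)) * φ t * hr
  refine ⟨w τ, fun t ht => ?_⟩
  rw [← const_left hwc hwd t ht]
  refine (hy t).congr_deriv ?_
  simp only [hw]; ring

lemma Hom_const {a κ τ T : ℝ} (h : a + κ * τ = 0) : Hom a κ τ T (fun _ => 1) := by
  refine ⟨continuous_const, fun t _ => ?_⟩
  refine (hasDerivAt_const t (1:ℝ)).congr_deriv ?_
  simp; linarith

lemma int_id_delay (t τ : ℝ) : ∫ s in (t - τ)..t, (s - (t - τ)) = τ ^ 2 / 2 := by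
  rw [intervalIntegral.integral_sub (by simp) (by simp)]
  simp; ring

/-- conserved functional in the double root case -/
lemma Hom.I_const {a κ τ T : ℝ} {v : ℝ → ℝ} (h : a + κ * τ = 0) (hv : Hom a κ τ T v) :
    ∃ I0, ∀ t ≤ T, v t + κ * (∫ s in (t - τ)..t, (s - (t - τ)) * v s) = I0 := by
  have hvc := hv.1
  have hc1 : Continuous (fun s => s * v s) := by fun_prop
  set w : ℝ → ℝ := fun t => v t + κ * ((∫ s in (t - τ)..t, s * v s) -
    (t - τ) * ∫ s in (t - τ)..t, v s) with hw
  have h1 := fun t => hasDerivAt_int_delay hc1 τ t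
  have h2 := fun t => hasDerivAt_int_delay hvc τ t
  have hwc : Continuous w := by
    have i1 := continuous_iff_continuousAt.2 fun t => (h1 t).continuousAt
    have i2 := continuous_iff_continuousAt.2 fun t => (h2 t).continuousAt
    fun_prop
  have hwd : ∀ t < T, HasDerivAt w 0 t := by
    intro t ht
    have h3 := (hv.2 t ht.le).add (((h1 t).sub (((hasDerivAt_id t).sub_const τ).mul (h2 t))).const_mul κ)
    refine h3.congr_deriv ?_
    simp only [id]
    linear_combination v t * h
  refine ⟨w T, fun t ht => ?_⟩
  rw [← const_left hwc hwd t ht]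
  simp only [hw]
  congr 2
  rw [← intervalIntegral.integral_const_mul, ← intervalIntegral.integral_sub
    (hc1.intervalIntegrable _ _) ((hvc.const_mul _).intervalIntegrable _ _)]
  congr 1; ext s; ring

lemma Hom.harnack {a κ τ T m t0 : ℝ} {v : ℝ → ℝ} (hκ : 0 ≤ κ) (hτ : 0 ≤ τ) (h : a + κ * τ = 0)
    (hv : Hom a κ τ T v)
    (hI : ∀ t ≤ T, v t + κ * (∫ s in (t - τ)..t, (s - (t - τ)) * v s) = 0)
    (ht0 : t0 ≤ T) (hm : 0 ≤ m) (hlow : ∀ s ∈ Icc (t0 - 2 * τ) t0, -m ≤ v s) :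
    -((1 - Real.exp (a * τ)) * m) ≤ v t0 := by
  have hvc := hv.1
  have ha : a ≤ 0 := by nlinarith
  obtain ⟨r, hr, hvr⟩ : ∃ r ∈ Icc (t0 - τ) t0, 0 ≤ v r := by
    by_contra hcon
    push Not at hcon
    have h1 := hI t0 ht0
    have h2 : v t0 < 0 := hcon t0 ⟨by linarith, le_rfl⟩
    have h3 : (∫ s in (t0 - τ)..t0, (s - (t0 - τ)) * v s) ≤ 0 := by
      have : 0 ≤ ∫ s in (t0 - τ)..t0, -((s - (t0 - τ)) * v s) := by
        apply intervalIntegral.integral_nonneg (by linarith)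
        intro s hs
        have := hcon s hs
        have : 0 ≤ s - (t0 - τ) := by linarith [hs.1]
        nlinarith
      rw [intervalIntegral.integral_neg] at this
      linarith
    nlinarith [mul_nonneg hκ (neg_nonneg.2 h3)]
  have hu : Hom a κ τ t0 (fun t => v t + m * 1) := by
    have := hv.comb (Hom_const (T := T) h) m
    exact ⟨this.1, fun t ht => this.2 t (ht.trans ht0)⟩
  have h4 := hu.mono hκ hτ (t0 := r) (fun t ha hb => by
    have := hlow t ⟨by linarith [hr.1], hb⟩
    linarith) r t0 le_rfl hr.2 le_rfl
  have h5 : Real.exp (a * τ) ≤ Real.exp (a * (t0 - r)) := by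
    apply Real.exp_le_exp.2
    have : t0 - r ≤ τ := by linarith [hr.1]
    nlinarith
  have h6 : Real.exp (a * τ) * m ≤ Real.exp (a * (t0 - r)) * (v r + m * 1) := by
    have : m ≤ v r + m * 1 := by linarith
    gcongr
  linarith

lemma Hom.dbl0 {a κ τ T C : ℝ} {v : ℝ → ℝ} (hκ : 0 ≤ κ) (hτ : 0 ≤ τ) (h : a + κ * τ = 0)
    (hv : Hom a κ τ T v)
    (hI : ∀ t ≤ T, v t + κ * (∫ s in (t - τ)..t, (s - (t - τ)) * v s) = 0)
    (hC : 0 ≤ C) (hlow : ∀ t ≤ T, -(C * (1 + |t|)) ≤ v t) : ∀ t ≤ T, 0 ≤ v t := by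
  set q : ℝ := 1 - Real.exp (a * τ) with hq
  have ha : a ≤ 0 := by nlinarith
  have hq0 : 0 ≤ q := by
    have : Real.exp (a * τ) ≤ 1 := Real.exp_le_one_iff.2 (by nlinarith)
    linarith
  have hq1 : q < 1 := by have := Real.exp_pos (a * τ); linarith
  have key : ∀ n : ℕ, ∀ t ≤ T, -(q ^ n * (C * (1 + |t| + 2 * n * τ))) ≤ v t := by
    intro n
    induction n with
    | zero => intro t ht; simpa using hlow t ht
    | succ n ih =>
      intro t ht
      have h1 := hv.harnack hκ hτ h hI (t0 := t) (m := q ^ n * (C * (1 + |t| + 2 * (n + 1) * τ))) ht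
        (by positivity) ?_
      · rw [pow_succ]
        push_cast
        refine le_trans (le_of_eq ?_) h1
        rw [hq]; ring
      · intro s hs
        refine le_trans ?_ (ih s (hs.2.trans ht))
        have : |s| ≤ |t| + 2 * τ := by
          have := abs_sub_abs_le_abs_sub s t
          have h3 : |s - t| ≤ 2 * τ := by rw [abs_le]; constructor <;> linarith [hs.1, hs.2]
          linarith
        have h4 : 1 + |s| + 2 * n * τ ≤ 1 + |t| + 2 * (n + 1) * τ := by linarith
        have : q ^ n * (C * (1 + |s| + 2 * n * τ)) ≤ q ^ n * (C * (1 + |t| + 2 * (n + 1) * τ)) := by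
          gcongr
        linarith
  intro t ht
  have hlim : Tendsto (fun n : ℕ => -(q ^ n * (C * (1 + |t| + 2 * n * τ)))) atTop (nhds 0) := by
    have l1 : Tendsto (fun n : ℕ => q ^ n) atTop (nhds 0) := tendsto_pow_atTop_nhds_zero_of_lt_one hq0 hq1
    have l2 : Tendsto (fun n : ℕ => (n : ℝ) * q ^ n) atTop (nhds 0) :=
      tendsto_self_mul_const_pow_of_lt_one hq0 hq1
    have := ((l1.const_mul (C * (1 + |t|))).add (l2.const_mul (2 * C * τ))).neg
    simp only [mul_zero, add_zero, neg_zero] at this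
    refine this.congr fun n => ?_
    ring
  exact le_of_tendsto' hlim (fun n => key n t ht)

lemma Hom.dbl {a κ τ T C : ℝ} {v : ℝ → ℝ} (hκ : 0 ≤ κ) (hτ : 0 ≤ τ) (h : a + κ * τ = 0)
    (hv : Hom a κ τ T v)
    (hC : 0 ≤ C) (hlow : ∀ t ≤ T, -(C * (1 + |t|)) ≤ v t) : ∃ B, ∀ t ≤ T, v t = B := by
  obtain ⟨I0, hI0⟩ := hv.I_const h
  set b := I0 / (1 + κ * (τ ^ 2 / 2)) with hb
  have hpos : 0 < 1 + κ * (τ ^ 2 / 2) := by positivity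
  have hbI : b * (1 + κ * (τ ^ 2 / 2)) = I0 := div_mul_cancel₀ _ hpos.ne'
  have hu : Hom a κ τ T (fun t => v t + (-b) * 1) := hv.comb (Hom_const h) (-b)
  have hvc := hv.1
  have hnn := hu.dbl0 hκ hτ h (C := C + |b|) ?_ (by positivity) ?_
  · obtain ⟨B, _, hB⟩ := hu.pos_unique (δ := 0) hκ hτ (by simpa using Hom_const h) hnn
    refine ⟨B + b, fun t ht => ?_⟩
    have := hB t ht
    simp at this
    linarith
  · intro t ht
    have e : ∀ s, (s - (t - τ)) * (v s + (-b) * 1) = (s - (t - τ)) * v s - b * (s - (t - τ)) := by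
      intro s; ring
    simp only [e]
    rw [intervalIntegral.integral_sub (Continuous.intervalIntegrable (by fun_prop) _ _)
      (Continuous.intervalIntegrable (by fun_prop) _ _), intervalIntegral.integral_const_mul,
      int_id_delay]
    linear_combination hI0 t ht - hbI
  · intro t ht
    have h1 := hlow t ht
    have h2 := le_abs_self b
    have h3 : 0 ≤ |b| * |t| := by positivity
    nlinarith


structure Mode (k c τ lam : ℝ) (e e' : ℝ → ℝ) : Prop where
  lam_pos : 0 < lam
  root : XX k c τ lam = 0
  largest : ∀ q, XX k c τ q ≤ 0 → q ≤ lam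
  he : ∀ t, HasDerivAt e (e' t) t
  he' : ∀ t, HasDerivAt e' (c * e' t + e t - k * e (t - τ)) t
  e0 : e 0 = 0
  epos : ∀ t < 0, 0 < e t
  elim : Tendsto e atBot (nhds 0)
  egrow : Tendsto (fun t => e t * Real.exp (-(lam * t))) atBot atTop
  Q : ∀ B, 0 ≤ B → ∀ t s, t < s → lam * Real.exp (lam * t) + B * e' t ≤ 0 →
    lam * Real.exp (lam * s) + B * e' s < 0
  ell : ∀ μ, 0 < μ → μ ^ 2 - c * μ - 1 - Real.exp (-(μ * τ)) = 0 →
    e' τ + (μ - c) * e τ + (∫ r in (0:ℝ)..τ, Real.exp (-(μ * r)) * e r) < 0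
  cls : ∀ φ D : ℝ → ℝ, (∀ t, HasDerivAt φ (D t) t) → Continuous D →
    (∀ t < τ, HasDerivAt D (c * D t + φ t - k * φ (t - τ)) t) → (∀ t, 0 < φ t) → φ 0 = 1 →
    ∃ B, 0 ≤ B ∧ ∀ t ≤ τ, φ t = Real.exp (lam * t) + B * e t

lemma hasDerivAt_expm (l t : ℝ) :
    HasDerivAt (fun t => Real.exp (l * t)) (l * Real.exp (l * t)) t := by
  have := ((hasDerivAt_id t).const_mul l).exp
  refine this.congr_deriv ?_
  simp [mul_comm]

lemma tendsto_expm {l : ℝ} (hl : 0 < l) : Tendsto (fun t => Real.exp (l * t)) atBot (nhds 0) :=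
  Real.tendsto_exp_atBot.comp (tendsto_id.const_mul_atBot hl)

lemma exp_ode {k c τ l : ℝ} (hr : XX k c τ l = 0) (t : ℝ) :
    HasDerivAt (fun t => l * Real.exp (l * t))
      (c * (l * Real.exp (l * t)) + Real.exp (l * t) - k * Real.exp (l * (t - τ))) t := by
  refine ((hasDerivAt_expm l t).const_mul l).congr_deriv ?_
  have e : Real.exp (l * (t - τ)) = Real.exp (l * t) * Real.exp (-(l * τ)) := by
    rw [← Real.exp_add]; ring_nf
  rw [e]
  simp only [XX] at hr
  linear_combination Real.exp (l * t) * hr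

lemma ell_exp {k c τ l μ : ℝ} (hr : XX k c τ l = 0) (hl : l < μ)
    (hμ : μ ^ 2 - c * μ - 1 - Real.exp (-(μ * τ)) = 0) :
    l * Real.exp (l * τ) + (μ - c) * Real.exp (l * τ)
      + (∫ r in (0:ℝ)..τ, Real.exp (-(μ * r)) * Real.exp (l * r)) = (k + 1) / (μ - l) := by
  have h0 : l - μ ≠ 0 := by linarith
  have h0' : μ - l ≠ 0 := by linarith
  have e1 : ∀ r : ℝ, Real.exp (-(μ * r)) * Real.exp (l * r) = Real.exp ((l - μ) * r) := by
    intro r; rw [← Real.exp_add]; ring_nf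
  simp only [e1]
  rw [int_exp h0]
  have e2 : Real.exp ((l - μ) * τ) = Real.exp (-(μ * τ)) * Real.exp (l * τ) := (e1 τ).symm
  have e3 : Real.exp (l * τ) * Real.exp (-(l * τ)) = 1 := by rw [← Real.exp_add]; simp
  rw [e2, eq_div_iff h0']
  simp only [XX] at hr
  have e4 : (Real.exp (-(μ * τ)) * Real.exp (l * τ) - Real.exp ((l - μ) * 0)) / (l - μ) * (μ - l)
    = 1 - Real.exp (-(μ * τ)) * Real.exp (l * τ) := by
    simp only [mul_zero, Real.exp_zero]
    field_simp; ring
  rw [add_mul, e4]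
  linear_combination Real.exp (l * τ) * hμ - Real.exp (l * τ) * hr + k * e3

lemma mode_simple {k c τ l1 l2 : ℝ} (hk : 1 < k) (hc : 0 < c) (hτ : 0 ≤ τ) (h2 : 0 < l2) (h21 : l2 < l1)
    (r1 : XX k c τ l1 = 0) (r2 : XX k c τ l2 = 0) :
    Mode k c τ l1 (fun t => Real.exp (l2 * t) - Real.exp (l1 * t))
      (fun t => l2 * Real.exp (l2 * t) - l1 * Real.exp (l1 * t)) where
  lam_pos := h2.trans h21
  root := r1
  largest := by
    intro q hq
    by_contra hcon
    push Not at hcon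
    have := XX_three (by linarith) h21 hcon r2.le hq
    linarith
  he t := (hasDerivAt_expm l2 t).sub (hasDerivAt_expm l1 t)
  he' t := by
    refine ((exp_ode r2 t).sub (exp_ode r1 t)).congr_deriv ?_
    ring
  e0 := by simp
  epos t ht := by
    have : l1 * t < l2 * t := mul_lt_mul_of_neg_right h21 ht
    have := Real.exp_lt_exp.2 this
    linarith
  elim := by
    simpa using (tendsto_expm h2).sub (tendsto_expm (h2.trans h21))
  egrow := by
    have h1 : Tendsto (fun t : ℝ => Real.exp ((l2 - l1) * t) - 1) atBot atTop := by
      apply tendsto_atTop_add_const_right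
      exact Real.tendsto_exp_atTop.comp (tendsto_id.const_mul_atBot_of_neg (by linarith))
    refine h1.congr fun t => ?_
    have e1 : Real.exp (l2 * t) * Real.exp (-(l1 * t)) = Real.exp ((l2 - l1) * t) := by
      rw [← Real.exp_add]; ring_nf
    have e2 : Real.exp (l1 * t) * Real.exp (-(l1 * t)) = 1 := by rw [← Real.exp_add]; simp
    linear_combination e2 - e1
  Q := by
    intro B hB t s hts h
    have e1 : ∀ t, Real.exp (l1 * t) = Real.exp (l2 * t) * Real.exp ((l1 - l2) * t) := by
      intro t; rw [← Real.exp_add]; ring_nf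
    have f1 : ∀ t, l1 * Real.exp (l1 * t) + B * (l2 * Real.exp (l2 * t) - l1 * Real.exp (l1 * t))
      = Real.exp (l2 * t) * ((1 - B) * l1 * Real.exp ((l1 - l2) * t) + B * l2) := by
      intro t; rw [e1]; ring
    rw [f1] at h ⊢
    have hl1 : 0 < l1 := h2.trans h21
    have g1 : (1 - B) * l1 * Real.exp ((l1 - l2) * t) + B * l2 ≤ 0 := by
      by_contra hc; push Not at hc
      have := mul_pos (Real.exp_pos (l2 * t)) hc
      linarith
    have g2 : Real.exp ((l1 - l2) * t) < Real.exp ((l1 - l2) * s) := by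
      apply Real.exp_lt_exp.2
      apply mul_lt_mul_of_pos_left hts; linarith
    have g3 : 1 - B < 0 := by
      by_contra hc; push Not at hc
      rcases hc.eq_or_lt with h | h
      · rw [← h] at g1; nlinarith
      · have := mul_pos (mul_pos h hl1) (Real.exp_pos ((l1 - l2) * t))
        nlinarith
    apply mul_neg_of_pos_of_neg (Real.exp_pos _)
    have : (1 - B) * l1 * Real.exp ((l1 - l2) * s) < (1 - B) * l1 * Real.exp ((l1 - l2) * t) :=
      mul_lt_mul_of_neg_left g2 (mul_neg_of_neg_of_pos g3 hl1)
    linarith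
  ell := by
    intro μ hμ0 hμ
    have m1 : l1 < μ := root_lt_mu hk hμ0 hμ r1.le
    have m2 : l2 < μ := h21.trans m1
    have a1 := ell_exp r1 m1 hμ
    have a2 := ell_exp r2 m2 hμ
    have e : ∀ r : ℝ, Real.exp (-(μ * r)) * (Real.exp (l2 * r) - Real.exp (l1 * r)) =
      Real.exp (-(μ * r)) * Real.exp (l2 * r) - Real.exp (-(μ * r)) * Real.exp (l1 * r) := by
      intro r; ring
    simp only [e]
    rw [intervalIntegral.integral_sub (Continuous.intervalIntegrable (by fun_prop) _ _)
      (Continuous.intervalIntegrable (by fun_prop) _ _)]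
    have : (k + 1) / (μ - l2) < (k + 1) / (μ - l1) := by
      apply div_lt_div_of_pos_left <;> linarith
    linarith
  cls := by
    intro φ D hφ hD hE hpos h0
    obtain ⟨w0, hw0⟩ := red hφ hD hE r1
    have hχ : 0 < 2 * l1 - c - k * τ * Real.exp (-(l1 * τ)) := XX_deriv_pos hk h21 r1 r2
    set a := c - 2 * l1 with ha
    set κ := k * Real.exp (-(l1 * τ)) with hκ
    have hκ0 : 0 ≤ κ := by positivity
    have hs : a + κ * τ < 0 := by rw [ha, hκ]; linarith
    set A := -w0 / (a + κ * τ) with hA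
    have hA' : (a + κ * τ) * A + w0 = 0 := by
      rw [hA, mul_div_cancel₀ _ hs.ne]; ring
    set δ := l2 - l1 with hδ
    have hδ0 : δ < 0 := by linarith
    have hφc : Continuous φ := continuous_iff_continuousAt.2 fun t => (hφ t).continuousAt
    have hyc : Continuous (fun t => Real.exp (-(l1 * t)) * φ t) := by fun_prop
    set v : ℝ → ℝ := fun t => Real.exp (-(l1 * t)) * φ t - A with hv
    have hvH : Hom a κ τ τ v := by
      refine ⟨by fun_prop, fun t ht => ?_⟩
      refine ((hw0 t ht).sub_const A).congr_deriv ?_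
      rw [intervalIntegral.integral_sub (hyc.intervalIntegrable _ _) (by simp)]
      simp only [intervalIntegral.integral_const, smul_eq_mul, hv]
      linear_combination hA'
    have heH : Hom a κ τ τ (fun t => Real.exp (δ * t)) := by
      apply Hom_exp hδ0.ne
      simp only [XX] at r1 r2
      have : Real.exp (-(l2 * τ)) = Real.exp (-(l1 * τ)) * Real.exp (-(δ * τ)) := by
        rw [← Real.exp_add, hδ]; ring_nf
      rw [this] at r2
      rw [ha, hκ, hδ]
      rw [hδ] at r2
      linear_combination r2 - r1
    have hvlow : ∀ t, -|A| ≤ v t := by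
      intro t
      have : 0 < Real.exp (-(l1 * t)) * φ t := mul_pos (Real.exp_pos _) (hpos t)
      have := le_abs_self A
      simp only [hv]; linarith
    have hcmp : ∀ t0 t, t0 ≤ t → t ≤ τ → -(|A| * Real.exp (δ * (t - t0))) ≤ v t := by
      intro t0 t h1 h2
      have hH := hvH.comb heH (|A| * Real.exp (-(δ * t0)))
      have := hH.cmp hκ0 hτ (t0 := t0) ?_ t ⟨h1, h2⟩
      · have e : Real.exp (δ * (t - t0)) = Real.exp (-(δ * t0)) * Real.exp (δ * t) := by
          rw [← Real.exp_add]; ring_nf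
        rw [e]; linarith
      · intro s hs
        have e : Real.exp (-(δ * t0)) * Real.exp (δ * s) = Real.exp (δ * (s - t0)) := by
          rw [← Real.exp_add]; ring_nf
        rw [mul_assoc, e]
        have : 1 ≤ Real.exp (δ * (s - t0)) := by
          apply Real.one_le_exp; nlinarith [hs.2]
        have := hvlow s
        have := abs_nonneg A
        nlinarith
    have hv0 : ∀ t ≤ τ, 0 ≤ v t := by
      intro t ht
      have l1 : Tendsto (fun t0 : ℝ => -(|A| * Real.exp (δ * (t - t0)))) atBot (nhds 0) := by
        have l2 : Tendsto (fun t0 : ℝ => t - t0) atBot atTop :=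
          tendsto_atTop_add_const_left _ _ tendsto_neg_atBot_atTop
        have := ((Real.tendsto_exp_atBot.comp (l2.const_mul_atTop_of_neg hδ0)).const_mul |A|).neg
        simpa [Function.comp_def] using this
      refine le_of_tendsto l1 ?_
      filter_upwards [eventually_le_atBot t] with t0 h
      exact hcmp t0 t h ht
    obtain ⟨B, hB, hBe⟩ := hvH.pos_unique hκ0 hτ heH hv0
    have hAB : A = 1 - B := by
      have := hBe 0 hτ
      simp only [hv, h0] at this
      simp at this
      linarith
    refine ⟨B, hB, fun t ht => ?_⟩
    have h1 := hBe t ht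
    simp only [hv] at h1
    have e1 : Real.exp (l1 * t) * Real.exp (-(l1 * t)) = 1 := by rw [← Real.exp_add]; simp
    have e2 : Real.exp (l1 * t) * Real.exp (δ * t) = Real.exp (l2 * t) := by
      rw [← Real.exp_add, hδ]; ring_nf
    rw [hAB] at h1
    linear_combination Real.exp (l1 * t) * h1 - φ t * e1 + B * e2

lemma int_texp {d : ℝ} (hd : d ≠ 0) (τ : ℝ) :
    ∫ r in (0:ℝ)..τ, Real.exp (-(d * r)) * r = (1 - Real.exp (-(d * τ)) * (1 + d * τ)) / d ^ 2 := by
  have h : ∀ x ∈ uIcc 0 τ, HasDerivAt (fun r => -(Real.exp (-(d * r)) * (1 + d * r)) / d ^ 2)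
      (Real.exp (-(d * x)) * x) x := by
    intro x _
    have h1 := ((((hasDerivAt_id x).const_mul d).neg.exp).mul
      (((hasDerivAt_id x).const_mul d).const_add 1)).neg.div_const (d ^ 2)
    refine h1.congr_deriv ?_
    simp only [id, Pi.neg_apply]
    field_simp; ring
  rw [intervalIntegral.integral_eq_sub_of_hasDerivAt h (Continuous.intervalIntegrable (by fun_prop) _ _)]
  simp; ring

lemma mode_double {k c τ l : ℝ} (hk : 1 < k) (hc : 0 < c) (hτ : 0 ≤ τ) (hl : 0 < l)
    (r1 : XX k c τ l = 0) (r2 : 2 * l - c - k * τ * Real.exp (-(l * τ)) = 0) :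
    Mode k c τ l (fun t => -(t * Real.exp (l * t)))
      (fun t => -((1 + l * t) * Real.exp (l * t))) where
  lam_pos := hl
  root := r1
  largest := fun q hq => (XX_dbl hk r1 r2 hq).le
  he t := by
    refine ((hasDerivAt_id t).mul (hasDerivAt_expm l t)).neg.congr_deriv ?_
    simp only [id]; ring
  he' t := by
    refine ((((hasDerivAt_id t).const_mul l).const_add 1).mul
      (hasDerivAt_expm l t)).neg.congr_deriv ?_
    have e : Real.exp (l * (t - τ)) = Real.exp (l * t) * Real.exp (-(l * τ)) := by
      rw [← Real.exp_add]; ring_nf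
    rw [e]
    simp only [XX] at r1
    simp only [id]
    linear_combination -(t * Real.exp (l * t)) * r1 - Real.exp (l * t) * r2
  e0 := by simp
  epos t ht := by
    have := mul_pos (neg_pos.2 ht) (Real.exp_pos (l * t))
    linarith
  elim := by
    have h1 : Tendsto (fun x : ℝ => x ^ 1 * Real.exp (-l * x)) atTop (nhds 0) := by
      simpa using Real.tendsto_pow_mul_exp_neg_atTop_nhds_zero 1 |>.comp
        (tendsto_id.const_mul_atTop hl) |>.const_mul (1 / l) |>.congr (fun x => by
          simp only [Function.comp, id]
          field_simp)
    have h2 := h1.comp tendsto_neg_atBot_atTop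
    refine h2.congr fun t => ?_
    simp [Function.comp]
  egrow := by
    refine tendsto_neg_atBot_atTop.congr fun t => ?_
    have e2 : Real.exp (l * t) * Real.exp (-(l * t)) = 1 := by rw [← Real.exp_add]; simp
    linear_combination t * e2
  Q := by
    intro B hB t s hts h
    have f1 : ∀ t, l * Real.exp (l * t) + B * -((1 + l * t) * Real.exp (l * t))
      = Real.exp (l * t) * (l - B * (1 + l * t)) := by
      intro t; ring
    rw [f1] at h ⊢
    have g1 : l - B * (1 + l * t) ≤ 0 := by
      by_contra hc; push Not at hc
      have := mul_pos (Real.exp_pos (l * t)) hc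
      linarith
    have hB' : 0 < B := by
      rcases hB.eq_or_lt with h | h
      · rw [← h] at g1; linarith
      · exact h
    apply mul_neg_of_pos_of_neg (Real.exp_pos _)
    have := mul_lt_mul_of_pos_left hts (mul_pos hB' hl)
    linarith
  ell := by
    intro μ hμ0 hμ
    have m1 : l < μ := root_lt_mu hk hμ0 hμ r1.le
    have hd : μ - l ≠ 0 := by linarith
    have e1 : ∀ r : ℝ, Real.exp (-(μ * r)) * -(r * Real.exp (l * r)) =
        -(Real.exp (-((μ - l) * r)) * r) := by
      intro r
      have : Real.exp (-((μ - l) * r)) = Real.exp (-(μ * r)) * Real.exp (l * r) := by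
        rw [← Real.exp_add]; ring_nf
      rw [this]; ring
    simp only [e1]
    rw [intervalIntegral.integral_neg, int_texp hd]
    have e2 : Real.exp (-((μ - l) * τ)) = Real.exp (-(μ * τ)) * Real.exp (l * τ) := by
        rw [← Real.exp_add]; ring_nf
    have e3 : Real.exp (l * τ) * Real.exp (-(l * τ)) = 1 := by rw [← Real.exp_add]; simp
    simp only [XX] at r1
    have key : ((1 + l * τ) * Real.exp (l * τ) + (μ - c) * (τ * Real.exp (l * τ))
      + (1 - Real.exp (-((μ - l) * τ)) * (1 + (μ - l) * τ)) / (μ - l) ^ 2) * (μ - l) ^ 2 = k + 1 := by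
      rw [add_mul, div_mul_cancel₀ _ (pow_ne_zero 2 hd), e2]
      linear_combination ((μ-l) * τ * Real.exp (l*τ) + Real.exp (l * τ)) * (hμ - r1)
        + ((μ - l) * τ * k + k - (μ - l) * k * τ) * e3 - (μ - l) * Real.exp (l * τ) * r2
    have : 0 < (1 + l * τ) * Real.exp (l * τ) + (μ - c) * (τ * Real.exp (l * τ))
      + (1 - Real.exp (-((μ - l) * τ)) * (1 + (μ - l) * τ)) / (μ - l) ^ 2 := by
      by_contra hcon; push Not at hcon
      nlinarith [sq_nonneg (μ - l)]
    linarith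
  cls := by
    intro φ D hφ hD hE hpos h0
    obtain ⟨w0, hw0⟩ := red hφ hD hE r1
    set a := c - 2 * l with ha
    set κ := k * Real.exp (-(l * τ)) with hκ
    have hκ0 : 0 ≤ κ := by positivity
    have hs : a + κ * τ = 0 := by rw [ha, hκ]; linarith
    have hpos2 : 0 < 1 + κ * (τ ^ 2 / 2) := by positivity
    set α := w0 / (1 + κ * (τ ^ 2 / 2)) with hα
    have hα' : α * (1 + κ * (τ ^ 2 / 2)) = w0 := div_mul_cancel₀ _ hpos2.ne'
    have hφc : Continuous φ := continuous_iff_continuousAt.2 fun t => (hφ t).continuousAt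
    have hyc : Continuous (fun t => Real.exp (-(l * t)) * φ t) := by fun_prop
    set v : ℝ → ℝ := fun t => Real.exp (-(l * t)) * φ t - α * t with hv
    have hvH : Hom a κ τ τ v := by
      refine ⟨by fun_prop, fun t ht => ?_⟩
      refine ((hw0 t ht).sub ((hasDerivAt_id t).const_mul α)).congr_deriv ?_
      have e : ∫ s in (t - τ)..t, α * s = α * (t * τ - τ ^ 2 / 2) := by
        rw [intervalIntegral.integral_const_mul, integral_id]; ring
      rw [intervalIntegral.integral_sub (hyc.intervalIntegrable _ _)
        (Continuous.intervalIntegrable (by fun_prop) _ _), e]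
      simp only [hv]
      linear_combination -hα' + α * t * hs
    obtain ⟨B, hB⟩ := hvH.dbl hκ0 hτ hs (C := |α|) (abs_nonneg _) (by
      intro t ht
      have h1 : 0 < Real.exp (-(l * t)) * φ t := mul_pos (Real.exp_pos _) (hpos t)
      have h2 : α * t ≤ |α| * |t| := by rw [← abs_mul]; exact le_abs_self _
      have := abs_nonneg α
      simp only [hv]; linarith)
    have hB1 : B = 1 := by
      have := hB 0 hτ
      simp only [hv, h0] at this
      simp at this
      linarith
    have hform : ∀ t ≤ τ, φ t = Real.exp (l * t) + (-α) * -(t * Real.exp (l * t)) := by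
      intro t ht
      have h1 := hB t ht
      simp only [hv] at h1
      have e1 : Real.exp (l * t) * Real.exp (-(l * t)) = 1 := by rw [← Real.exp_add]; simp
      rw [hB1] at h1
      linear_combination Real.exp (l * t) * h1 - φ t * e1
    refine ⟨-α, ?_, hform⟩
    by_contra hcon
    push Not at hcon
    have hα0 : 0 < α := by linarith
    have ht : -(1 / α) ≤ τ := by
      have : 0 < 1 / α := by positivity
      linarith
    have h1 := hform _ ht
    have h2 := hpos (-(1 / α))
    have h3 : α * (1 / α) = 1 := by field_simp
    have h4 : Real.exp (l * -(1 / α)) + (-α) * -(-(1 / α) * Real.exp (l * -(1 / α))) = 0 := by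
      linear_combination -Real.exp (l * -(1 / α)) * h3
    linarith

lemma mode_exists {k c τ q : ℝ} (hk : 1 < k) (hc : 0 < c) (hτ : 0 ≤ τ) (hq : XX k c τ q ≤ 0) :
    ∃ lam e e', Mode k c τ lam e e' := by
  rcases XX_roots hk hc hτ hq with ⟨l1, l2, h1, h2, h3, h4, _⟩ | ⟨h1, h2, h3⟩
  · exact ⟨_, _, _, mode_simple hk hc hτ h1 h2 h3 h4⟩
  · exact ⟨_, _, _, mode_double hk hc hτ h1 h2 h3⟩


/-! ### Part F: profiles, nonexistence -/

lemma grow_bound {f f' : ℝ → ℝ} {a b C : ℝ} (hab : a ≤ b) (hc : ContinuousOn f (Icc a b))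
    (h : ∀ x ∈ Ioo a b, HasDerivAt f (f' x) x) (hb : ∀ x ∈ Ioo a b, C ≤ f' x) :
    f a + C * (b - a) ≤ f b := by
  have := (convex_Icc a b).mul_sub_le_image_sub_of_le_deriv hc
    (by rw [interior_Icc]; intro x hx; exact (h x hx).differentiableAt.differentiableWithinAt)
    (C := C) (by rw [interior_Icc]; intro x hx; rw [(h x hx).deriv]; exact hb x hx)
    a (left_mem_Icc.2 hab) b (right_mem_Icc.2 hab) hab
  linarith

lemma strictMono_bound {f f' : ℝ → ℝ} {a b : ℝ} (hab : a < b) (hc : ContinuousOn f (Icc a b))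
    (h : ∀ x ∈ Ioo a b, HasDerivAt f (f' x) x) (hb : ∀ x ∈ Ioo a b, 0 < f' x) :
    f a < f b := by
  have := strictMonoOn_of_deriv_pos (convex_Icc a b) hc
    (by rw [interior_Icc]; intro x hx; rw [(h x hx).deriv]; exact hb x hx)
  exact this (left_mem_Icc.2 hab.le) (right_mem_Icc.2 hab.le) hab

lemma pos_no_slope {φ D : ℝ → ℝ} {t2 η : ℝ} (hφ : ∀ t, HasDerivAt φ (D t) t) (hpos : ∀ t, 0 < φ t)
    (hη : 0 < η) (h : ∀ t ≤ t2, η ≤ D t) : False := by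
  set t := t2 - φ t2 / η with ht
  have h0 := hpos t2
  have h1 : 0 < φ t2 / η := by positivity
  have := grow_bound (f := φ) (f' := D) (a := t) (b := t2) (C := η) (by linarith)
    (fun x _ => (hφ x).continuousAt.continuousWithinAt) (fun x _ => hφ x)
    (fun x hx => h x hx.2.le)
  have e : η * (t2 - t) = φ t2 := by rw [ht]; field_simp; ring
  have := hpos t
  linarith

structure Prof (k c τ : ℝ) (φ D : ℝ → ℝ) : Prop where
  hφ : ∀ t, HasDerivAt φ (D t) t
  hD : Continuous D
  pos : ∀ t, 0 < φ t
  bot : Tendsto φ atBot (nhds 0)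
  top : Tendsto φ atTop (nhds 2)
  eq : ∀ t, φ (t - τ) ≠ 1 → HasDerivAt D (c * D t + φ t - gtoy k (φ (t - τ))) t
  one : φ 0 = 1
  lt : ∀ t < 0, φ t < 1

lemma Prof.cont {k c τ : ℝ} {φ D : ℝ → ℝ} (P : Prof k c τ φ D) : Continuous φ :=
  continuous_iff_continuousAt.2 fun t => (P.hφ t).continuousAt

lemma Prof.lin {k c τ : ℝ} {φ D : ℝ → ℝ} (P : Prof k c τ φ D) :
    ∀ t < τ, HasDerivAt D (c * D t + φ t - k * φ (t - τ)) t := by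
  intro t ht
  have h1 := P.lt (t - τ) (by linarith)
  have := P.eq t h1.ne
  rwa [gtoy, if_pos h1] at this

lemma ToyWavefront.prof {k c h : ℝ} {φ : ℝ → ℝ} (W : ToyWavefront k c h φ) :
    ∃ s, Prof k c (c * h) (fun t => φ (t + s)) (fun t => deriv φ (t + s)) := by
  obtain ⟨hC, hpos, hb, ht, heq⟩ := W
  have hcont := hC.continuous
  have hdiff : ∀ t, HasDerivAt φ (deriv φ t) t := fun t =>
    ((hC.differentiable (by norm_num)) t).hasDerivAt
  have hDc : Continuous (deriv φ) := hC.continuous_deriv (by norm_num)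
  obtain ⟨t0, ht0⟩ : ∃ t0, ∀ t ≤ t0, φ t < 1 := by
    have := hb.eventually (gt_mem_nhds (show (0:ℝ) < 1 by norm_num))
    rw [eventually_atBot] at this
    exact this
  obtain ⟨t1, ht1⟩ : ∃ t1, 1 < φ t1 :=
    (ht.eventually (lt_mem_nhds (show (1:ℝ) < 2 by norm_num))).exists
  have h01 : t0 < t1 := by
    by_contra hcon; push Not at hcon
    have := ht0 t1 hcon; linarith
  have hK : IsCompact (Icc t0 t1 ∩ {t | 1 ≤ φ t}) :=
    isCompact_Icc.inter_right (isClosed_le continuous_const hcont)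
  obtain ⟨s, ⟨hs, hs1⟩, hleast⟩ := hK.exists_isLeast ⟨t1, ⟨h01.le, le_rfl⟩, ht1.le⟩
  have hs1 : 1 ≤ φ s := hs1
  have hlt : ∀ t < s, φ t < 1 := by
    intro t hts
    rcases le_or_gt t t0 with h | h
    · exact ht0 t h
    · by_contra hc
      push Not at hc
      have := hleast ⟨⟨h.le, hts.le.trans hs.2⟩, hc⟩
      linarith
  have hs2 : φ s ≤ 1 := by
    have h1 : Tendsto φ (nhdsWithin s (Iio s)) (nhds (φ s)) :=
      hcont.continuousAt.tendsto.mono_left nhdsWithin_le_nhds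
    refine le_of_tendsto h1 ?_
    filter_upwards [self_mem_nhdsWithin] with t ht
    exact (hlt t ht).le
  refine ⟨s, ?_, ?_, ?_, ?_, ?_, ?_, ?_, ?_⟩
  · intro t
    simpa using (hdiff (t + s)).comp_add_const t s
  · fun_prop
  · intro t; exact hpos _
  · exact hb.comp (tendsto_atBot_add_const_right _ _ tendsto_id)
  · exact ht.comp (tendsto_atTop_add_const_right _ _ tendsto_id)
  · intro t hne
    have e : t + s - c * h = t - c * h + s := by ring
    have := heq (t + s) (by rw [e]; exact hne)
    rw [e] at this
    exact this.comp_add_const t s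
  · simp; linarith
  · intro t ht
    exact hlt _ (by linarith)

lemma Prof.c_pos {k c h : ℝ} {φ D : ℝ → ℝ} (hk : 1 < k) (hh : 0 ≤ h)
    (P : Prof k c (c * h) φ D) : 0 < c := by
  by_contra hc
  push Not at hc
  set τ := c * h with hτ
  have hτ0 : τ ≤ 0 := by rw [hτ]; nlinarith
  have hpc := P.cont
  set J : ℝ → ℝ := fun t => D t - c * φ t - k * ∫ s in (t - τ)..t, φ s with hJ
  have hJd : ∀ t < τ, HasDerivAt J (-((k - 1) * φ t)) t := by
    intro t ht
    refine (((P.lin t ht).sub ((P.hφ t).const_mul c)).sub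
      ((hasDerivAt_int_delay hpc τ t).const_mul k)).congr_deriv ?_
    ring
  have hanti : ∀ t s, t < s → s < τ → J s < J t := by
    intro t s hts hs
    have := strictMono_bound (f := fun t => - J t) (f' := fun t => (k - 1) * φ t) hts
      (fun x hx => (hJd x (hx.2.trans_lt hs)).neg.continuousAt.continuousWithinAt)
      (fun x hx => (hJd x (hx.2.trans hs)).neg.congr_deriv (neg_neg _))
      (fun x hx => mul_pos (by linarith) (P.pos x))
    linarith
  have hint : ∀ t, (∫ s in (t - τ)..t, φ s) ≤ 0 := by
    intro t
    rw [intervalIntegral.integral_symm]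
    have := intervalIntegral.integral_nonneg (f := φ) (μ := MeasureTheory.volume)
      (show t ≤ t - τ by linarith) (fun x _ => (P.pos x).le)
    linarith
  by_cases hex : ∃ t1 < τ, 0 ≤ J t1
  · obtain ⟨t1, ht1, hJ1⟩ := hex
    have hη := hanti (t1 - 1) t1 (by linarith) ht1
    set η := J (t1 - 1) with hηd
    have hη0 : 0 < η := by linarith
    have hden : 0 < 4 * (1 - c + k * (-τ)) := by nlinarith
    have hsm : 0 < η / (4 * (1 - c + k * (-τ))) := by positivity
    set ε := η / (4 * (1 - c + k * (-τ))) with hε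
    have hεe : ε * (4 * (1 - c + k * (-τ))) = η := div_mul_cancel₀ _ hden.ne'
    obtain ⟨t3, ht3⟩ : ∃ t3, ∀ t ≤ t3, φ t < ε := by
      have := P.bot.eventually (gt_mem_nhds hsm)
      rw [eventually_atBot] at this
      exact this
    refine pos_no_slope P.hφ P.pos (t2 := min (t1 - 1) (t3 + τ)) (η := η / 2) (by linarith) ?_
    intro t ht
    have ha : t ≤ t1 - 1 := ht.trans (min_le_left _ _)
    have hb : t ≤ t3 + τ := ht.trans (min_le_right _ _)
    have hJt : η ≤ J t := by
      rcases ha.eq_or_lt with h | h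
      · rw [h]
      · exact (hanti t (t1 - 1) h (by linarith)).le
    have h1 : φ t < ε := ht3 t (by linarith)
    have h2 : (∫ s in t..(t - τ), φ s) ≤ ε * (-τ) := by
      have := intervalIntegral.integral_mono_on (f := φ) (g := fun _ => ε)
        (μ := MeasureTheory.volume) (show t ≤ t - τ by linarith)
        (hpc.intervalIntegrable _ _) (by simp) (fun x hx => (ht3 x (by linarith [hx.2])).le)
      refine this.trans (le_of_eq ?_)
      simp; ring
    rw [intervalIntegral.integral_symm] at h2
    have h3 := mul_le_mul_of_nonneg_left h2 (show 0 ≤ k by linarith)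
    have h4 : c * ε ≤ c * φ t := mul_le_mul_of_nonpos_left h1.le hc
    simp only [hJ] at hJt
    nlinarith
  · push Not at hex
    have hDneg : ∀ t < τ, D t < 0 := by
      intro t ht
      have h1 := hex t ht
      simp only [hJ] at h1
      have h2 := mul_nonpos_of_nonneg_of_nonpos (show 0 ≤ k by linarith) (hint t)
      have h3 := mul_nonpos_of_nonpos_of_nonneg hc (P.pos t).le
      linarith
    have hge : ∀ t ≤ τ - 1, φ (τ - 1) ≤ φ t := by
      intro t ht
      have := grow_bound (f := fun t => - φ t) (f' := fun t => - D t) (C := 0) ht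
        (by fun_prop) (fun x hx => (P.hφ x).neg) (fun x hx => by
          have := hDneg x (by linarith [hx.2]); linarith)
      linarith
    have := ge_of_tendsto P.bot (b := φ (τ - 1)) (by
      filter_upwards [eventually_le_atBot (τ - 1)] with t ht using hge t ht)
    have := P.pos (τ - 1)
    linarith

lemma back_lem {f f' : ℝ → ℝ} {t1 q ε η : ℝ} (hε : 0 < ε) (hη : 0 < η)
    (hf : ∀ t ≤ t1, HasDerivAt f (f' t) t) (hq : ∀ t ≤ t1, f t ≤ q)
    (hd : ∀ t ≤ t1, q - ε ≤ f t → f' t ≤ -η) (h1 : q - ε < f t1) : False := by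
  have hfc : ∀ a b, b ≤ t1 → ContinuousOn f (Icc a b) := fun a b hb x hx =>
    (hf x (hx.2.trans hb)).continuousAt.continuousWithinAt
  have hst : ∀ t ≤ t1, q - ε < f t := by
    intro t ht
    by_contra hcon
    push Not at hcon
    have hK : IsCompact (Icc t t1 ∩ f ⁻¹' (Iic (q - ε))) := by
      apply isCompact_Icc.of_isClosed_subset _ inter_subset_left
      exact (hfc t t1 le_rfl).preimage_isClosed_of_isClosed isClosed_Icc isClosed_Iic
    obtain ⟨s, ⟨hs, hs1⟩, hgr⟩ := hK.exists_isGreatest ⟨t, ⟨le_rfl, ht⟩, hcon⟩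
    have hs1 : f s ≤ q - ε := hs1
    have hst : s < t1 := by
      rcases hs.2.lt_or_eq with h | h
      · exact h
      · rw [h] at hs1; linarith
    have := grow_bound (f := fun t => - f t) (f' := fun t => - f' t) (C := η) hst.le
      (hfc _ _ le_rfl).neg (fun x hx => (hf x hx.2.le).neg) (fun x hx => by
        have := hd x hx.2.le (by
          by_contra hc
          push Not at hc
          have := hgr ⟨⟨hs.1.trans hx.1.le, hx.2.le⟩, hc.le⟩
          linarith [hx.1])
        linarith)
    nlinarith
  have hlen : 0 ≤ 2 * ε / η := by positivity
  have := grow_bound (f := fun t => - f t) (f' := fun t => - f' t) (C := η)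
    (show t1 - 2 * ε / η ≤ t1 by linarith) (hfc _ _ le_rfl).neg
    (fun x hx => (hf x hx.2.le).neg) (fun x hx => by
      have := hd x hx.2.le (hst x hx.2.le).le; linarith)
  have e : η * (t1 - (t1 - 2 * ε / η)) = 2 * ε := by field_simp; ring
  have := hq (t1 - 2 * ε / η) (by linarith)
  linarith

lemma Prof.XX_neg {k c τ : ℝ} {φ D : ℝ → ℝ} (hk : 1 < k) (hc : 0 < c) (hτ : 0 ≤ τ)
    (P : Prof k c τ φ D) : ∃ q, XX k c τ q ≤ 0 := by
  have hpc := P.cont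
  -- upper bound for `D / φ`
  set z : ℝ := (c + Real.sqrt (c ^ 2 + 4)) / 2 with hz
  have hsq : Real.sqrt (c ^ 2 + 4) ^ 2 = c ^ 2 + 4 := Real.sq_sqrt (by positivity)
  have hzz : z ^ 2 - c * z - 1 = 0 := by rw [hz]; nlinarith
  have hzc : c < z := by
    have : c < Real.sqrt (c ^ 2 + 4) := by
      apply Real.lt_sqrt_of_sq_lt; linarith
    rw [hz]; linarith
  have hub : ∀ t < 0, D t ≤ z * φ t := by
    intro t1 ht1
    by_contra hcon
    push Not at hcon
    set W : ℝ → ℝ := fun t => Real.exp ((z - c) * t) * (D t - z * φ t) with hW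
    have hWd : ∀ t < 0, HasDerivAt W (-(Real.exp ((z - c) * t) * (k * φ (t - τ)))) t := by
      intro t ht
      refine ((hasDerivAt_expm (z - c) t).mul ((P.lin t (by linarith)).sub
        ((P.hφ t).const_mul z))).congr_deriv ?_
      simp only [Pi.sub_apply]
      linear_combination - Real.exp ((z - c) * t) * φ t * hzz
    have hW1 : ∀ t ≤ t1, W t1 ≤ W t := by
      intro t ht
      have := grow_bound (f := fun t => - W t) (f' := fun t => (Real.exp ((z - c) * t) * (k * φ (t - τ))))
        (C := 0) ht (by have := P.hD; fun_prop)
        (fun x hx => (hWd x (hx.2.trans ht1)).neg.congr_deriv (neg_neg _))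
        (fun x hx => by
          have := P.pos (x - τ)
          positivity)
      linarith
    refine pos_no_slope P.hφ P.pos (t2 := t1) (η := D t1 - z * φ t1) (by linarith) ?_
    intro t ht
    have h1 := hW1 t ht
    simp only [hW] at h1
    have h2 : Real.exp ((z - c) * t) ≤ Real.exp ((z - c) * t1) := by
      apply Real.exp_le_exp.2; nlinarith
    have h3 : 0 < Real.exp ((z - c) * t) := Real.exp_pos _
    have h4 : 0 < z * φ t := mul_pos (by linarith) (P.pos t)
    have h5 : Real.exp ((z - c) * t) * (D t1 - z * φ t1) ≤ Real.exp ((z - c) * t) * (D t - z * φ t) := by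
      refine le_trans ?_ h1
      exact mul_le_mul_of_nonneg_right h2 (by linarith)
    have := le_of_mul_le_mul_left h5 h3
    linarith
  set r : ℝ → ℝ := fun t => D t / φ t with hr
  have hrD : ∀ t, D t = r t * φ t := fun t => (div_mul_cancel₀ _ (P.pos t).ne').symm
  set S := r '' Iio 0 with hS
  have hSne : S.Nonempty := ⟨_, ⟨-1, by simp, rfl⟩⟩
  have hSb : BddAbove S := by
    refine ⟨z, ?_⟩
    rintro _ ⟨t, ht, rfl⟩
    rw [hr]
    simp only
    rw [div_le_iff₀ (P.pos t)]
    exact hub t ht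
  set q := sSup S with hq
  have hrq : ∀ t < 0, r t ≤ q := fun t ht => le_csSup hSb ⟨t, ht, rfl⟩
  refine ⟨q, ?_⟩
  by_contra hcon
  push Not at hcon
  -- ratio bound
  have hratio : ∀ t < 0, Real.exp (-(q * τ)) * φ t ≤ φ (t - τ) := by
    intro t ht
    have := grow_bound (f := fun s => -(Real.exp ((-q) * s) * φ s))
      (f' := fun s => -((-q) * Real.exp ((-q) * s) * φ s + Real.exp ((-q) * s) * D s))
      (C := 0) (show t - τ ≤ t by linarith) (by fun_prop)
      (fun x hx => ((hasDerivAt_expm (-q) x).mul (P.hφ x)).neg)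
      (fun x hx => by
        have h1 := hrq x (hx.2.trans ht)
        have h2 := mul_le_mul_of_nonneg_right h1 (P.pos x).le
        rw [← hrD x] at h2
        have h3 := Real.exp_pos ((-q) * x)
        nlinarith)
    have e : Real.exp ((-q) * t) = Real.exp ((-q) * (t - τ)) * Real.exp (-(q * τ)) := by
      rw [← Real.exp_add]; ring_nf
    rw [e] at this
    have h3 := Real.exp_pos ((-q) * (t - τ))
    refine le_of_mul_le_mul_left ?_ h3
    linarith
  have hrd : ∀ t < 0, HasDerivAt r (c * r t + 1 - k * φ (t - τ) / φ t - (r t) ^ 2) t := by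
    intro t ht
    refine ((P.lin t (by linarith)).div (P.hφ t) (P.pos t).ne').congr_deriv ?_
    have := (P.pos t).ne'
    rw [hrD t]
    field_simp
  set F : ℝ → ℝ := fun x => x ^ 2 - c * x - 1 + k * Real.exp (-(q * τ)) with hF
  have hFq : F q = XX k c τ q := rfl
  have hFc : Continuous F := by fun_prop
  obtain ⟨ε, hε, hεF⟩ : ∃ ε > 0, ∀ x, |x - q| ≤ ε → XX k c τ q / 2 ≤ F x := by
    have h1 : ∀ᶠ x in nhds q, XX k c τ q / 2 < F x :=
      hFc.continuousAt.eventually (lt_mem_nhds (by rw [hFq]; linarith))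
    obtain ⟨ε, hε, h⟩ := Metric.eventually_nhds_iff.1 h1
    refine ⟨ε / 2, by linarith, fun x hx => (h ?_).le⟩
    rw [Real.dist_eq]; linarith
  obtain ⟨_, ⟨t1, ht1, rfl⟩, hlt⟩ := exists_lt_of_lt_csSup hSne (show q - ε < sSup S by linarith)
  have ht1 : t1 < 0 := ht1
  refine back_lem (t1 := t1) hε (show 0 < XX k c τ q / 2 by linarith)
    (fun t ht => hrd t (by linarith)) (fun t ht => hrq t (by linarith)) ?_ hlt
  intro t ht hge
  have h1 := hεF (r t) (by
    have := hrq t (by linarith)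
    rw [abs_le]; constructor <;> linarith)
  have h2 := hratio t (by linarith)
  have h3 : k * Real.exp (-(q * τ)) ≤ k * φ (t - τ) / φ t := by
    rw [le_div_iff₀ (P.pos t)]
    nlinarith
  simp only [hF] at h1
  linarith


/-! ### Part G: profiles stay above one -/

lemma sgn_left {D F : ℝ → ℝ} {t1 : ℝ} (hD : Continuous D) (hF : Continuous F) (h0 : D t1 = 0)
    (hF1 : 0 < F t1) (hd : ∀ᶠ t in nhdsWithin t1 (Iio t1), HasDerivAt D (F t) t) :
    ∀ᶠ t in nhdsWithin t1 (Iio t1), D t < 0 := by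
  have h1 : ∀ᶠ t in nhdsWithin t1 (Iio t1), 0 < F t :=
    nhdsWithin_le_nhds (hF.continuousAt.eventually (lt_mem_nhds hF1))
  obtain ⟨l, hl, hI⟩ := mem_nhdsLT_iff_exists_Ioo_subset.1 (hd.and h1)
  have hl : l < t1 := hl
  filter_upwards [Ioo_mem_nhdsLT hl] with t ht
  have := strictMono_bound (f := D) (f' := F) ht.2 hD.continuousOn
    (fun x hx => (hI ⟨ht.1.trans hx.1, hx.2⟩).1) (fun x hx => (hI ⟨ht.1.trans hx.1, hx.2⟩).2)
  linarith

lemma sgn_right {D F : ℝ → ℝ} {t1 : ℝ} (hD : Continuous D) (hF : Continuous F) (h0 : D t1 = 0)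
    (hF1 : 0 < F t1) (hd : ∀ᶠ t in nhdsWithin t1 (Ioi t1), HasDerivAt D (F t) t) :
    ∀ᶠ t in nhdsWithin t1 (Ioi t1), 0 < D t := by
  have h1 : ∀ᶠ t in nhdsWithin t1 (Ioi t1), 0 < F t :=
    nhdsWithin_le_nhds (hF.continuousAt.eventually (lt_mem_nhds hF1))
  obtain ⟨l, hl, hI⟩ := mem_nhdsGT_iff_exists_Ioo_subset.1 (hd.and h1)
  have hl : t1 < l := hl
  filter_upwards [Ioo_mem_nhdsGT hl] with t ht
  have := strictMono_bound (f := D) (f' := F) ht.1 hD.continuousOn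
    (fun x hx => (hI ⟨hx.1, hx.2.trans ht.2⟩).1) (fun x hx => (hI ⟨hx.1, hx.2.trans ht.2⟩).2)
  linarith

lemma sgn_left' {D F : ℝ → ℝ} {t1 : ℝ} (hD : Continuous D) (hF : Continuous F) (h0 : D t1 = 0)
    (hF1 : F t1 < 0) (hd : ∀ᶠ t in nhdsWithin t1 (Iio t1), HasDerivAt D (F t) t) :
    ∀ᶠ t in nhdsWithin t1 (Iio t1), 0 < D t := by
  have := sgn_left (D := fun t => - D t) (F := fun t => - F t) (t1 := t1) hD.neg hF.neg (by simp [h0])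
    (by linarith) (hd.mono fun t ht => ht.neg)
  exact this.mono fun t ht => by linarith

lemma sgn_right' {D F : ℝ → ℝ} {t1 : ℝ} (hD : Continuous D) (hF : Continuous F) (h0 : D t1 = 0)
    (hF1 : F t1 < 0) (hd : ∀ᶠ t in nhdsWithin t1 (Ioi t1), HasDerivAt D (F t) t) :
    ∀ᶠ t in nhdsWithin t1 (Ioi t1), D t < 0 := by
  have := sgn_right (D := fun t => - D t) (F := fun t => - F t) (t1 := t1) hD.neg hF.neg (by simp [h0])
    (by linarith) (hd.mono fun t ht => ht.neg)
  exact this.mono fun t ht => by linarith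

lemma incr_left {φ D : ℝ → ℝ} {t1 : ℝ} (hφ : ∀ t, HasDerivAt φ (D t) t)
    (h : ∀ᶠ t in nhdsWithin t1 (Iio t1), D t < 0) : ∀ᶠ t in nhdsWithin t1 (Iio t1), φ t1 < φ t := by
  have hc : Continuous φ := continuous_iff_continuousAt.2 fun t => (hφ t).continuousAt
  obtain ⟨l, hl, hI⟩ := mem_nhdsLT_iff_exists_Ioo_subset.1 h
  have hl : l < t1 := hl
  filter_upwards [Ioo_mem_nhdsLT hl] with t ht
  have := strictMono_bound (f := fun t => - φ t) (f' := fun t => - D t) ht.2 (by fun_prop)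
    (fun x hx => (hφ x).neg) (fun x hx => by
      have : D x < 0 := hI ⟨ht.1.trans hx.1, hx.2⟩
      linarith)
  linarith

lemma decr_right {φ D : ℝ → ℝ} {t1 : ℝ} (hφ : ∀ t, HasDerivAt φ (D t) t)
    (h : ∀ᶠ t in nhdsWithin t1 (Ioi t1), D t < 0) : ∀ᶠ t in nhdsWithin t1 (Ioi t1), φ t < φ t1 := by
  have hc : Continuous φ := continuous_iff_continuousAt.2 fun t => (hφ t).continuousAt
  obtain ⟨l, hl, hI⟩ := mem_nhdsGT_iff_exists_Ioo_subset.1 h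
  have hl : t1 < l := hl
  filter_upwards [Ioo_mem_nhdsGT hl] with t ht
  have := strictMono_bound (f := fun t => - φ t) (f' := fun t => - D t) ht.1 (by fun_prop)
    (fun x hx => (hφ x).neg) (fun x hx => by
      have : D x < 0 := hI ⟨hx.1, hx.2.trans ht.2⟩
      linarith)
  linarith

lemma eqOn_deriv {φ ψ D E : ℝ → ℝ} {T : ℝ} (hφ : ∀ t, HasDerivAt φ (D t) t)
    (hψ : ∀ t, HasDerivAt ψ (E t) t) (hD : Continuous D) (hE : Continuous E)
    (h : ∀ t ≤ T, φ t = ψ t) : ∀ t ≤ T, D t = E t := by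
  have h1 : ∀ t < T, D t = E t := by
    intro t ht
    have : φ =ᶠ[nhds t] ψ := by
      filter_upwards [Iio_mem_nhds ht] with s hs using h s (le_of_lt hs)
    exact (hφ t).unique ((hψ t).congr_of_eventuallyEq this)
  intro t ht
  rcases ht.lt_or_eq with h | h
  · exact h1 t h
  · subst h
    have l1 : Tendsto D (nhdsWithin t (Iio t)) (nhds (D t)) :=
      hD.continuousAt.tendsto.mono_left nhdsWithin_le_nhds
    have l2 : Tendsto E (nhdsWithin t (Iio t)) (nhds (E t)) :=
      hE.continuousAt.tendsto.mono_left nhdsWithin_le_nhds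
    refine tendsto_nhds_unique l1 (l2.congr' ?_)
    filter_upwards [self_mem_nhdsWithin] with s hs using (h1 s hs).symm

/-- the explicit profile -/
def pB (lam B : ℝ) (e : ℝ → ℝ) (t : ℝ) : ℝ := Real.exp (lam * t) + B * e t
def qB (lam B : ℝ) (e' : ℝ → ℝ) (t : ℝ) : ℝ := lam * Real.exp (lam * t) + B * e' t

lemma Mode.cont_e {k c τ lam : ℝ} {e e' : ℝ → ℝ} (M : Mode k c τ lam e e') : Continuous e :=
  continuous_iff_continuousAt.2 fun t => (M.he t).continuousAt
lemma Mode.cont_e' {k c τ lam : ℝ} {e e' : ℝ → ℝ} (M : Mode k c τ lam e e') : Continuous e' :=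
  continuous_iff_continuousAt.2 fun t => (M.he' t).continuousAt

lemma Mode.hp {k c τ lam : ℝ} {e e' : ℝ → ℝ} (M : Mode k c τ lam e e') (B t : ℝ) :
    HasDerivAt (pB lam B e) (qB lam B e' t) t :=
  (hasDerivAt_expm lam t).add ((M.he t).const_mul B)

lemma Mode.hq {k c τ lam : ℝ} {e e' : ℝ → ℝ} (M : Mode k c τ lam e e') (B t : ℝ) :
    HasDerivAt (qB lam B e') (c * qB lam B e' t + pB lam B e t - k * pB lam B e (t - τ)) t := by
  refine ((exp_ode M.root t).add ((M.he' t).const_mul B)).congr_deriv ?_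
  simp only [pB, qB]; ring

lemma Mode.cont_p {k c τ lam : ℝ} {e e' : ℝ → ℝ} (M : Mode k c τ lam e e') (B : ℝ) :
    Continuous (pB lam B e) := continuous_iff_continuousAt.2 fun t => (M.hp B t).continuousAt
lemma Mode.cont_q {k c τ lam : ℝ} {e e' : ℝ → ℝ} (M : Mode k c τ lam e e') (B : ℝ) :
    Continuous (qB lam B e') := continuous_iff_continuousAt.2 fun t => (M.hq B t).continuousAt

lemma Prof.expl {k c τ lam : ℝ} {φ D e e' : ℝ → ℝ} (P : Prof k c τ φ D) (M : Mode k c τ lam e e') :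
    ∃ B, 0 ≤ B ∧ (∀ t ≤ τ, φ t = pB lam B e t) ∧ (∀ t ≤ τ, D t = qB lam B e' t) := by
  obtain ⟨B, hB, h⟩ := M.cls φ D P.hφ P.hD P.lin P.pos P.one
  exact ⟨B, hB, h, eqOn_deriv P.hφ (M.hp B) P.hD (M.cont_q B) h⟩

lemma Prof.Q {k c τ lam : ℝ} {φ D e e' : ℝ → ℝ} (P : Prof k c τ φ D) (M : Mode k c τ lam e e') :
    ∀ t s, t < s → s ≤ τ → D t ≤ 0 → D s < 0 := by
  obtain ⟨B, hB, h1, h2⟩ := P.expl M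
  intro t s hts hs h
  rw [h2 t (hts.le.trans hs)] at h
  rw [h2 s hs]
  exact M.Q B hB t s hts h

lemma Prof.eqg {k c τ : ℝ} {φ D : ℝ → ℝ} (P : Prof k c τ φ D) {t : ℝ} (h : 1 < φ (t - τ)) :
    HasDerivAt D (c * D t + φ t - (4 - φ (t - τ))) t := by
  have := P.eq t h.ne'
  rwa [gtoy, if_neg (by linarith)] at this

lemma Prof.eql {k c τ : ℝ} {φ D : ℝ → ℝ} (P : Prof k c τ φ D) {t : ℝ} (h : φ (t - τ) < 1) :
    HasDerivAt D (c * D t + φ t - k * φ (t - τ)) t := by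
  have := P.eq t h.ne
  rwa [gtoy, if_pos h] at this

lemma Prof.gt_one_zero {k c : ℝ} {φ D : ℝ → ℝ} (hk : 1 < k)
    (P : Prof k c 0 φ D) : ∀ t > 0, 1 < φ t := by
  by_contra hcon
  push Not at hcon
  obtain ⟨ts, hts, hφts⟩ := hcon
  have hc := P.cont
  have hDc := P.hD
  obtain ⟨T, hT⟩ : ∃ T, ∀ t ≥ T, 1 < φ t := by
    have := P.top.eventually (lt_mem_nhds (show (1:ℝ) < 2 by norm_num))
    rw [eventually_atTop] at this; exact this
  have hK : IsCompact (Icc ts T ∩ {t | φ t ≤ 1}) :=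
    isCompact_Icc.inter_right (isClosed_le hc continuous_const)
  have htsT : ts ≤ T := by
    by_contra h; push Not at h
    have := hT ts h.le; linarith
  obtain ⟨e, ⟨he, he1⟩, hgr⟩ := hK.exists_isGreatest ⟨ts, ⟨le_rfl, htsT⟩, hφts⟩
  have he1 : φ e ≤ 1 := he1
  have haft : ∀ t > e, 1 < φ t := by
    intro t ht
    by_contra hcon; push Not at hcon
    rcases le_or_gt t T with h | h
    · have := hgr ⟨⟨he.1.trans ht.le, h⟩, hcon⟩
      linarith
    · have := hT t h.le; linarith
  have he2 : φ e = 1 := by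
    apply le_antisymm he1
    have h1 : Tendsto φ (nhdsWithin e (Ioi e)) (nhds (φ e)) :=
      hc.continuousAt.tendsto.mono_left nhdsWithin_le_nhds
    refine ge_of_tendsto h1 ?_
    filter_upwards [self_mem_nhdsWithin] with t ht using (haft t ht).le
  have hDe : 0 < D e := by
    by_contra hcon; push Not at hcon
    have hdr : ∀ᶠ t in nhdsWithin e (Ioi e), D t < 0 := by
      rcases hcon.lt_or_eq with h | h
      · exact nhdsWithin_le_nhds (hDc.continuousAt.eventually (gt_mem_nhds h))
      · refine sgn_right' (F := fun t => c * D t + φ t - (4 - φ (t - 0))) hDc (by fun_prop) h ?_ ?_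
        · simp [h, he2]; norm_num
        · filter_upwards [self_mem_nhdsWithin] with t ht
          exact P.eqg (by simpa using haft t ht)
    obtain ⟨t, h1, h2⟩ := ((decr_right P.hφ hdr).and self_mem_nhdsWithin).exists
    have := haft t h2
    linarith
  have hepos : 0 < e := lt_of_lt_of_le hts he.1
  obtain ⟨l, hl, hI⟩ := mem_nhdsLT_iff_exists_Ioo_subset.1 (deriv_pos_left (P.hφ e) hDe)
  have hl : l < e := hl
  set e' := max ((l + e) / 2) (e / 2) with he'
  have he'e : e' < e := max_lt (by linarith) (by linarith)
  have he'l : l < e' := lt_of_lt_of_le (by linarith) (le_max_left _ _)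
  have he'0 : 0 < e' := lt_of_lt_of_le (by linarith) (le_max_right _ _)
  have hK2 : IsCompact (Icc 0 e' ∩ {t | 1 ≤ φ t}) :=
    isCompact_Icc.inter_right (isClosed_le continuous_const hc)
  obtain ⟨f, ⟨hf, hf1⟩, hgr2⟩ := hK2.exists_isGreatest ⟨0, ⟨le_rfl, he'0.le⟩, P.one.ge⟩
  have hf1 : 1 ≤ φ f := hf1
  have hbet : ∀ t, f < t → t < e → φ t < 1 := by
    intro t h1 h2
    rcases le_or_gt t e' with h | h
    · by_contra hcon; push Not at hcon
      have := hgr2 ⟨⟨hf.1.trans h1.le, h⟩, hcon⟩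
      linarith
    · have : φ t < φ e := hI ⟨he'l.trans h, h2⟩
      linarith
  have hfe : f < e := hf.2.trans_lt he'e
  obtain ⟨m, hm, hmin⟩ := isCompact_Icc.exists_isMinOn (nonempty_Icc.2 hfe.le) hc.continuousOn
  have hm1 : φ m < 1 := by
    have h1 := hmin (show (f + e) / 2 ∈ Icc f e from ⟨by linarith, by linarith⟩)
    have h2 := hbet ((f + e) / 2) (by linarith) (by linarith)
    have h1 : φ m ≤ φ ((f + e) / 2) := h1
    linarith
  have hmf : f < m := by
    rcases hm.1.lt_or_eq with h | h
    · exact h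
    · rw [← h] at hm1; linarith
  have hme : m < e := by
    rcases hm.2.lt_or_eq with h | h
    · exact h
    · rw [h] at hm1; linarith
  have hlm : IsLocalMin φ m := hmin.isLocalMin (Icc_mem_nhds hmf hme)
  have hDm : D m = 0 := hlm.hasDerivAt_eq_zero (P.hφ m)
  have hdr : ∀ᶠ t in nhdsWithin m (Ioi m), D t < 0 := by
    refine sgn_right' (F := fun t => c * D t + φ t - k * φ (t - 0)) hDc (by fun_prop) hDm ?_ ?_
    · simp only [hDm, sub_zero]
      have := P.pos m
      nlinarith
    · filter_upwards [Ioo_mem_nhdsGT hme] with t ht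
      exact P.eql (by simpa using hbet t (hmf.trans ht.1) ht.2)
  obtain ⟨t, h1, h2⟩ := ((decr_right P.hφ hdr).and
    (nhdsWithin_le_nhds hlm : ∀ᶠ t in nhdsWithin m (Ioi m), φ m ≤ φ t)).exists
  linarith

lemma Prof.gt_one {k c τ lam : ℝ} {φ D e e' : ℝ → ℝ} (hk : 1 < k) (hk3 : k < 3) (hτ : 0 < τ)
    (P : Prof k c τ φ D) (M : Mode k c τ lam e e') : ∀ t > 0, 1 < φ t := by
  by_contra hcon
  push Not at hcon
  obtain ⟨ts, hts, hφts⟩ := hcon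
  have hc := P.cont
  have hDc := P.hD
  have hQ := P.Q M
  set S : Set ℝ := {t | 0 < t ∧ φ t ≤ 1} with hS
  have hSne : S.Nonempty := ⟨ts, hts, hφts⟩
  have hSb : BddBelow S := ⟨0, fun t ht => ht.1.le⟩
  set r := sInf S with hr
  have hr0 : 0 ≤ r := le_csInf hSne fun t ht => ht.1.le
  have hbef : ∀ t, 0 < t → t < r → 1 < φ t := by
    intro t h1 h2
    by_contra hcon; push Not at hcon
    have := csInf_le hSb (show t ∈ S from ⟨h1, hcon⟩)
    linarith
  have hclos : r ∈ closure S := csInf_mem_closure hSne hSb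
  have hr1 : φ r ≤ 1 := by
    have : closure S ⊆ {t | φ t ≤ 1} :=
      closure_minimal (fun t ht => ht.2) (isClosed_le hc continuous_const)
    exact this hclos
  have hr2 : φ r = 1 := by
    rcases hr0.eq_or_lt with h | h
    · rw [← h]; exact P.one
    · apply le_antisymm hr1
      have h1 : Tendsto φ (nhdsWithin r (Iio r)) (nhds (φ r)) :=
        hc.continuousAt.tendsto.mono_left nhdsWithin_le_nhds
      refine ge_of_tendsto h1 ?_
      filter_upwards [Ioo_mem_nhdsLT h] with t ht using (hbef t ht.1 ht.2).le
  have hDr : D r ≤ 0 := by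
    by_contra hcon; push Not at hcon
    obtain ⟨l, hl, hI⟩ := mem_nhdsGT_iff_exists_Ioo_subset.1 (deriv_pos_right (P.hφ r) hcon)
    have hl : r < l := hl
    obtain ⟨s, hs, hsl⟩ := exists_lt_of_csInf_lt hSne (show sInf S < l from hl)
    have hrs : r ≤ s := csInf_le hSb hs
    rcases hrs.eq_or_lt with h | h
    · -- r = s > 0, left contradiction
      have hrp : 0 < r := by rw [h]; exact hs.1
      obtain ⟨t, h1, h2⟩ := ((deriv_pos_left (P.hφ r) hcon).and (Ioo_mem_nhdsLT hrp)).exists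
      have := hbef t h2.1 h2.2
      linarith
    · have h1 : φ r < φ s := hI ⟨h, hsl⟩
      have := hs.2
      linarith
  -- upper bound 3
  have hlt3 : ∀ t ∈ Icc 0 r, φ t < 3 := by
    obtain ⟨t1, ht1, hmax⟩ := isCompact_Icc.exists_isMaxOn (nonempty_Icc.2 hr0) hc.continuousOn
    suffices H : φ t1 < 3 by
      intro t ht
      have : φ t ≤ φ t1 := hmax ht
      linarith
    by_contra hcon; push Not at hcon
    have h0 : 0 < t1 := by
      rcases ht1.1.lt_or_eq with h | h
      · exact h
      · rw [← h, P.one] at hcon; linarith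
    have h1 : t1 < r := by
      rcases ht1.2.lt_or_eq with h | h
      · exact h
      · rw [h, hr2] at hcon; linarith
    have hlm : IsLocalMax φ t1 := hmax.isLocalMax (Icc_mem_nhds h0 h1)
    have hD1 : D t1 = 0 := hlm.hasDerivAt_eq_zero (P.hφ t1)
    have hneg : ∀ᶠ t in nhdsWithin t1 (Iio t1), D t < 0 := by
      rcases le_or_gt t1 τ with h | h
      · refine sgn_left (F := fun t => c * D t + φ t - k * φ (t - τ)) hDc (by fun_prop) hD1 ?_ ?_
        · simp only [hD1]
          have : φ (t1 - τ) ≤ 1 := by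
            rcases h.lt_or_eq with h | h
            · exact (P.lt _ (by linarith)).le
            · rw [h, sub_self, P.one]
          have := P.pos (t1 - τ)
          nlinarith
        · filter_upwards [self_mem_nhdsWithin] with t ht
          have ht : t < t1 := ht
          exact P.lin t (by linarith)
      · refine sgn_left (F := fun t => c * D t + φ t - (4 - φ (t - τ))) hDc (by fun_prop) hD1 ?_ ?_
        · simp only [hD1]
          have := hbef (t1 - τ) (by linarith) (by linarith)
          linarith
        · filter_upwards [Ioo_mem_nhdsLT h] with t ht
          exact P.eqg (hbef _ (by linarith [ht.1]) (by linarith [ht.2]))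
    obtain ⟨t, h1, h2⟩ := ((incr_left P.hφ hneg).and
      (nhdsWithin_le_nhds hlm : ∀ᶠ t in nhdsWithin t1 (Iio t1), φ t ≤ φ t1)).exists
    linarith
  -- start of decrease
  have hstart : ∀ᶠ t in nhdsWithin r (Ioi r), D t < 0 := by
    rcases lt_or_ge r τ with h | h
    · filter_upwards [Ioo_mem_nhdsGT h] with t ht
      exact hQ r t ht.1 ht.2.le hDr
    · rcases hDr.lt_or_eq with h' | h'
      · exact nhdsWithin_le_nhds (hDc.continuousAt.eventually (gt_mem_nhds h'))
      · refine sgn_right' (F := fun t => c * D t + φ t - (4 - φ (t - τ))) hDc (by fun_prop) h' ?_ ?_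
        · simp only [h', hr2]
          have := hlt3 (r - τ) ⟨by linarith, by linarith⟩
          linarith
        · filter_upwards [Ioo_mem_nhdsGT (show r < r + τ by linarith)] with t ht
          exact P.eqg (hbef _ (by linarith [ht.1]) (by linarith [ht.2]))
  obtain ⟨l, hl, hI⟩ := mem_nhdsGT_iff_exists_Ioo_subset.1 hstart
  have hl : r < l := hl
  have hdec : ∀ t > r, D t < 0 := by
    intro t3 ht3
    by_contra hcon; push Not at hcon
    have hl3 : l ≤ t3 := by
      by_contra h; push Not at h
      have : D t3 < 0 := hI ⟨ht3, h⟩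
      linarith
    have hK : IsCompact (Icc l t3 ∩ {t | 0 ≤ D t}) :=
      isCompact_Icc.inter_right (isClosed_le continuous_const hDc)
    obtain ⟨t2, ⟨ht2, ht2D⟩, hleast⟩ := hK.exists_isLeast ⟨t3, ⟨hl3, le_rfl⟩, hcon⟩
    have ht2D : 0 ≤ D t2 := ht2D
    have hr2t : r < t2 := hl.trans_le ht2.1
    have hneg : ∀ t, r < t → t < t2 → D t < 0 := by
      intro t h1 h2
      rcases lt_or_ge t l with h | h
      · exact hI ⟨h1, h⟩
      · by_contra hc'; push Not at hc'
        have := hleast ⟨⟨h, h2.le.trans ht2.2⟩, hc'⟩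
        linarith
    have hD2 : D t2 = 0 := by
      apply le_antisymm _ ht2D
      have h1 : Tendsto D (nhdsWithin t2 (Iio t2)) (nhds (D t2)) :=
        hDc.continuousAt.tendsto.mono_left nhdsWithin_le_nhds
      refine le_of_tendsto h1 ?_
      filter_upwards [Ioo_mem_nhdsLT hr2t] with t ht using (hneg t ht.1 ht.2).le
    have hτ2 : τ < t2 := by
      by_contra h; push Not at h
      have := hQ r t2 hr2t h hDr
      linarith
    have hmono : ∀ s t, r ≤ s → s < t → t ≤ t2 → φ t < φ s := by
      intro s t h1 h2 h3
      have := strictMono_bound (f := fun t => - φ t) (f' := fun t => - D t) h2 (by fun_prop)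
        (fun x hx => (P.hφ x).neg) (fun x hx => by
          have := hneg x (h1.trans_lt hx.1) (hx.2.trans_le h3)
          linarith)
      linarith
    have hφ2 : φ t2 < 1 := by rw [← hr2]; exact hmono r t2 le_rfl hr2t le_rfl
    have hpos : ∀ᶠ t in nhdsWithin t2 (Iio t2), 0 < D t := by
      rcases le_or_gt (t2 - τ) r with h | h
      · refine sgn_left' (F := fun t => c * D t + φ t - (4 - φ (t - τ))) hDc (by fun_prop) hD2 ?_ ?_
        · simp only [hD2]
          have := hlt3 (t2 - τ) ⟨by linarith, h⟩
          linarith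
        · filter_upwards [Ioo_mem_nhdsLT hτ2] with t ht
          exact P.eqg (hbef _ (by linarith [ht.1]) (by linarith [ht.2]))
      · refine sgn_left' (F := fun t => c * D t + φ t - k * φ (t - τ)) hDc (by fun_prop) hD2 ?_ ?_
        · simp only [hD2]
          have h1 := hmono (t2 - τ) t2 h.le (by linarith) le_rfl
          have := P.pos (t2 - τ)
          nlinarith
        · filter_upwards [Ioo_mem_nhdsLT (show r + τ < t2 by linarith)] with t ht
          refine P.eql ?_
          rw [← hr2]
          exact hmono r (t - τ) le_rfl (by linarith [ht.1]) (by linarith [ht.2])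
    obtain ⟨t, h1, h2⟩ := (hpos.and (Ioo_mem_nhdsLT hr2t)).exists
    have := hneg t h2.1 h2.2
    linarith
  have hle : ∀ t ≥ r, φ t ≤ 1 := by
    intro t ht
    have := grow_bound (f := fun t => - φ t) (f' := fun t => - D t) (C := 0) ht (by fun_prop)
      (fun x hx => (P.hφ x).neg) (fun x hx => by
        have := hdec x hx.1
        linarith)
    linarith
  have := le_of_tendsto P.top (b := 1) (by
    filter_upwards [eventually_ge_atTop r] with t ht using hle t ht)
  norm_num at this


/-! ### Part H: the compatibility condition and uniqueness -/

lemma Prof.gt1 {k c τ lam : ℝ} {φ D e e' : ℝ → ℝ} (hk : 1 < k) (hk3 : k < 3) (hτ : 0 ≤ τ)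
    (P : Prof k c τ φ D) (M : Mode k c τ lam e e') : ∀ t > 0, 1 < φ t := by
  rcases hτ.eq_or_lt with h | h
  · subst h; exact P.gt_one_zero hk
  · exact P.gt_one hk hk3 h M

def ellE (c τ μ : ℝ) (e e' : ℝ → ℝ) : ℝ :=
  e' τ + (μ - c) * e τ + (∫ r in (0:ℝ)..τ, Real.exp (-(μ * r)) * e r)

lemma ell_pB {k c τ lam μ : ℝ} {e e' : ℝ → ℝ} (hk : 1 < k) (M : Mode k c τ lam e e') (hμ0 : 0 < μ)
    (hμ : μ ^ 2 - c * μ - 1 - Real.exp (-(μ * τ)) = 0) (B : ℝ) :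
    qB lam B e' τ + (μ - c) * (pB lam B e τ - 2)
      + (∫ r in (0:ℝ)..τ, Real.exp (-(μ * r)) * (pB lam B e r - 2))
      = (k + 1) / (μ - lam) + B * ellE c τ μ e e' - 4 / μ := by
  have h1 := ell_exp M.root (root_lt_mu hk hμ0 hμ M.root.le) hμ
  have hec := M.cont_e
  have e1 : ∀ r, Real.exp (-(μ * r)) * (pB lam B e r - 2) =
      Real.exp (-(μ * r)) * Real.exp (lam * r) + B * (Real.exp (-(μ * r)) * e r)
        - 2 * Real.exp ((-μ) * r) := by
    intro r
    rw [show (-μ) * r = -(μ * r) by ring]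
    simp only [pB]; ring
  simp only [e1]
  rw [intervalIntegral.integral_sub (Continuous.intervalIntegrable (by fun_prop) _ _)
    (Continuous.intervalIntegrable (by fun_prop) _ _),
    intervalIntegral.integral_add (Continuous.intervalIntegrable (by fun_prop) _ _)
    (Continuous.intervalIntegrable (by fun_prop) _ _),
    intervalIntegral.integral_const_mul, intervalIntegral.integral_const_mul,
    int_exp (by linarith)]
  rw [← h1]
  simp only [ellE, pB, qB]
  have e2 : Real.exp ((-μ) * τ) = Real.exp (-(μ * τ)) := by ring_nf
  rw [e2, mul_zero, Real.exp_zero]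
  have e3 : 2 * (μ - c) + 2 * ((Real.exp (-(μ * τ)) - 1) / (-μ)) = 4 / μ := by
    field_simp
    linear_combination 2 * hμ
  linear_combination -e3

lemma Prof.cond0 {k c τ μ : ℝ} {φ D : ℝ → ℝ} (hτ : 0 ≤ τ) (hμ0 : 0 < μ)
    (hμ : μ ^ 2 - c * μ - 1 - Real.exp (-(μ * τ)) = 0)
    (P : Prof k c τ φ D) (h1 : ∀ t > 0, 1 < φ t) :
    D τ + (μ - c) * (φ τ - 2) + (∫ r in (0:ℝ)..τ, Real.exp (-(μ * r)) * (φ r - 2)) = 0 := by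
  have hc := P.cont
  have hDc := P.hD
  have hwc : Continuous (fun r => Real.exp (-(μ * r)) * (φ r - 2)) := by fun_prop
  set K : ℝ → ℝ := fun t => Real.exp (-μ * t) * (D t + (μ - c) * (φ t - 2))
    + Real.exp (-(μ * τ)) * ∫ r in (t - τ)..t, Real.exp (-(μ * r)) * (φ r - 2) with hK
  have hic := continuous_iff_continuousAt.2 fun t => (hasDerivAt_int_delay hwc τ t).continuousAt
  have hKc : Continuous K := by fun_prop
  have hKd : ∀ t > τ, HasDerivAt K 0 t := by
    intro t ht
    have hd := P.eqg (t := t) (h1 _ (by linarith))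
    have := (((hasDerivAt_expm (-μ) t).mul (hd.add (((P.hφ t).sub_const 2).const_mul (μ - c)))).add
      ((hasDerivAt_int_delay hwc τ t).const_mul (Real.exp (-(μ * τ)))))
    refine this.congr_deriv ?_
    have e1 : Real.exp (-(μ * τ)) * Real.exp (-(μ * (t - τ))) = Real.exp (-μ * t) := by
      rw [← Real.exp_add]; ring_nf
    have e2 : Real.exp (-(μ * t)) = Real.exp (-μ * t) := by ring_nf
    rw [e2]
    simp only [Pi.add_apply]
    linear_combination (-(Real.exp (-μ * t) * (φ t - 2))) * hμ - (φ (t - τ) - 2) * e1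
  have hconst : ∀ t ≥ τ, K t = K τ := by
    intro t ht
    refine constant_of_has_deriv_right_zero (f := fun s => K s) (a := τ) (b := t)
      hKc.continuousOn ?_ t ⟨ht, le_rfl⟩
    intro x hx
    rcases hx.1.eq_or_lt with h | h
    · rw [← h]
      refine hasDerivWithinAt_Ici_of_tendsto_deriv (s := Ioi τ) (f := K) ?_
        hKc.continuousWithinAt self_mem_nhdsWithin ?_
      · intro y hy
        exact (hKd y hy).differentiableAt.differentiableWithinAt
      · refine tendsto_const_nhds.congr' ?_
        filter_upwards [self_mem_nhdsWithin] with y hy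
        exact ((hKd y hy).deriv).symm
    · exact (hKd x h).hasDerivWithinAt
  have hKτ : K τ = Real.exp (-μ * τ) * (D τ + (μ - c) * (φ τ - 2)
      + ∫ r in (0:ℝ)..τ, Real.exp (-(μ * r)) * (φ r - 2)) := by
    simp only [hK, sub_self]
    rw [show -(μ * τ) = -μ * τ by ring]; ring
  suffices H : K τ = 0 by
    rw [hKτ] at H
    rcases mul_eq_zero.1 H with h | h
    · exact absurd h (Real.exp_pos _).ne'
    · exact h
  obtain ⟨T, hT⟩ : ∃ T, ∀ t ≥ T, |φ t - 2| ≤ 1 := by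
    have := P.top.eventually (Metric.ball_mem_nhds 2 one_pos)
    rw [eventually_atTop] at this
    obtain ⟨T, hT⟩ := this
    refine ⟨T, fun t ht => ?_⟩
    have := hT t ht
    rw [Real.dist_eq] at this
    exact this.le
  set C := |μ - c| + τ with hC
  have hCnn : 0 ≤ C := by positivity
  have hest : ∀ t, T + τ ≤ t → τ ≤ t → |D t - Real.exp (μ * t) * K τ| ≤ C := by
    intro t ht htτ
    have h1 := hconst t htτ
    have e1 : Real.exp (μ * t) * Real.exp (-μ * t) = 1 := by rw [← Real.exp_add]; simp
    have h2 : D t - Real.exp (μ * t) * K τ = -((μ - c) * (φ t - 2)) -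
        Real.exp (μ * t) * (Real.exp (-(μ * τ)) * ∫ r in (t - τ)..t, Real.exp (-(μ * r)) * (φ r - 2)) := by
      rw [← h1]
      simp only [hK]
      linear_combination -(D t + (μ - c) * (φ t - 2)) * e1
    have h3 : |∫ r in (t - τ)..t, Real.exp (-(μ * r)) * (φ r - 2)| ≤ Real.exp (-(μ * (t - τ))) * τ := by
      have := intervalIntegral.norm_integral_le_of_norm_le_const
        (a := t - τ) (b := t) (f := fun r => Real.exp (-(μ * r)) * (φ r - 2))
        (C := Real.exp (-(μ * (t - τ)))) ?_
      · rw [Real.norm_eq_abs] at this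
        refine this.trans (le_of_eq ?_)
        rw [abs_of_nonneg (by linarith)]; ring
      · intro x hx
        rw [uIoc_of_le (by linarith)] at hx
        rw [norm_mul, Real.norm_eq_abs, Real.norm_eq_abs, abs_of_pos (Real.exp_pos _)]
        have a1 := hT x (by linarith [hx.1])
        have a2 : Real.exp (-(μ * x)) ≤ Real.exp (-(μ * (t - τ))) := by
          apply Real.exp_le_exp.2; nlinarith [hx.1]
        calc _ ≤ Real.exp (-(μ * (t - τ))) * 1 := by gcongr
          _ = _ := mul_one _
    have e2 : Real.exp (μ * t) * (Real.exp (-(μ * τ)) * (Real.exp (-(μ * (t - τ))) * τ)) = τ := by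
      rw [← mul_assoc, ← mul_assoc, ← Real.exp_add, ← Real.exp_add]
      ring_nf; simp
    rw [h2]
    refine (abs_sub _ _).trans ?_
    rw [abs_neg, abs_mul, abs_mul, abs_mul, abs_of_pos (Real.exp_pos _), abs_of_pos (Real.exp_pos _)]
    have a1 := hT t (by linarith)
    have a2 : |μ - c| * |φ t - 2| ≤ |μ - c| * 1 := by gcongr
    have a3 : Real.exp (μ * t) * (Real.exp (-(μ * τ)) *
        |∫ r in (t - τ)..t, Real.exp (-(μ * r)) * (φ r - 2)|) ≤ τ := by
      refine le_trans ?_ e2.le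
      gcongr
    linarith
  by_contra hne
  have hKpos : 0 < |K τ| := abs_pos.2 hne
  -- large time
  obtain ⟨T2, hT2⟩ : ∃ T2, ∀ t ≥ T2, C + 1 ≤ Real.exp (μ * t) * |K τ| := by
    have l : Tendsto (fun t => Real.exp (μ * t) * |K τ|) atTop atTop :=
      (Real.tendsto_exp_atTop.comp (tendsto_id.const_mul_atTop hμ0)).atTop_mul_const hKpos
    exact eventually_atTop.1 (l.eventually_ge_atTop (C + 1))
  set T3 := max (max T2 (T + τ)) τ with hT3
  have b1 : T2 ≤ T3 := (le_max_left _ _).trans (le_max_left _ _)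
  have b2 : T + τ ≤ T3 := (le_max_right _ _).trans (le_max_left _ _)
  have b3 : τ ≤ T3 := le_max_right _ _
  have f1 := hT T3 (by linarith)
  have f2 := hT (T3 + 3) (by linarith)
  rw [abs_le] at f1 f2
  rcases lt_or_gt_of_ne hne with h | h
  · have := grow_bound (f := fun t => - φ t) (f' := fun t => - D t) (C := 1)
      (show T3 ≤ T3 + 3 by linarith) (by fun_prop) (fun x hx => (P.hφ x).neg) (fun x hx => by
        have g1 := hest x (by linarith [hx.1]) (by linarith [hx.1])
        have g2 := hT2 x (by linarith [hx.1])
        rw [abs_of_neg h] at g2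
        rw [abs_le] at g1
        linarith [g1.2])
    linarith
  · have := grow_bound (f := φ) (f' := D) (C := 1)
      (show T3 ≤ T3 + 3 by linarith) (by fun_prop) (fun x hx => (P.hφ x)) (fun x hx => by
        have g1 := hest x (by linarith [hx.1]) (by linarith [hx.1])
        have g2 := hT2 x (by linarith [hx.1])
        rw [abs_of_pos h] at g2
        rw [abs_le] at g1
        linarith [g1.1])
    linarith

lemma Prof.cond {k c τ lam μ B : ℝ} {φ D e e' : ℝ → ℝ} (hk : 1 < k) (hk3 : k < 3) (hτ : 0 ≤ τ)
    (hμ0 : 0 < μ) (hμ : μ ^ 2 - c * μ - 1 - Real.exp (-(μ * τ)) = 0)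
    (P : Prof k c τ φ D) (M : Mode k c τ lam e e')
    (h1 : ∀ t ≤ τ, φ t = pB lam B e t) (h2 : ∀ t ≤ τ, D t = qB lam B e' t) :
    (k + 1) / (μ - lam) + B * ellE c τ μ e e' = 4 / μ := by
  have h := P.cond0 hτ hμ0 hμ (P.gt1 hk hk3 hτ M)
  have := ell_pB hk M hμ0 hμ B
  rw [h1 τ le_rfl, h2 τ le_rfl] at h
  have e : (∫ r in (0:ℝ)..τ, Real.exp (-(μ * r)) * (φ r - 2)) =
      ∫ r in (0:ℝ)..τ, Real.exp (-(μ * r)) * (pB lam B e r - 2) := by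
    apply intervalIntegral.integral_congr
    intro r hr
    rw [uIcc_of_le hτ] at hr
    simp only [h1 r hr.2]
  rw [e] at h
  linarith

/-- uniqueness for the delayed equation to the right of `τ` -/
lemma uniq_lem {c τ : ℝ} {d E : ℝ → ℝ} (hτ : 0 ≤ τ) (hd : ∀ t, HasDerivAt d (E t) t) (hE : Continuous E)
    (h0 : ∀ t ≤ τ, d t = 0) (heq : ∀ t > τ, HasDerivAt E (c * E t + d t + d (t - τ)) t)
    (htop : Tendsto d atTop (nhds 0)) : ∀ t, d t = 0 := by
  have hdc : Continuous d := continuous_iff_continuousAt.2 fun t => (hd t).continuousAt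
  by_contra hcon
  push Not at hcon
  obtain ⟨ts, hts⟩ := hcon
  have hpos : 0 < |d ts| := abs_pos.2 hts
  obtain ⟨T, hT⟩ : ∃ T, ∀ t ≥ T, |d t| < |d ts| := by
    have := htop.eventually (Metric.ball_mem_nhds 0 hpos)
    rw [eventually_atTop] at this
    obtain ⟨T, hT⟩ := this
    refine ⟨T, fun t ht => ?_⟩
    simpa using hT t ht
  have hτs : τ < ts := by
    by_contra h; push Not at h
    exact hts (h0 ts h)
  have hsT : ts < T := by
    by_contra h; push Not at h
    have := hT ts h; linarith
  obtain ⟨tm, htm, hmax⟩ := isCompact_Icc.exists_isMaxOn (nonempty_Icc.2 (hτs.trans hsT).le)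
    hdc.abs.continuousOn
  have hge : |d ts| ≤ |d tm| := hmax ⟨hτs.le, hsT.le⟩
  set m := |d tm| with hm
  have hm0 : 0 < m := by linarith
  have hall : ∀ t, |d t| ≤ m := by
    intro t
    rcases le_or_gt t τ with h | h
    · rw [h0 t h]; simpa using hm0.le
    · rcases le_or_gt t T with h' | h'
      · exact hmax ⟨h.le, h'⟩
      · have := hT t h'.le; linarith
  have hK : IsCompact (Icc τ T ∩ {t | m ≤ |d t|}) :=
    isCompact_Icc.inter_right (isClosed_le continuous_const hdc.abs)
  obtain ⟨t1, ⟨ht1, hm1⟩, hleast⟩ := hK.exists_isLeast ⟨tm, htm, hm.le⟩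
  have hm1 : m ≤ |d t1| := hm1
  have hτ1 : τ < t1 := by
    by_contra h; push Not at h
    rw [h0 t1 h] at hm1
    simp at hm1; linarith
  have hbefore : ∀ t < t1, |d t| < m := by
    intro t ht
    rcases le_or_gt t τ with h | h
    · rw [h0 t h]; simpa using hm0
    · by_contra hc; push Not at hc
      have := hleast ⟨⟨h.le, ht.le.trans ht1.2⟩, hc⟩
      linarith
  have hz : d t1 - - d (t1 - τ) ≠ 0 ∧ |d (t1 - τ)| ≤ |d t1| ∧ (τ = 0 ∨ |d (t1 - τ)| < |d t1|) := by
    rcases hτ.eq_or_lt with h | h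
    · rw [← h, sub_zero]
      refine ⟨?_, le_rfl, Or.inl rfl⟩
      intro hh
      have : d t1 = 0 := by linarith
      rw [this] at hm1; simp at hm1; linarith
    · have := hbefore (t1 - τ) (by linarith)
      refine ⟨?_, by linarith, Or.inr (by linarith)⟩
      intro hh
      have : d t1 = - d (t1 - τ) := by linarith
      rw [this, abs_neg] at hm1; linarith
  have hFc : Continuous (fun t => c * E t + d t + d (t - τ)) := by fun_prop
  have hev : ∀ᶠ t in nhdsWithin t1 (Iio t1), HasDerivAt E (c * E t + d t + d (t - τ)) t := by
    filter_upwards [Ioo_mem_nhdsLT hτ1] with t ht using heq t ht.1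
  rcases le_or_gt 0 (d t1) with hs | hs
  · have hloc : IsLocalMax d t1 := by
      filter_upwards with t
      have := hall t
      rw [abs_of_nonneg hs] at hm1
      exact (le_abs_self _).trans (this.trans hm1)
    have hE1 : E t1 = 0 := hloc.hasDerivAt_eq_zero (hd t1)
    have hFp : 0 < c * E t1 + d t1 + d (t1 - τ) := by
      rw [hE1]
      have h1 := hz.2.1
      rw [abs_of_nonneg hs, abs_le] at h1
      have : 0 ≤ d t1 + d (t1 - τ) := by linarith [h1.1]
      rcases this.lt_or_eq with h | h
      · linarith
      · exact absurd (by linarith) hz.1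
    obtain ⟨t, h1, h2⟩ := ((incr_left hd (sgn_left hE hFc hE1 hFp hev)).and
      (nhdsWithin_le_nhds hloc : ∀ᶠ t in nhdsWithin t1 (Iio t1), d t ≤ d t1)).exists
    linarith
  · have hloc : IsLocalMin d t1 := by
      filter_upwards with t
      have := hall t
      rw [abs_of_neg hs] at hm1
      have := neg_abs_le (d t)
      linarith
    have hE1 : E t1 = 0 := hloc.hasDerivAt_eq_zero (hd t1)
    have hFp : c * E t1 + d t1 + d (t1 - τ) < 0 := by
      rw [hE1]
      have h1 := hz.2.1
      rw [abs_of_neg hs, abs_le] at h1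
      have : d t1 + d (t1 - τ) ≤ 0 := by linarith [h1.2]
      rcases this.lt_or_eq with h | h
      · linarith
      · exact absurd (by linarith) hz.1
    have hneg := (sgn_left' hE hFc hE1 hFp hev).mono (p := fun t => 0 < E t)
      (q := fun t => - E t < 0) (fun t ht => by linarith)
    obtain ⟨t, h1, h2⟩ := ((incr_left (φ := fun t => - d t) (D := fun t => - E t)
      (fun t => (hd t).neg) hneg).and
      (nhdsWithin_le_nhds hloc : ∀ᶠ t in nhdsWithin t1 (Iio t1), d t1 ≤ d t)).exists
    linarith

lemma Prof.unique {k c τ lam μ : ℝ} {φ D ψ E e e' : ℝ → ℝ} (hk : 1 < k) (hk3 : k < 3) (hτ : 0 ≤ τ)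
    (hμ0 : 0 < μ) (hμ : μ ^ 2 - c * μ - 1 - Real.exp (-(μ * τ)) = 0)
    (P : Prof k c τ φ D) (R : Prof k c τ ψ E) (M : Mode k c τ lam e e') : ∀ t, φ t = ψ t := by
  obtain ⟨B, hB, h1, h2⟩ := P.expl M
  obtain ⟨B', hB', h1', h2'⟩ := R.expl M
  have c1 := P.cond hk hk3 hτ hμ0 hμ M h1 h2
  have c2 := R.cond hk hk3 hτ hμ0 hμ M h1' h2'
  have hl : ellE c τ μ e e' < 0 := M.ell μ hμ0 hμ
  have hBB : B = B' := by
    have : (B - B') * ellE c τ μ e e' = 0 := by linarith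
    rcases mul_eq_zero.1 this with h | h
    · linarith
    · linarith
  subst hBB
  have g1 := P.gt1 hk hk3 hτ M
  have g2 := R.gt1 hk hk3 hτ M
  have := uniq_lem (c := c) (τ := τ) (d := fun t => φ t - ψ t) (E := fun t => D t - E t) hτ
    (fun t => (P.hφ t).sub (R.hφ t)) (P.hD.sub R.hD) (fun t ht => by simp only [h1 t ht, h1' t ht, sub_self])
    (fun t ht => by
      refine ((P.eqg (g1 _ (by linarith))).sub (R.eqg (g2 _ (by linarith)))).congr_deriv ?_
      ring) (by simpa using P.top.sub R.top)
  intro t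
  linarith [this t]

lemma Mode.nonlin_B {k c τ lam B s0 s1 σ : ℝ} {φ e e' : ℝ → ℝ} (M : Mode k c τ lam e e') (hB : 0 ≤ B)
    (hσ : 0 < σ) (h1 : ∀ t ≤ τ, φ (t + s1) = pB lam B e t)
    (hO : (fun t => φ (t + s0) - Real.exp (lam * t)) =O[atBot] fun t => Real.exp ((lam + σ) * t)) :
    B = 0 := by
  by_contra hne
  have hBp : 0 < B := lt_of_le_of_ne hB (Ne.symm hne)
  obtain ⟨C, hC⟩ := hO.bound
  have l1 : Tendsto (fun t : ℝ => t + (s0 - s1)) atBot atBot :=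
    tendsto_atBot_add_const_right _ _ tendsto_id
  have l2 := M.egrow.comp l1
  have l3 : Tendsto (fun t => B * (e (t + (s0 - s1)) * Real.exp (-(lam * (t + (s0 - s1)))))
      * Real.exp (lam * (s0 - s1))) atBot atTop :=
    (l2.const_mul_atTop hBp).atTop_mul_const (Real.exp_pos _)
  have ev := l3.eventually_ge_atTop (|C| + 2)
  obtain ⟨t, ha, hb, hc, hd⟩ := (hC.and (ev.and ((l1.eventually_le_atBot τ).and
    (eventually_le_atBot 0)))).exists
  have e1 := h1 _ hc
  rw [show t + (s0 - s1) + s1 = t + s0 by ring] at e1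
  rw [Real.norm_eq_abs, Real.norm_eq_abs, abs_of_pos (Real.exp_pos _), e1] at ha
  have p1 := Real.exp_pos (lam * t)
  have p2 : Real.exp ((lam + σ) * t) ≤ Real.exp (lam * t) := by
    apply Real.exp_le_exp.2; nlinarith
  have ha2 := (le_abs_self _).trans ha
  have ha3 : C * Real.exp ((lam + σ) * t) ≤ |C| * Real.exp (lam * t) := by
    calc _ ≤ |C| * Real.exp ((lam + σ) * t) := by gcongr; exact le_abs_self C
      _ ≤ _ := by gcongr
  simp only [pB] at ha2
  have p3 := Real.exp_pos (lam * (t + (s0 - s1)))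
  have hBe : B * e (t + (s0 - s1)) ≤ (|C| + 1) * Real.exp (lam * t) := by linarith
  have hb' := mul_le_mul_of_nonneg_right hb p1.le
  have e2 : Real.exp (-(lam * (t + (s0 - s1)))) * Real.exp (lam * (s0 - s1)) * Real.exp (lam * t) = 1 := by
    rw [← Real.exp_add, ← Real.exp_add]; ring_nf; simp
  have e3 : B * (e (t + (s0 - s1)) * Real.exp (-(lam * (t + (s0 - s1)))))
      * Real.exp (lam * (s0 - s1)) * Real.exp (lam * t) = B * e (t + (s0 - s1)) := by
    linear_combination B * e (t + (s0 - s1)) * e2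
  rw [e3] at hb'
  linarith


def LL (κ γ τ : ℝ) (z : ℝ → ℝ) (t : ℝ) : ℝ :=
  κ * (Real.exp (γ * t) * ∫ r in (t - τ)..t, Real.exp (-(γ * r)) * z r)

lemma LL_cont {κ γ τ : ℝ} {z : ℝ → ℝ} (hz : Continuous z) : Continuous (LL κ γ τ z) := by
  have hwc : Continuous (fun r => Real.exp (-(γ * r)) * z r) := by fun_prop
  have hic := continuous_iff_continuousAt.2 fun t => (hasDerivAt_int_delay hwc τ t).continuousAt
  unfold LL
  fun_prop

lemma wint_bd {b C x t : ℝ} {v : ℝ → ℝ} (hb : b ≠ 0) (hxt : x ≤ t) (hv : Continuous v) (hC : ∀ s, |v s| ≤ C) :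
    |∫ r in x..t, Real.exp (b * r) * v r| ≤ C * ((Real.exp (b * t) - Real.exp (b * x)) / b) := by
  rw [← int_exp hb, ← intervalIntegral.integral_const_mul]
  refine (intervalIntegral.abs_integral_le_integral_abs hxt).trans ?_
  refine intervalIntegral.integral_mono_on hxt ?_ ?_ ?_
  · exact Continuous.intervalIntegrable (by fun_prop) _ _
  · exact Continuous.intervalIntegrable (by fun_prop) _ _
  · intro r _
    rw [abs_mul, abs_of_pos (Real.exp_pos _), mul_comm]
    exact mul_le_mul_of_nonneg_right (hC r) (Real.exp_pos _).le

lemma LL_bd {κ γ τ C : ℝ} {z : ℝ → ℝ} (hκ : 0 ≤ κ) (hγ : 0 < γ) (hτ : 0 ≤ τ) (hz : Continuous z)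
    (hC : ∀ s, |z s| ≤ C) (t : ℝ) : |LL κ γ τ z t| ≤ κ * ((Real.exp (γ * τ) - 1) / γ) * C := by
  have h := wint_bd (b := -γ) (x := t - τ) (t := t) (by linarith) (by linarith) hz hC
  have e : ∀ r, Real.exp (-γ * r) = Real.exp (-(γ * r)) := fun r => by ring_nf
  simp only [e] at h
  rw [LL, abs_mul, abs_mul, abs_of_nonneg hκ, abs_of_pos (Real.exp_pos _), mul_assoc]
  refine mul_le_mul_of_nonneg_left ?_ hκ
  refine (mul_le_mul_of_nonneg_left h (Real.exp_pos _).le).trans (le_of_eq ?_)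
  have e1 : Real.exp (γ * t) * Real.exp (-(γ * t)) = 1 := by rw [← Real.exp_add]; simp
  have e2 : Real.exp (γ * t) * Real.exp (-(γ * (t - τ))) = Real.exp (γ * τ) := by
    rw [← Real.exp_add]; ring_nf
  have : Real.exp (γ * t) * (C * ((Real.exp (-(γ * t)) - Real.exp (-(γ * (t - τ)))) / -γ)) =
    C * ((Real.exp (γ * t) * Real.exp (-(γ * (t - τ))) - Real.exp (γ * t) * Real.exp (-(γ * t))) / γ) := by
    field_simp
    ring
  rw [this, e1, e2]; ring

lemma LL_sub {κ γ τ : ℝ} {z w : ℝ → ℝ} (hz : Continuous z) (hw : Continuous w) (t : ℝ) :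
    LL κ γ τ z t - LL κ γ τ w t = LL κ γ τ (fun s => z s - w s) t := by
  have i1 : IntervalIntegrable (fun r => Real.exp (-(γ * r)) * z r) MeasureTheory.volume (t - τ) t :=
    Continuous.intervalIntegrable (by fun_prop) _ _
  have i2 : IntervalIntegrable (fun r => Real.exp (-(γ * r)) * w r) MeasureTheory.volume (t - τ) t :=
    Continuous.intervalIntegrable (by fun_prop) _ _
  simp only [LL]
  have : (fun r => Real.exp (-(γ * r)) * (z r - w r)) =
    fun r => Real.exp (-(γ * r)) * z r - Real.exp (-(γ * r)) * w r := by funext r; ring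
  rw [this, intervalIntegral.integral_sub i1 i2]; ring

def TT (b κ γ τ : ℝ) (f z : ℝ → ℝ) (t : ℝ) : ℝ :=
  f (max 0 (min t τ)) - f τ + Real.exp (-(b * (max t τ - τ))) * f τ
    - Real.exp (-(b * max t τ)) * ∫ r in τ..(max t τ), Real.exp (b * r) * LL κ γ τ z r

lemma TT_int_bd {b C τ t : ℝ} {v : ℝ → ℝ} (hb : 0 < b) (hv : Continuous v) (hC : ∀ s, |v s| ≤ C) :
    |Real.exp (-(b * max t τ)) * ∫ r in τ..(max t τ), Real.exp (b * r) * v r| ≤ C / b := by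
  have h := wint_bd hb.ne' (le_max_right t τ) hv hC
  have hC0 : 0 ≤ C := (abs_nonneg _).trans (hC 0)
  rw [abs_mul, abs_of_pos (Real.exp_pos _)]
  refine (mul_le_mul_of_nonneg_left h (Real.exp_pos _).le).trans ?_
  have e1 : Real.exp (-(b * max t τ)) * Real.exp (b * max t τ) = 1 := by rw [← Real.exp_add]; simp
  have : Real.exp (-(b * max t τ)) * (C * ((Real.exp (b * max t τ) - Real.exp (b * τ)) / b)) =
    C * ((Real.exp (-(b * max t τ)) * Real.exp (b * max t τ) - Real.exp (-(b * max t τ)) * Real.exp (b * τ)) / b) := by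
    ring
  rw [this, e1, div_eq_mul_inv C b, div_eq_mul_inv]
  refine mul_le_mul_of_nonneg_left ?_ hC0
  have : 0 < Real.exp (-(b * max t τ)) * Real.exp (b * τ) := by positivity
  have hb' : 0 < b⁻¹ := inv_pos.2 hb
  nlinarith

lemma TT_cont {b κ γ τ : ℝ} {f z : ℝ → ℝ} (hf : Continuous f) (hz : Continuous z) :
    Continuous (TT b κ γ τ f z) := by
  have hl := LL_cont (κ := κ) (γ := γ) (τ := τ) hz
  have hwc : Continuous (fun r => Real.exp (b * r) * LL κ γ τ z r) := by fun_prop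
  have h1 : Continuous (fun x : ℝ => ∫ r in τ..x, Real.exp (b * r) * LL κ γ τ z r) :=
    intervalIntegral.continuous_primitive (fun _ _ => hwc.intervalIntegrable _ _) τ
  have h2 : Continuous (fun t : ℝ => ∫ r in τ..(max t τ), Real.exp (b * r) * LL κ γ τ z r) :=
    h1.comp (by fun_prop)
  unfold TT
  fun_prop

lemma TT_bdd {b κ γ τ C : ℝ} {f z : ℝ → ℝ} (hb : 0 < b) (hκ : 0 ≤ κ) (hγ : 0 < γ) (hτ : 0 ≤ τ)
    (hf : Continuous f) (hz : Continuous z) (hC : ∀ s, |z s| ≤ C) :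
    ∃ K, ∀ t, |TT b κ γ τ f z t| ≤ K := by
  obtain ⟨F, hF⟩ := isCompact_Icc.exists_bound_of_continuousOn (hf.continuousOn (s := Icc 0 τ))
  refine ⟨F + F + F + (κ * ((Real.exp (γ * τ) - 1) / γ) * C) / b, fun t => ?_⟩
  have h1 := TT_int_bd (t := t) (τ := τ) hb (LL_cont hz) (LL_bd hκ hγ hτ hz hC)
  have h2 : |f (max 0 (min t τ))| ≤ F := hF _ ⟨le_max_left _ _, max_le hτ (min_le_right _ _)⟩
  have h3 : |f τ| ≤ F := hF _ ⟨hτ, le_rfl⟩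
  have h4 : |Real.exp (-(b * (max t τ - τ))) * f τ| ≤ F := by
    rw [abs_mul, abs_of_pos (Real.exp_pos _)]
    have : Real.exp (-(b * (max t τ - τ))) ≤ 1 := by
      rw [Real.exp_le_one_iff]
      have := le_max_right t τ
      nlinarith
    have := mul_le_mul_of_nonneg_right this (abs_nonneg (f τ))
    linarith
  rw [TT]
  rw [abs_le] at *
  constructor <;> linarith [h1.1, h1.2, h2.1, h2.2, h3.1, h3.2, h4.1, h4.2]

lemma TT_sub {b κ γ τ C : ℝ} {f z w : ℝ → ℝ} (hb : 0 < b) (hκ : 0 ≤ κ) (hγ : 0 < γ) (hτ : 0 ≤ τ)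
    (hz : Continuous z) (hw : Continuous w) (hC : ∀ s, |z s - w s| ≤ C) (t : ℝ) :
    |TT b κ γ τ f z t - TT b κ γ τ f w t| ≤ (κ * ((Real.exp (γ * τ) - 1) / γ) * C) / b := by
  have hzw : Continuous (fun s => z s - w s) := hz.sub hw
  have h1 := TT_int_bd (t := t) (τ := τ) hb (LL_cont hzw) (LL_bd hκ hγ hτ hzw hC)
  have hl := LL_cont (κ := κ) (γ := γ) (τ := τ) hz
  have hl' := LL_cont (κ := κ) (γ := γ) (τ := τ) hw
  have i1 : IntervalIntegrable (fun r => Real.exp (b * r) * LL κ γ τ z r) MeasureTheory.volume τ (max t τ) :=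
    Continuous.intervalIntegrable (by fun_prop) _ _
  have i2 : IntervalIntegrable (fun r => Real.exp (b * r) * LL κ γ τ w r) MeasureTheory.volume τ (max t τ) :=
    Continuous.intervalIntegrable (by fun_prop) _ _
  have e : (fun r => Real.exp (b * r) * LL κ γ τ (fun s => z s - w s) r) =
    fun r => Real.exp (b * r) * LL κ γ τ z r - Real.exp (b * r) * LL κ γ τ w r := by
    funext r; rw [← LL_sub hz hw]; ring
  rw [e, intervalIntegral.integral_sub i1 i2] at h1
  rw [← abs_neg]
  convert h1 using 2
  simp only [TT]; ring

lemma solve1 {b κ γ τ : ℝ} {f : ℝ → ℝ} (hb : 0 < b) (hκ : 0 ≤ κ) (hγ : 0 < γ) (hτ : 0 ≤ τ)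
    (hf : Continuous f) (hlt : κ * ((Real.exp (γ * τ) - 1) / γ) < b) :
    ∃ z : ℝ → ℝ, Continuous z ∧ (∃ K, ∀ t, |z t| ≤ K) ∧ ∀ t, z t = TT b κ γ τ f z t := by
  set W := κ * ((Real.exp (γ * τ) - 1) / γ) with hW
  have hW0 : 0 ≤ W := by
    have : 1 ≤ Real.exp (γ * τ) := Real.one_le_exp (by positivity)
    have : 0 ≤ Real.exp (γ * τ) - 1 := by linarith
    positivity
  have hbd : ∀ z : BoundedContinuousFunction ℝ ℝ, ∃ K, ∀ t, ‖TT b κ γ τ f z t‖ ≤ K := fun z =>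
    TT_bdd hb hκ hγ hτ hf z.continuous (fun s => z.norm_coe_le_norm s)
  let Φ : BoundedContinuousFunction ℝ ℝ → BoundedContinuousFunction ℝ ℝ := fun z =>
    BoundedContinuousFunction.ofNormedAddCommGroup (TT b κ γ τ f z) (TT_cont hf z.continuous)
      (hbd z).choose (hbd z).choose_spec
  have hcon : ContractingWith (W / b).toNNReal Φ := by
    refine ⟨?_, ?_⟩
    · rw [← NNReal.coe_lt_coe, Real.coe_toNNReal _ (by positivity)]
      simpa using (div_lt_one hb).2 hlt
    · refine LipschitzWith.of_dist_le_mul fun z w => ?_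
      rw [Real.coe_toNNReal _ (by positivity)]
      refine (BoundedContinuousFunction.dist_le (by positivity)).2 fun t => ?_
      have := TT_sub (f := f) hb hκ hγ hτ z.continuous w.continuous (C := dist z w)
        (fun s => by rw [← Real.dist_eq]; exact BoundedContinuousFunction.dist_coe_le_dist s) t
      rw [Real.dist_eq]
      refine (le_of_eq ?_).trans (this.trans (le_of_eq ?_))
      · rfl
      · rw [hW]; ring
  have hfix := hcon.fixedPoint_isFixedPt
  set z := ContractingWith.fixedPoint Φ hcon
  refine ⟨z, z.continuous, ⟨‖z‖, fun t => z.norm_coe_le_norm t⟩, fun t => ?_⟩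
  have : Φ z = z := hfix
  have h2 : (Φ z) t = z t := by rw [this]
  rw [← h2]; rfl


lemma solve2 {b κ γ τ : ℝ} {f : ℝ → ℝ} (hb : 0 < b) (hκ : 0 ≤ κ) (hγ : 0 < γ) (hτ : 0 ≤ τ)
    (hf : Continuous f) (hlt : κ * ((Real.exp (γ * τ) - 1) / γ) < b) :
    ∃ z : ℝ → ℝ, Continuous z ∧ (∀ t ≤ τ, z t = f t) ∧ (∃ K, ∀ t ≥ τ, |z t| ≤ K) ∧
      ∀ t > τ, HasDerivAt z (-(b * z t) - LL κ γ τ z t) t := by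
  obtain ⟨w, hwc, ⟨K, hK⟩, hw⟩ := solve1 hb hκ hγ hτ hf hlt
  have hl := LL_cont (κ := κ) (γ := γ) (τ := τ) hwc
  have hw0 : ∀ t, 0 ≤ t → t ≤ τ → w t = f t := by
    intro t h0 h1
    rw [hw t, TT, max_eq_right h1, min_eq_left h1, max_eq_right h0]
    simp
  have hw1 : ∀ t ≥ τ, w t = Real.exp (-(b * t)) * (Real.exp (b * τ) * f τ
      - ∫ r in τ..t, Real.exp (b * r) * LL κ γ τ w r) := by
    intro t ht
    rw [hw t, TT, max_eq_left ht, min_eq_right ht, max_eq_right hτ]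
    have : Real.exp (-(b * (t - τ))) = Real.exp (-(b * t)) * Real.exp (b * τ) := by
      rw [← Real.exp_add]; ring_nf
    rw [this]; ring
  have hwcE : Continuous (fun r => Real.exp (b * r) * LL κ γ τ w r) := by fun_prop
  have hwd : ∀ t > τ, HasDerivAt w (-(b * w t) - LL κ γ τ w t) t := by
    intro t ht
    have h1 : HasDerivAt (fun t => ∫ r in τ..t, Real.exp (b * r) * LL κ γ τ w r)
        (Real.exp (b * t) * LL κ γ τ w t) t :=
      intervalIntegral.integral_hasDerivAt_right (hwcE.intervalIntegrable _ _)
        (hwcE.stronglyMeasurableAtFilter _ _) hwcE.continuousAt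
    have h2 := (hasDerivAt_expm (-b) t).mul (h1.const_sub (Real.exp (b * τ) * f τ))
    have e : ∀ r, Real.exp (-b * r) = Real.exp (-(b * r)) := fun r => by ring_nf
    simp only [e] at h2
    have h3 : HasDerivAt w _ t := h2.congr_of_eventuallyEq
      (by filter_upwards [lt_mem_nhds ht] with s hs; exact hw1 s hs.le)
    refine h3.congr_deriv ?_
    rw [hw1 t ht.le]
    have e1 : Real.exp (-(b * t)) * Real.exp (b * t) = 1 := by rw [← Real.exp_add]; simp
    linear_combination (-LL κ γ τ w t) * e1
  set z : ℝ → ℝ := fun t => if t ≤ τ then f t else w t with hz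
  have hz0 : ∀ t ≤ τ, z t = f t := fun t ht => if_pos ht
  have hz1 : ∀ t, 0 ≤ t → z t = w t := by
    intro t ht
    by_cases h : t ≤ τ
    · rw [hz0 t h, hw0 t ht h]
    · exact if_neg h
  have hzc : Continuous z := by
    refine Continuous.if_le hf hwc continuous_id continuous_const ?_
    intro x hx
    have hx : x = τ := hx
    rw [hx, hw0 τ hτ le_rfl]
  refine ⟨z, hzc, hz0, ⟨K, fun t ht => ?_⟩, fun t ht => ?_⟩
  · rw [hz1 t (hτ.trans ht)]; exact hK t
  · have h3 : HasDerivAt z _ t := (hwd t ht).congr_of_eventuallyEq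
      (by filter_upwards [lt_mem_nhds ht] with s hs; exact hz1 s (hτ.trans hs.le))
    refine h3.congr_deriv ?_
    rw [hz1 t (hτ.trans ht.le)]
    have : LL κ γ τ w t = LL κ γ τ z t := by
      simp only [LL]
      congr 2
      apply intervalIntegral.integral_congr
      intro r hr
      rw [uIcc_of_le (by linarith)] at hr
      have := hr.1
      simp only
      rw [hz1 r (by linarith)]
    rw [this]

lemma solve3 {b κ μ τ : ℝ} {f : ℝ → ℝ} (hb : 0 < b) (hκ : 0 ≤ κ) (hμ : 0 < μ) (hτ : 0 ≤ τ)
    (hf : Continuous f) (hlt : κ * ((Real.exp (μ * τ) - 1) / μ) < b) :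
    ∃ z : ℝ → ℝ, Continuous z ∧ (∀ t ≤ τ, z t = f t) ∧ Tendsto z atTop (nhds 0) ∧
      ∀ t > τ, HasDerivAt z (-(b * z t) - LL κ μ τ z t) t := by
  obtain ⟨η, hη, hηb, hηl⟩ : ∃ η, 0 < η ∧ η < b ∧
      κ * ((Real.exp ((μ + η) * τ) - 1) / (μ + η)) < b - η := by
    have hc : ContinuousAt (fun η : ℝ => κ * ((Real.exp ((μ + η) * τ) - 1) / (μ + η)) - (b - η)) 0 := by
      have : (μ + (0:ℝ)) ≠ 0 := by linarith
      fun_prop (disch := exact this)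
    have h00 : κ * ((Real.exp ((μ + 0) * τ) - 1) / (μ + 0)) - (b - 0) < 0 := by
      simp only [add_zero, sub_zero]; linarith
    have h1 := hc.eventually (gt_mem_nhds h00)
    have h2 := (h1.filter_mono (nhdsWithin_le_nhds (s := Ioi 0))).and
      ((((gt_mem_nhds hb).filter_mono (nhdsWithin_le_nhds (s := Ioi 0)))).and
        (self_mem_nhdsWithin : ∀ᶠ x in nhdsWithin (0:ℝ) (Ioi 0), x ∈ Ioi (0:ℝ)))
    obtain ⟨η, h3, h4, h5⟩ := h2.exists
    exact ⟨η, h5, h4, by linarith⟩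
  obtain ⟨z, hzc, hz0, ⟨K, hK⟩, hz⟩ := solve2 (f := fun t => Real.exp (η * t) * f t)
    (b := b - η) (γ := μ + η) (by linarith) hκ (by linarith) hτ (by fun_prop) hηl
  have e1 : ∀ t, Real.exp (-η * t) * Real.exp (η * t) = 1 := fun t => by rw [← Real.exp_add]; simp
  refine ⟨fun t => Real.exp (-η * t) * z t, by fun_prop, fun t ht => ?_, ?_, fun t ht => ?_⟩
  · simp only []
    rw [hz0 t ht, ← mul_assoc, e1]; simp
  · have h0 : Tendsto (fun t => Real.exp (-η * t) * K) atTop (nhds 0) := by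
      have : Tendsto (fun t : ℝ => Real.exp (-η * t)) atTop (nhds 0) :=
        Real.tendsto_exp_atBot.comp (tendsto_id.const_mul_atTop_of_neg (by linarith))
      simpa using this.mul_const K
    refine squeeze_zero_norm' ?_ h0
    filter_upwards [eventually_ge_atTop τ] with t ht
    rw [norm_mul, Real.norm_eq_abs, Real.norm_eq_abs, abs_of_pos (Real.exp_pos _)]
    exact mul_le_mul_of_nonneg_left (hK t ht) (Real.exp_pos _).le
  · refine ((hasDerivAt_expm (-η) t).mul (hz t ht)).congr_deriv ?_
    have : LL κ μ τ (fun t => Real.exp (-η * t) * z t) t = Real.exp (-η * t) * LL κ (μ + η) τ z t := by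
      simp only [LL]
      have e2 : (fun r => Real.exp (-(μ * r)) * (Real.exp (-η * r) * z r)) =
          fun r => Real.exp (-((μ + η) * r)) * z r := by
        funext r
        rw [← mul_assoc, ← Real.exp_add]; ring_nf
      rw [e2]
      have e3 : Real.exp (μ * t) = Real.exp (-η * t) * Real.exp ((μ + η) * t) := by
        rw [← Real.exp_add]; ring_nf
      rw [e3]; ring
    rw [this]; ring


lemma first_min {φ : ℝ → ℝ} {ts : ℝ} (hc : Continuous φ) (htop : Tendsto φ atTop (nhds 2)) (hts : 0 ≤ ts)
    (h2 : φ ts < 2) : ∃ t0, 0 ≤ t0 ∧ (∀ t, 0 ≤ t → φ t0 ≤ φ t) ∧ (∀ t, 0 ≤ t → φ t ≤ φ t0 → t0 ≤ t) := by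
  obtain ⟨T0, hT0⟩ := eventually_atTop.1 (htop.eventually (lt_mem_nhds h2))
  set T := max T0 ts with hT
  have htT : ts ∈ Icc 0 T := ⟨hts, le_max_right _ _⟩
  obtain ⟨tm, htm, hmin⟩ := isCompact_Icc.exists_isMinOn ⟨ts, htT⟩ hc.continuousOn
  have hmin' : ∀ t, 0 ≤ t → φ tm ≤ φ t := by
    intro t ht
    by_cases h : t ≤ T
    · exact hmin ⟨ht, h⟩
    · have h3 := hT0 t ((le_max_left _ _).trans (not_le.1 h).le)
      exact (hmin htT).trans h3.le
  have hK : IsCompact (Icc 0 T ∩ {t | φ t ≤ φ tm}) :=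
    isCompact_Icc.inter_right (isClosed_le hc continuous_const)
  obtain ⟨t0, ⟨ht0, hm0⟩, hleast⟩ := hK.exists_isLeast ⟨tm, htm, le_refl (φ tm)⟩
  have hm0 : φ t0 ≤ φ tm := hm0
  refine ⟨t0, ht0.1, fun t ht => hm0.trans (hmin' t ht), fun t ht h => ?_⟩
  by_cases h' : t ≤ T
  · exact hleast ⟨⟨ht, h'⟩, h.trans hm0⟩
  · exact ht0.2.trans (not_le.1 h').le

lemma incr_right {φ D : ℝ → ℝ} {t1 : ℝ} (hφ : ∀ t, HasDerivAt φ (D t) t)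
    (h : ∀ᶠ t in nhdsWithin t1 (Ioi t1), 0 < D t) : ∀ᶠ t in nhdsWithin t1 (Ioi t1), φ t1 < φ t := by
  have := decr_right (φ := fun t => - φ t) (D := fun t => - D t) (fun t => (hφ t).neg)
    (h.mono fun t ht => by linarith)
  exact this.mono fun t ht => by linarith

lemma ge_one {k c τ : ℝ} {φ D : ℝ → ℝ} (hk3 : k < 3) (hk1 : 1 < k) (hτ : 0 ≤ τ)
    (hφ : ∀ t, HasDerivAt φ (D t) t) (hD : Continuous D) (htop : Tendsto φ atTop (nhds 2))
    (h0 : φ 0 = 1) (hlt : ∀ t < 0, φ t < 1)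
    (hQ : ∀ t s, t < s → s ≤ τ → D t ≤ 0 → D s < 0)
    (hl : ∀ t < τ, HasDerivAt D (c * D t + φ t - k * φ (t - τ)) t)
    (hg : ∀ t > τ, HasDerivAt D (c * D t + φ t - (4 - φ (t - τ))) t) : ∀ t, 0 ≤ t → 1 ≤ φ t := by
  have hc : Continuous φ := continuous_iff_continuousAt.2 fun t => (hφ t).continuousAt
  by_contra hcon
  push Not at hcon
  obtain ⟨ts, hts, hφts⟩ := hcon
  obtain ⟨t0, ht0, hmin, hfirst⟩ := first_min hc htop hts (by linarith)
  have hN : φ t0 < 1 := (hmin ts hts).trans_lt hφts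
  have ht0' : 0 < t0 := lt_of_le_of_ne ht0 (by rintro rfl; linarith)
  have hD0 : D t0 = 0 := by
    refine IsLocalMin.hasDerivAt_eq_zero (f := φ) ?_ (hφ t0)
    filter_upwards [lt_mem_nhds ht0'] with s hs using hmin s hs.le
  have hF : Continuous (fun t => c * D t + φ t - (4 - φ (t - τ))) := by fun_prop
  have hG : Continuous (fun t => c * D t + φ t - k * φ (t - τ)) := by fun_prop
  have hgr : ∀ t ≥ τ, ∀ᶠ s in nhdsWithin t (Ioi t), HasDerivAt D (c * D s + φ s - (4 - φ (s - τ))) s := by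
    intro t ht
    filter_upwards [self_mem_nhdsWithin] with s hs
    exact hg s (lt_of_le_of_lt ht hs)
  have ht0τ : τ ≤ t0 := by
    by_contra h
    push Not at h
    have := strictMono_bound (f := fun t => - φ t) (f' := fun t => - D t) h (by fun_prop)
      (fun x _ => (hφ x).neg) (fun x hx => by
        have := hQ t0 x hx.1 hx.2.le hD0.le
        linarith)
    have := hmin τ hτ
    linarith
  have h1 : 4 - φ t0 ≤ φ (t0 - τ) := by
    by_contra h
    push Not at h
    have := decr_right hφ (sgn_right' hD hF hD0 (by simp only [hD0]; linarith) (hgr t0 ht0τ))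
    obtain ⟨s, hs, hs2⟩ := (this.and self_mem_nhdsWithin).exists
    have hs2 : t0 < s := hs2
    have := hmin s (by linarith)
    linarith
  have hpos2 : 0 ≤ t0 - τ := by linarith
  obtain ⟨t1, ht1, hmax, hfirst1⟩ := first_min (φ := fun t => 4 - φ t) (ts := t0 - τ) (by fun_prop)
    (by have := htop.const_sub 4; norm_num at this; exact this) hpos2 (by linarith)
  have hM := hmax _ hpos2
  have ht1' : 0 < t1 := lt_of_le_of_ne ht1 (by rintro rfl; linarith)
  have hD1 : D t1 = 0 := by
    refine IsLocalMax.hasDerivAt_eq_zero (f := φ) ?_ (hφ t1)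
    filter_upwards [lt_mem_nhds ht1'] with s hs
    have := hmax s hs.le
    linarith
  have ht1τ : τ ≤ t1 := by
    by_contra h
    push Not at h
    have hlt1 := hlt (t1 - τ) (by linarith)
    have := incr_right hφ (sgn_right hD hG hD1 (by simp only [hD1]; nlinarith)
      (by filter_upwards [nhdsWithin_le_nhds (gt_mem_nhds h)] with s hs using hl s hs))
    obtain ⟨s, hs, hs2⟩ := (this.and self_mem_nhdsWithin).exists
    have hs2 : t1 < s := hs2
    have := hmax s (by linarith)
    linarith
  have h2 : φ (t1 - τ) ≤ 4 - φ t1 := by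
    by_contra h
    push Not at h
    have := incr_right hφ (sgn_right hD hF hD1 (by simp only [hD1]; linarith) (hgr t1 ht1τ))
    obtain ⟨s, hs, hs2⟩ := (this.and self_mem_nhdsWithin).exists
    have hs2 : t1 < s := hs2
    have := hmax s (by linarith)
    linarith
  have h3 := hfirst (t1 - τ) (by linarith) (by linarith)
  have h4 := hmin (t1 - τ) (by linarith)
  have h5 := hfirst1 (t0 - τ) hpos2 (by linarith)
  have : t0 = t1 := by linarith
  subst this
  linarith

lemma exist_prof {k c τ lam μ : ℝ} {e e' : ℝ → ℝ} (hk1 : 1 < k) (hk3 : k < 3) (hτ : 0 ≤ τ)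
    (hμ0 : 0 < μ) (hμ : μ ^ 2 - c * μ - 1 - Real.exp (-(μ * τ)) = 0)
    (M : Mode k c τ lam e e') (hlam : (3 - k) * μ ≤ 4 * lam) : ∃ φ D, Prof k c τ φ D := by
  have hlμ : lam < μ := root_lt_mu hk1 hμ0 hμ M.root.le
  have hell : ellE c τ μ e e' < 0 := M.ell μ hμ0 hμ
  have hratio : 4 / μ ≤ (k + 1) / (μ - lam) := by
    rw [div_le_div_iff₀ hμ0 (by linarith)]; linarith
  set B := ((k + 1) / (μ - lam) - 4 / μ) / (-ellE c τ μ e e') with hB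
  have hB0 : 0 ≤ B := div_nonneg (by linarith) (by linarith)
  have hBl : B * ellE c τ μ e e' = -((k + 1) / (μ - lam) - 4 / μ) := by
    rw [hB, div_neg, neg_mul, div_mul_cancel₀ _ hell.ne]
  have hid := ell_pB hk1 M hμ0 hμ B
  rw [hBl] at hid
  set κ := Real.exp (-(μ * τ)) with hκ
  have hκ0 : 0 < κ := Real.exp_pos _
  set b := μ - c with hb
  have hμb : μ * b = 1 + κ := by rw [hb]; linarith
  have hb0 : 0 < b := by
    by_contra h
    push Not at h
    nlinarith
  have hκe : κ * Real.exp (μ * τ) = 1 := by rw [hκ, ← Real.exp_add]; simp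
  have hW : κ * ((Real.exp (μ * τ) - 1) / μ) < b := by
    rw [← mul_div_assoc, div_lt_iff₀ hμ0]
    nlinarith
  set p := pB lam B e with hp
  set q := qB lam B e' with hq
  have hpc : Continuous p := M.cont_p B
  have hqc : Continuous q := M.cont_q B
  have hpd : ∀ t, HasDerivAt p (q t) t := M.hp B
  have hqd : ∀ t, HasDerivAt q (c * q t + p t - k * p (t - τ)) t := M.hq B
  have hQ : ∀ t s, t < s → q t ≤ 0 → q s < 0 := M.Q B hB0
  have hp0 : p 0 = 1 := by simp [hp, pB, M.e0]
  have hq0 : 0 < q 0 := by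
    by_contra h
    push Not at h
    have hple : ∀ t, 0 ≤ t → p t ≤ 1 := by
      intro t ht
      have := grow_bound (f := fun t => - p t) (f' := fun t => - q t) (C := 0) ht (by fun_prop)
        (fun x _ => (hpd x).neg) (fun x hx => by
          have := hQ 0 x hx.1 h
          linarith)
      linarith
    have hqτ : q τ ≤ 0 := by
      rcases hτ.eq_or_lt with h' | h'
      · rw [← h']; exact h
      · exact (hQ 0 τ h' h).le
    have hI : (∫ r in (0:ℝ)..τ, Real.exp (-(μ * r)) * (p r - 2)) ≤ 0 := by
      have : 0 ≤ ∫ r in (0:ℝ)..τ, -(Real.exp (-(μ * r)) * (p r - 2)) := by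
        refine intervalIntegral.integral_nonneg hτ fun r hr => ?_
        have h1 := hple r hr.1
        have := mul_nonneg (Real.exp_pos (-(μ * r))).le (show 0 ≤ 2 - p r by linarith)
        linarith
      rw [intervalIntegral.integral_neg] at this
      linarith
    have := hple τ hτ
    nlinarith
  have hqneg : ∀ t < 0, 0 < q t := by
    intro t ht
    by_contra h
    push Not at h
    have := hQ t 0 ht h
    linarith
  have hplt : ∀ t < 0, p t < 1 := by
    intro t ht
    have := strictMono_bound (f := p) (f' := q) ht hpc.continuousOn (fun x _ => hpd x)
      (fun x hx => hqneg x hx.2)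
    linarith
  have hppos : ∀ t ≤ 0, 0 < p t := by
    intro t ht
    have h1 : 0 ≤ e t := by
      rcases ht.eq_or_lt with h | h
      · rw [h, M.e0]
      · exact (M.epos t h).le
    have := mul_nonneg hB0 h1
    have := Real.exp_pos (lam * t)
    simp only [hp, pB]; linarith
  have hpbot : Tendsto p atBot (nhds 0) := by
    have := (tendsto_expm M.lam_pos).add (M.elim.const_mul B)
    rw [mul_zero, add_zero] at this
    exact this
  obtain ⟨z, hzc, hz0, hztop, hzd⟩ := solve3 (f := fun t => p t - 2) hb0 hκ0.le hμ0 hτ (by fun_prop) hW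
  have hLc := LL_cont (κ := κ) (γ := μ) (τ := τ) hzc
  have hLτ : LL κ μ τ z τ = ∫ r in (0:ℝ)..τ, Real.exp (-(μ * r)) * (p r - 2) := by
    rw [LL, ← mul_assoc, hκe, one_mul, sub_self]
    apply intervalIntegral.integral_congr
    intro r hr
    rw [uIcc_of_le hτ] at hr
    simp only
    rw [hz0 r hr.2]
  set φ : ℝ → ℝ := fun t => z t + 2 with hφdef
  set D : ℝ → ℝ := fun t => if t ≤ τ then q t else -(b * z t) - LL κ μ τ z t with hDdef
  have hDl : ∀ t ≤ τ, D t = q t := fun t ht => if_pos ht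
  have hDr : ∀ t > τ, D t = -(b * z t) - LL κ μ τ z t := fun t ht => if_neg (not_le.2 ht)
  have hφl : ∀ t ≤ τ, φ t = p t := by
    intro t ht
    simp only [hφdef]; rw [hz0 t ht]; ring
  have hDc : Continuous D := by
    refine Continuous.if_le hqc (by fun_prop) continuous_id continuous_const ?_
    intro x hx
    have hx : x = τ := hx
    rw [hx, hLτ, hz0 τ le_rfl]
    linarith
  have hφc : Continuous φ := by fun_prop
  have hφd : ∀ t, HasDerivAt φ (D t) t := by
    have hne : ∀ y, y ≠ τ → HasDerivAt φ (D y) y := by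
      intro y hy
      rcases lt_or_gt_of_ne hy with h | h
      · rw [hDl y h.le]
        refine (hpd y).congr_of_eventuallyEq ?_
        filter_upwards [gt_mem_nhds h] with s hs using hφl s hs.le
      · rw [hDr y h]
        exact (hzd y h).add_const 2
    intro t
    by_cases ht : t = τ
    · rw [ht]
      exact hasDerivAt_of_hasDerivAt_of_ne (fun y hy => hne y hy) hφc.continuousAt hDc.continuousAt
    · exact hne t ht
  have hl : ∀ t < τ, HasDerivAt D (c * D t + φ t - k * φ (t - τ)) t := by
    intro t ht
    rw [hDl t ht.le, hφl t ht.le, hφl (t - τ) (by linarith)]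
    refine (hqd t).congr_of_eventuallyEq ?_
    filter_upwards [gt_mem_nhds ht] with s hs using hDl s hs.le
  have hg : ∀ t > τ, HasDerivAt D (c * D t + φ t - (4 - φ (t - τ))) t := by
    intro t ht
    have hwc : Continuous (fun r => Real.exp (-(μ * r)) * z r) := by fun_prop
    have h1 := (((hasDerivAt_expm μ t).mul (hasDerivAt_int_delay hwc τ t)).const_mul κ)
    have h2 := ((hzd t ht).const_mul b).neg.sub h1
    have h3 : HasDerivAt D _ t := h2.congr_of_eventuallyEq (by
      filter_upwards [lt_mem_nhds ht] with s hs
      rw [hDr s hs]; rfl)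
    refine h3.congr_deriv ?_
    rw [hDr t ht]
    simp only [hφdef, LL]
    set I := ∫ r in (t - τ)..t, Real.exp (-(μ * r)) * z r
    have e1 : Real.exp (μ * t) * Real.exp (-(μ * t)) = 1 := by rw [← Real.exp_add]; simp
    have e2 : Real.exp (-(μ * (t - τ))) = Real.exp (-(μ * t)) * Real.exp (μ * τ) := by
      rw [← Real.exp_add]; ring_nf
    rw [e2]
    have hc' : c = μ - b := by rw [hb]; ring
    rw [hc']
    have hμb' : b * μ = 1 + κ := by linarith
    linear_combination (z t) * hμb' - κ * z t * e1 + κ * z (t - τ) * Real.exp (μ * τ) * e1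
      + z (t - τ) * hκe
  have htop : Tendsto φ atTop (nhds 2) := by
    have := hztop.add_const 2
    simpa using this
  have h0 : φ 0 = 1 := by rw [hφl 0 hτ, hp0]
  have hlt : ∀ t < 0, φ t < 1 := fun t ht => by rw [hφl t (by linarith)]; exact hplt t ht
  have hge := ge_one hk3 hk1 hτ hφd hDc htop h0 hlt (fun t s hts hs h => by
    rw [hDl s hs]; rw [hDl t (by linarith)] at h; exact hQ t s hts h) hl hg
  refine ⟨φ, D, hφd, hDc, ?_, ?_, htop, ?_, h0, hlt⟩
  · intro t
    by_cases ht : t ≤ 0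
    · rw [hφl t (by linarith)]; exact hppos t ht
    · have := hge t (by linarith)
      linarith
  · refine hpbot.congr' ?_
    filter_upwards [eventually_le_atBot τ] with t ht using (hφl t ht).symm
  · intro t ht
    rcases lt_trichotomy t τ with h | h | h
    · rw [gtoy, if_pos (hlt _ (by linarith))]; exact hl t h
    · exact absurd (by rw [h, sub_self, h0]) ht
    · rw [gtoy, if_neg (not_lt.2 (hge _ (by linarith)))]; exact hg t h


lemma RR_XX {k ρ m h c : ℝ} (hc : 0 < c) (hm : 0 < m) (hcc : CC m h = c) :
    RR k ρ m h = - XX k c (c * h) (ρ * (m / c)) := by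
  rw [RR_chi hc hm hcc (ρ * m) rfl, XX]
  have e1 : (ρ * (m / c)) ^ 2 = (ρ * m) ^ 2 / c ^ 2 := by field_simp
  have e2 : c * (ρ * (m / c)) = ρ * m := by field_simp
  have e3 : ρ * (m / c) * (c * h) = ρ * m * h := by field_simp
  rw [e1, e2, e3]

lemma mu_eq {m h c : ℝ} (hc : 0 < c) (hm : 0 < m) (hcc : CC m h = c) :
    (m / c) ^ 2 - c * (m / c) - 1 - Real.exp (-(m / c * (c * h))) = 0 := by
  have h1 := CC_sq (h := h) hm
  rw [hcc] at h1
  have e3 : m / c * (c * h) = m * h := by field_simp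
  have e2 : c * (m / c) = m := by field_simp
  have e1 : (m / c) ^ 2 = 1 + m + Real.exp (-(m * h)) := by
    rw [div_pow, div_eq_iff (by positivity)]; linarith
  rw [e1, e2, e3]; ring

lemma CC_le_iff {m m' h : ℝ} (hm : 0 < m) (hm' : 0 < m') (hh : 0 ≤ h) : CC m h ≤ CC m' h ↔ m ≤ m' := by
  constructor
  · intro h1
    by_contra h2
    push Not at h2
    have := CC_strict hm' hh h2
    linarith
  · intro h1
    rcases h1.eq_or_lt with h | h
    · rw [h]
    · exact (CC_strict hm hh h).le

lemma csharp_eq {k h c m0 : ℝ} (hk : 1 < k) (hh : 0 ≤ h) (hm0 : IsThr k 0 h m0) (hC : IsCsharp k h c) :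
    c = CC m0 h := by
  obtain ⟨hc, z, hz, hz1, hz2⟩ := hC
  obtain ⟨m, hm, hcc⟩ := CC_surj hc hh
  rw [chi_eq_XX] at hz1
  have hz2' : 2 * z - c - k * (c * h) * Real.exp (-(z * (c * h))) = 0 := by
    rw [← mul_assoc z, ← mul_assoc k]; exact hz2
  have hμ0 : 0 < m / c := div_pos hm hc
  have hμ := mu_eq hc hm hcc
  have hzμ := root_lt_mu hk hμ0 hμ hz1.le
  have h1 : m0 ≤ m := by
    refine (hm0.2 m hm).1 ⟨z / (m / c), ⟨by positivity, ?_⟩, ?_⟩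
    · exact ((div_lt_one hμ0).2 hzμ).le
    · rw [RR_XX hc hm hcc, div_mul_cancel₀ _ hμ0.ne', hz1]; simp
  rcases h1.eq_or_lt with h | h
  · rw [h, hcc]
  · exfalso
    obtain ⟨ρ, -, hρ0, hρ1, hR⟩ := thr_attained hk le_rfl hm0
    have := RR_strict hk hρ0 hρ1 hh h
    rw [RR_XX hc hm hcc] at this
    have h3 := XX_dbl hk hz1 hz2' (q := ρ * (m / c)) (by linarith)
    rw [h3, hz1] at this
    linarith

lemma wave_nec {k c h m : ℝ} {φ : ℝ → ℝ} (hk : 1 < k) (hk3 : k < 3) (hh : 0 ≤ h) (W : ToyWavefront k c h φ)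
    (hm : IsThr k ((3 - k) / 4) h m) : CC m h ≤ c := by
  obtain ⟨s, P⟩ := W.prof
  have hc := P.c_pos hk hh
  have hτ : 0 ≤ c * h := by positivity
  obtain ⟨q, hq⟩ := P.XX_neg hk hc hτ
  obtain ⟨lam, e, e', M⟩ := mode_exists hk hc hτ hq
  obtain ⟨m', hm', hcc⟩ := CC_surj hc hh
  have hμ0 : 0 < m' / c := div_pos hm' hc
  have hμ := mu_eq hc hm' hcc
  obtain ⟨B, hB, h1, h2⟩ := P.expl M
  have hcond := P.cond hk hk3 hτ hμ0 hμ M h1 h2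
  have hell : ellE c (c * h) (m' / c) e e' < 0 := M.ell _ hμ0 hμ
  have hlμ := root_lt_mu hk hμ0 hμ M.root.le
  have hle : 4 / (m' / c) ≤ (k + 1) / (m' / c - lam) := by nlinarith
  rw [div_le_div_iff₀ hμ0 (by linarith)] at hle
  rw [← hcc, CC_le_iff hm.1 hm' hh]
  refine (hm.2 m' hm').1 ⟨lam / (m' / c), ⟨?_, ?_⟩, ?_⟩
  · rw [le_div_iff₀ hμ0]; linarith
  · exact ((div_lt_one hμ0).2 hlμ).le
  · rw [RR_XX hc hm' hcc, div_mul_cancel₀ _ hμ0.ne', M.root]; simp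

lemma Prof.wave {k c h : ℝ} {φ D : ℝ → ℝ} (P : Prof k c (c * h) φ D) : ToyWavefront k c h φ := by
  have hd : deriv φ = D := funext fun t => (P.hφ t).deriv
  refine ⟨?_, P.pos, P.bot, P.top, ?_⟩
  · rw [contDiff_one_iff_deriv, hd]
    exact ⟨fun t => (P.hφ t).differentiableAt, P.hD⟩
  · rw [hd]; exact P.eq

lemma wave_suf {k c h m : ℝ} (hk : 1 < k) (hk3 : k < 3) (hh : 0 ≤ h)
    (hm : IsThr k ((3 - k) / 4) h m) (hle : CC m h ≤ c) : ∃ φ, ToyWavefront k c h φ := by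
  have hc : 0 < c := (CC_pos hm.1).trans_le hle
  have hτ : 0 ≤ c * h := by positivity
  obtain ⟨m', hm', hcc⟩ := CC_surj hc hh
  rw [← hcc, CC_le_iff hm.1 hm' hh] at hle
  obtain ⟨ρ, hρ, hR⟩ := (hm.2 m' hm').2 hle
  rw [RR_XX hc hm' hcc] at hR
  obtain ⟨lam, e, e', M⟩ := mode_exists hk hc hτ (q := ρ * (m' / c)) (by linarith)
  have hl := M.largest _ (show XX k c (c * h) (ρ * (m' / c)) ≤ 0 by linarith)
  have hμ0 : 0 < m' / c := div_pos hm' hc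
  have := mul_le_mul_of_nonneg_right hρ.1 hμ0.le
  obtain ⟨φ, D, P⟩ := exist_prof hk hk3 hτ hμ0 (mu_eq hc hm' hcc) M (by linarith)
  exact ⟨φ, P.wave⟩

lemma wave_unique {k c h : ℝ} {φ ψ : ℝ → ℝ} (hk : 1 < k) (hk3 : k < 3) (hh : 0 ≤ h)
    (W : ToyWavefront k c h φ) (V : ToyWavefront k c h ψ) : ∃ s : ℝ, ∀ t : ℝ, ψ t = φ (t + s) := by
  obtain ⟨s, P⟩ := W.prof
  obtain ⟨r, R⟩ := V.prof
  have hc := P.c_pos hk hh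
  have hτ : 0 ≤ c * h := by positivity
  obtain ⟨q, hq⟩ := P.XX_neg hk hc hτ
  obtain ⟨lam, e, e', M⟩ := mode_exists hk hc hτ hq
  obtain ⟨m', hm', hcc⟩ := CC_surj hc hh
  have hμ0 : 0 < m' / c := div_pos hm' hc
  have hu := P.unique hk hk3 hτ hμ0 (mu_eq hc hm' hcc) R M
  refine ⟨s - r, fun t => ?_⟩
  have := hu (t - r)
  rw [show t - r + s = t + (s - r) by ring, show t - r + r = t by ring] at this
  exact this.symm

lemma nonlin_m {k c h : ℝ} {φ : ℝ → ℝ} (hk : 1 < k) (hk3 : k < 3) (hh : 0 ≤ h)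
    (W : ToyWavefront k c h φ) (N : NonlinDetermined k c h φ) :
    ∃ m, 0 < m ∧ CC m h = c ∧ RR k ((3 - k) / 4) m h = 0 := by
  obtain ⟨s, P⟩ := W.prof
  have hc := P.c_pos hk hh
  have hτ : 0 ≤ c * h := by positivity
  obtain ⟨q, hq⟩ := P.XX_neg hk hc hτ
  obtain ⟨lam, e, e', M⟩ := mode_exists hk hc hτ hq
  obtain ⟨m', hm', hcc⟩ := CC_surj hc hh
  have hμ0 : 0 < m' / c := div_pos hm' hc
  have hμ := mu_eq hc hm' hcc
  obtain ⟨B, hB, h1, h2⟩ := P.expl M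
  have hcond := P.cond hk hk3 hτ hμ0 hμ M h1 h2
  obtain ⟨lam1, s0, σ, hl0, hl1, hl2, hσ, hO⟩ := N
  rw [chi_eq_XX] at hl1
  have hle1 := M.largest lam1 hl1.le
  have hle2 := hl2 lam M.lam_pos (by rw [chi_eq_XX]; exact M.root)
  have hll : lam1 = lam := le_antisymm hle1 hle2
  subst hll
  have hB0 := M.nonlin_B hB hσ h1 hO
  rw [hB0, zero_mul, add_zero] at hcond
  have hlμ := root_lt_mu hk hμ0 hμ M.root.le
  rw [div_eq_div_iff (by linarith) hμ0.ne'] at hcond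
  refine ⟨m', hm', hcc, ?_⟩
  rw [RR_XX hc hm' hcc, show (3 - k) / 4 * (m' / c) = lam1 by linarith, M.root]; simp

theorem toy_aux
    (k : ℝ) (hk1 : 1 < k) (hk3 : k < 3)
    (csharp : ℝ → ℝ)
    (hcsharp : ∀ h : ℝ, 0 ≤ h →
      IsCsharp k h (csharp h) ∧ ∀ c : ℝ, IsCsharp k h c → c = csharp h) :
    ∃ cstar : ℝ → ℝ,
      ContinuousOn cstar (Ici 0) ∧ StrictAntiOn cstar (Ici 0) ∧
      (∀ h : ℝ, 0 ≤ h → 0 < cstar h) ∧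
      (∀ h : ℝ, 0 ≤ h → ∀ c : ℝ, (∃ φ : ℝ → ℝ, ToyWavefront k c h φ) ↔ cstar h ≤ c) ∧
      (k < 5 / 3 →
        (∀ h : ℝ, 0 ≤ h → csharp h < cstar h) ∨
        (∃ hp : ℝ, 0 < hp ∧ (∀ h : ℝ, 0 ≤ h → h < hp → csharp h < cstar h) ∧
          ¬ csharp hp < cstar hp)) ∧
      (∀ h : ℝ, 0 ≤ h → ∀ c : ℝ, ∀ φ ψ : ℝ → ℝ,
        ToyWavefront k c h φ → ToyWavefront k c h ψ →
        ∃ s : ℝ, ∀ t : ℝ, ψ t = φ (t + s)) ∧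
      (∀ h : ℝ, 0 ≤ h → ∀ c₁ c₂ : ℝ, ∀ φ ψ : ℝ → ℝ,
        ToyWavefront k c₁ h φ → ToyWavefront k c₂ h ψ →
        NonlinDetermined k c₁ h φ → NonlinDetermined k c₂ h ψ →
        c₁ = c₂ ∧ ∃ s : ℝ, ∀ t : ℝ, ψ t = φ (t + s)) := by
  have hθ : 0 < (3 - k) / 4 := by linarith
  have hθ1 : (3 - k) / 4 < 1 / 2 := by linarith
  have ex1 : ∀ h, ∃ m, 0 ≤ h → IsThr k ((3 - k) / 4) h m := by
    intro h
    by_cases hh : 0 ≤ h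
    · obtain ⟨m, hm⟩ := thr_exists hk1 hθ.le hθ1 hh
      exact ⟨m, fun _ => hm⟩
    · exact ⟨0, fun h' => absurd h' hh⟩
  have ex0 : ∀ h, ∃ m, 0 ≤ h → IsThr k 0 h m := by
    intro h
    by_cases hh : 0 ≤ h
    · obtain ⟨m, hm⟩ := thr_exists hk1 le_rfl (by norm_num : (0:ℝ) < 1 / 2) hh
      exact ⟨m, fun _ => hm⟩
    · exact ⟨0, fun h' => absurd h' hh⟩
  choose ms hms using ex1
  choose m0 hm0 using ex0
  have hcs : ∀ h, 0 ≤ h → csharp h = CC (m0 h) h := fun h hh =>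
    csharp_eq hk1 hh (hm0 h hh) (hcsharp h hh).1
  have hcont1 := thr_cont hk1 hθ.le hms
  have hcont0 := thr_cont hk1 le_rfl hm0
  refine ⟨fun h => CC (ms h) h, hcont1, thr_anti hk1 hθ.le hms, fun h hh => CC_pos (hms h hh).1,
    fun h hh c => ⟨?_, ?_⟩, ?_, ?_, ?_⟩
  · rintro ⟨φ, W⟩
    exact wave_nec hk1 hk3 hh W (hms h hh)
  · intro hle
    exact wave_suf hk1 hk3 hh (hms h hh) hle
  · intro hk5
    have h00 : CC (m0 0) 0 < CC (ms 0) 0 :=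
      CC_strict (hm0 0 le_rfl).1 le_rfl (thr_k53 hk1 hk5 (hm0 0 le_rfl) (hms 0 le_rfl))
    by_cases hall : ∀ h : ℝ, 0 ≤ h → csharp h < CC (ms h) h
    · exact Or.inl hall
    · right
      set S : Set ℝ := Ici 0 ∩ {h | CC (ms h) h ≤ CC (m0 h) h} with hS
      have hScl : IsClosed S := by
        have : S = Ici 0 ∩ (fun h => CC (ms h) h - CC (m0 h) h) ⁻¹' (Iic 0) := by
          ext h; simp [hS]
        rw [this]
        exact (hcont1.sub hcont0).preimage_isClosed_of_isClosed isClosed_Ici isClosed_Iic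
      have hSne : S.Nonempty := by
        push Not at hall
        obtain ⟨h, hh, hl⟩ := hall
        rw [hcs h hh] at hl
        exact ⟨h, hh, hl⟩
      have hSb : BddBelow S := ⟨0, fun x hx => hx.1⟩
      have hmem := hScl.csInf_mem hSne hSb
      have hne : sInf S ≠ 0 := by
        intro h
        rw [h] at hmem
        have h2 : CC (ms 0) 0 ≤ CC (m0 0) 0 := hmem.2
        linarith
      have hge : 0 ≤ sInf S := hmem.1
      refine ⟨sInf S, lt_of_le_of_ne hge (Ne.symm hne), fun h hh hlt => ?_, ?_⟩
      · rw [hcs h hh]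
        by_contra hcon
        push Not at hcon
        have : sInf S ≤ h := csInf_le hSb ⟨hh, hcon⟩
        linarith
      · rw [hcs _ hge]
        exact not_lt.2 hmem.2
  · intro h hh c φ ψ W V
    exact wave_unique hk1 hk3 hh W V
  · intro h hh c₁ c₂ φ ψ W V N N'
    obtain ⟨m, hm, hcc, hR⟩ := nonlin_m hk1 hk3 hh W N
    obtain ⟨m', hm', hcc', hR'⟩ := nonlin_m hk1 hk3 hh V N'
    have hmm : m = m' := by
      rcases lt_trichotomy m m' with h1 | h1 | h1
      · have := RR_strict (ρ := (3 - k) / 4) hk1 hθ (by linarith) hh h1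
        linarith
      · exact h1
      · have := RR_strict (ρ := (3 - k) / 4) hk1 hθ (by linarith) hh h1
        linarith
    have hc12 : c₁ = c₂ := by rw [← hcc, ← hcc', hmm]
    subst hc12
    exact ⟨rfl, wave_unique hk1 hk3 hh W V⟩

/-- For the toy model with `k ∈ (1,3)` there is a continuous strictly decreasing positive
minimal speed function `c_*`, such that a wavefront of speed `c` exists iff `c ≥ c_*(h)`;
if `k ∈ (1,5/3)` there is a maximal `h_p ∈ (0,+∞]` with `c_*(h) > c_#(h)` on `[0,h_p)`;
each wavefront is unique up to translation, and for each `h` there is at most one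
non-linearly determined wavefront. -/
theorem toy_model_structure
    (k : ℝ) (hk1 : 1 < k) (hk3 : k < 3)
    (csharp : ℝ → ℝ)
    (hcsharp : ∀ h : ℝ, 0 ≤ h →
      IsCsharp k h (csharp h) ∧ ∀ c : ℝ, IsCsharp k h c → c = csharp h) :
    ∃ cstar : ℝ → ℝ,
      ContinuousOn cstar (Ici 0) ∧ StrictAntiOn cstar (Ici 0) ∧
      (∀ h : ℝ, 0 ≤ h → 0 < cstar h) ∧
      (∀ h : ℝ, 0 ≤ h → ∀ c : ℝ, (∃ φ : ℝ → ℝ, ToyWavefront k c h φ) ↔ cstar h ≤ c) ∧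
      (k < 5 / 3 →
        (∀ h : ℝ, 0 ≤ h → csharp h < cstar h) ∨
        (∃ hp : ℝ, 0 < hp ∧ (∀ h : ℝ, 0 ≤ h → h < hp → csharp h < cstar h) ∧
          ¬ csharp hp < cstar hp)) ∧
      (∀ h : ℝ, 0 ≤ h → ∀ c : ℝ, ∀ φ ψ : ℝ → ℝ,
        ToyWavefront k c h φ → ToyWavefront k c h ψ →
        ∃ s : ℝ, ∀ t : ℝ, ψ t = φ (t + s)) ∧
      (∀ h : ℝ, 0 ≤ h → ∀ c₁ c₂ : ℝ, ∀ φ ψ : ℝ → ℝ,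
        ToyWavefront k c₁ h φ → ToyWavefront k c₂ h ψ →
        NonlinDetermined k c₁ h φ → NonlinDetermined k c₂ h ψ →
        c₁ = c₂ ∧ ∃ s : ℝ, ∀ t : ℝ, ψ t = φ (t + s)) := by
  exact toy_aux k hk1 hk3 csharp hcsharp
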